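/- arXiv:1912.11911 — 11 statements merged into one kernel-verified Lean document; each statement's English description precedes it below -/
import Mathlib

section
/- Let T be a finite abelian group. For every pair (β, μ) where β: T × T → {±1} is an alternating bicharacter and μ: T_{[2]} → {±1} is a quadratic form with polarization β restricted to T_{[2]} × T_{[2]} (i.e., μ(e) may be arbitrary in {±1} with μ(gh) = β(g,h)μ(g)μ(h) for all g,h ∈ T_{[2]}, and μ(e)=1), there exists a graded-division algebra D = ⊕_{t∈T} D_t over ℝ, unique up to isomorphism of graded algebras, such that: (i) dim_ℝ D_t = 1 for all t ∈ T; (ii) xy = β(s,t) yx for all x ∈ D_s, y ∈ D_t; and (iii) x^{o(t)} ∈ μ(t^{o(t)/2})·ℝ_{>0} for every nonzero x ∈ D_t with o(t) even. Conversely, every graded-division algebra over ℝ with support T and 1-dimensional homogeneous components is graded-isomorphic to exactly one such algebra D(T,β,μ); in particular, its structure constants determine an alternating bicharacter β with values in {±1} and its restriction function μ on T_{[2]} is a quadratic form with polarization β|_{T_{[2]}×T_{[2]}}. -/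
universe u

/-- A bundled graded-division algebra over `ℝ` graded by the finite abelian group `T`. -/
structure RealGradedDivAlg (T : Type u) [CommGroup T] [DecidableEq T] : Type (u + 1) where
  carrier : Type u
  [ringC : Ring carrier]
  [algC : Algebra ℝ carrier]
  comp : T → Submodule ℝ carrier
  internal : DirectSum.IsInternal comp
  one_mem : (1 : carrier) ∈ comp 1
  mul_mem : ∀ {g h : T} {x y : carrier}, x ∈ comp g → y ∈ comp h → x * y ∈ comp (g * h)
  div : ∀ (g : T), ∀ x ∈ comp g, x ≠ 0 → IsUnit x

attribute [instance] RealGradedDivAlg.ringC RealGradedDivAlg.algC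

variable {T : Type u} [CommGroup T] [DecidableEq T]

/-- `β` is an alternating bicharacter on `T` with values in `{±1} ⊆ ℝ^×`. -/
def IsAltBicharPM (β : T → T → ℝˣ) : Prop :=
  (∀ s t u : T, β (s * t) u = β s u * β t u) ∧
  (∀ s t u : T, β s (t * u) = β s t * β s u) ∧
  (∀ t : T, β t t = 1) ∧
  (∀ s t : T, β s t = 1 ∨ β s t = -1)

/-- `μ : T_{[2]} → {±1}` is a quadratic form with polarization `β|_{T_{[2]} × T_{[2]}}`:
`μ(e) = 1`, `μ` takes values `±1` on `T_{[2]}`, and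
`μ(gh) = β(g,h) μ(g) μ(h)` for all `g, h ∈ T_{[2]}`. -/
def IsQuadFormPM (β : T → T → ℝˣ) (μ : T → ℝˣ) : Prop :=
  (μ 1 = 1) ∧
  (∀ t : T, t ^ 2 = 1 → (μ t = 1 ∨ μ t = -1)) ∧
  (∀ g h : T, g ^ 2 = 1 → h ^ 2 = 1 → μ (g * h) = β g h * μ g * μ h)

/-- `𝒟` has `1`-dimensional components, commutation governed by `β`, and
`x^{o(t)} ∈ μ(t^{o(t)/2})·ℝ_{>0}` for every nonzero homogeneous `x` of degree `t`
with even order. -/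
def RSatisfies (𝒟 : RealGradedDivAlg T) (β : T → T → ℝˣ) (μ : T → ℝˣ) : Prop :=
  (∀ t : T, Module.finrank ℝ (𝒟.comp t) = 1) ∧
  (∀ (s t : T) (x y : 𝒟.carrier), x ∈ 𝒟.comp s → y ∈ 𝒟.comp t →
      x * y = ((β s t : ℝˣ) : ℝ) • (y * x)) ∧
  (∀ t : T, Even (orderOf t) → ∀ x ∈ 𝒟.comp t, x ≠ 0 →
      ∃ r : ℝ, 0 < r ∧ x ^ orderOf t =
        algebraMap ℝ 𝒟.carrier (((μ (t ^ (orderOf t / 2)) : ℝˣ) : ℝ) * r))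

/-- A graded isomorphism between bundled real graded algebras. -/
def RGradedIso (𝒟 𝒟' : RealGradedDivAlg T) : Prop :=
  ∃ e : 𝒟.carrier ≃ₐ[ℝ] 𝒟'.carrier, ∀ (t : T) (x : 𝒟.carrier), x ∈ 𝒟.comp t → e x ∈ 𝒟'.comp t


open Module

/-- Over any ring, an alternating bilinear map on a free module is the antisymmetrization of a
bilinear map. -/
theorem LinearMap.exists_eq_sub_flip {k V N : Type*} [CommRing k] [AddCommGroup V] [Module k V]
    [Module.Free k V] [AddCommGroup N] [Module k N] (B : V →ₗ[k] V →ₗ[k] N) (hB : B.IsAlt) :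
    ∃ C : V →ₗ[k] V →ₗ[k] N, B = C - C.flip := by
  classical
  let b := Module.Free.chooseBasis k V
  let _ : LinearOrder (Module.Free.ChooseBasisIndex k V) := linearOrderOfSTO WellOrderingRel
  refine ⟨b.constr k fun i => b.constr k fun j => if i < j then B (b i) (b j) else 0, ?_⟩
  refine b.ext fun i => b.ext fun j => ?_
  simp only [LinearMap.sub_apply, LinearMap.flip_apply, Basis.constr_basis]
  rcases lt_trichotomy i j with h | rfl | h
  · simp [h, h.not_gt]
  · simp [hB (b i)]
  · simp [h, h.not_gt, hB.neg]

section Signs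

variable {G : Type*} [CommGroup G]

/-- Sign characters of an abelian group detect the elements that are not squares. -/
theorem exists_monoidHom_intUnits_eq_neg_one {g : G} (hg : ¬ IsSquare g) :
    ∃ χ : G →* ℤˣ, χ g = -1 := by
  have hne : ModN.mkQ 2 (Additive.ofMul g) ≠ 0 := by
    intro h
    obtain ⟨a, ha⟩ := (Submodule.Quotient.mk_eq_zero _).1 h
    refine hg ⟨a.toMul, ?_⟩
    have := congrArg Additive.toMul ha
    simpa [pow_two] using this.symm
  obtain ⟨d, hd⟩ := not_forall.1 fun h =>
    hne ((Module.forall_dual_apply_eq_zero_iff (ZMod 2) (ModN.mkQ 2 (Additive.ofMul g))).1 h)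
  refine ⟨⟨⟨fun x => (-1 : ℤˣ) ^ d (ModN.mkQ 2 (Additive.ofMul x)), by simp⟩, fun x y => ?_⟩, ?_⟩
  · simp [uzpow_add]
  · have h1 : d (ModN.mkQ 2 (Additive.ofMul g)) = 1 := by
      generalize d _ = z at hd; revert z; decide
    simp [h1]

/-- An alternating sign-valued bicharacter is the symmetrization of a bicharacter. -/
theorem exists_bicharacter_mul_swap (β : G →* G →* ℤˣ) (hβ : ∀ g, β g g = 1) :
    ∃ γ : G →* G →* ℤˣ, ∀ g h, β g h = γ g h * γ h g := by
  have h2 (a : Additive ℤˣ) : 2 • a = 0 := Int.units_pow_two a.toMul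
  have h2' (f : ModN (Additive G) 2 →ₗ[ZMod 2] Additive ℤˣ) : 2 • f = 0 :=
    LinearMap.ext fun v => h2 (f v)
  have hmk : Function.Surjective (ModN.mkQ 2 : Additive G → ModN (Additive G) 2) :=
    Submodule.mkQ_surjective _
  let β₁ : Additive G →+ (ModN (Additive G) 2 →ₗ[ZMod 2] Additive ℤˣ) :=
    AddMonoidHom.mk' (fun g => ModN.liftEquiv'.symm ⟨(β g.toMul).toAdditive, fun _ => h2 _⟩)
      fun g h => LinearMap.ext <| hmk.forall.2 fun x =>
        congrArg Additive.ofMul (DFunLike.congr_fun (map_mul β g.toMul h.toMul) x.toMul)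
  let B : ModN (Additive G) 2 →ₗ[ZMod 2] ModN (Additive G) 2 →ₗ[ZMod 2] Additive ℤˣ :=
    ModN.liftEquiv'.symm ⟨β₁, fun _ => h2' _⟩
  have hB (g h : G) : B (ModN.mkQ 2 (.ofMul g)) (ModN.mkQ 2 (.ofMul h)) = .ofMul (β g h) := rfl
  obtain ⟨C, hC⟩ := B.exists_eq_sub_flip <|
    hmk.forall.2 fun g => congrArg Additive.ofMul (hβ g.toMul)
  let γ (g h : G) : ℤˣ := (C (ModN.mkQ 2 (.ofMul g)) (ModN.mkQ 2 (.ofMul h))).toMul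
  refine ⟨MonoidHom.mk' (fun g => MonoidHom.mk' (γ g) fun h h' => ?_) fun g g' => ?_, fun g h => ?_⟩
  · simp [γ]
  · ext h; simp [γ]
  · apply Additive.ofMul.injective
    rw [← hB, hC]
    simpa [γ, sub_eq_add_neg] using neg_eq_iff_add_eq_zero.2 ((two_nsmul _).symm.trans (h2 _))

end Signs

/-- The sign of a nonzero real number, as an integer unit. -/
noncomputable def Real.unitsSign : ℝˣ →* ℤˣ where
  toFun a := if 0 < (a : ℝ) then 1 else -1
  map_one' := by simp
  map_mul' a b := by
    rcases lt_or_gt_of_ne a.ne_zero with ha | ha <;>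
    rcases lt_or_gt_of_ne b.ne_zero with hb | hb <;>
    simp [ha, hb, ha.not_gt, hb.not_gt, mul_pos_iff]

/-- A normalized `2`-cocycle on `G` with values in `ℝˣ` (with trivial action). -/
structure RealCocycle (G : Type*) [CommGroup G] where
  /-- The underlying function. -/
  val : G → G → ℝˣ
  one_left : ∀ g, val 1 g = 1
  one_right : ∀ g, val g 1 = 1
  cocycle : ∀ g h k, val g h * val (g * h) k = val h k * val g (h * k)

namespace RealCocycle

variable {G : Type*} [CommGroup G]

/-- The abelian extension of `G` by `ℝˣ` defined by a symmetric cocycle. -/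
@[ext] structure Ext (c : RealCocycle G) where
  /-- The image in `G`. -/
  base : G
  /-- The coordinate in `ℝˣ`. -/
  coeff : ℝˣ

/-- The group structure on the extension defined by a symmetric cocycle. -/
abbrev extCommGroup (c : RealCocycle G) (hc : ∀ g h, c.val g h = c.val h g) :
    CommGroup c.Ext where
  mul x y := ⟨x.base * y.base, c.val x.base y.base * (x.coeff * y.coeff)⟩
  one := ⟨1, 1⟩
  inv x := ⟨x.base⁻¹, (c.val x.base⁻¹ x.base * x.coeff)⁻¹⟩
  mul_assoc x y z := Ext.ext (mul_assoc _ _ _) <| by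
    change c.val (x.base * y.base) z.base * (c.val x.base y.base * (x.coeff * y.coeff) * z.coeff) =
      c.val x.base (y.base * z.base) * (x.coeff * (c.val y.base z.base * (y.coeff * z.coeff)))
    calc _ = c.val x.base y.base * c.val (x.base * y.base) z.base *
            (x.coeff * y.coeff * z.coeff) := by ac_rfl
      _ = _ := by rw [c.cocycle]; ac_rfl
  one_mul x := Ext.ext (one_mul _) <| by
    change c.val 1 x.base * (1 * x.coeff) = x.coeff
    simp [c.one_left]
  mul_one x := Ext.ext (mul_one _) <| by
    change c.val x.base 1 * (x.coeff * 1) = x.coeff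
    simp [c.one_right]
  inv_mul_cancel x := Ext.ext (inv_mul_cancel _) <| by
    change c.val x.base⁻¹ x.base * ((c.val x.base⁻¹ x.base * x.coeff)⁻¹ * x.coeff) = 1
    simp [mul_inv_rev, mul_comm]
  mul_comm x y := Ext.ext (mul_comm _ _) <| by
    change c.val x.base y.base * (x.coeff * y.coeff) = c.val y.base x.base * (y.coeff * x.coeff)
    rw [hc, mul_comm x.coeff]

/-- A symmetric cocycle that is positive on `(g, g)` for all `g` with `g ^ 2 = 1` has the sign of
a coboundary. -/
theorem exists_sign_eq (c : RealCocycle G) (hc : ∀ g h, c.val g h = c.val h g)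
    (hpos : ∀ g, g ^ 2 = 1 → 0 < (c.val g g : ℝ)) :
    ∃ f : G → ℤˣ, ∀ g h, Real.unitsSign (c.val g h) * f (g * h) = f g * f h := by
  let _ := c.extCommGroup hc
  have mul_def (x y : c.Ext) :
      x * y = ⟨x.base * y.base, c.val x.base y.base * (x.coeff * y.coeff)⟩ := rfl
  let i : ℝˣ →* c.Ext := MonoidHom.mk' (fun a => ⟨1, a⟩) fun a b => by simp [mul_def, c.one_left]
  have hsq : ¬ IsSquare (i (-1)) := by
    rintro ⟨x, hx⟩
    have h1 : x.base ^ 2 = 1 := (pow_two x.base).trans (congrArg Ext.base hx).symm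
    have h2 : (-1 : ℝ) = c.val x.base x.base * (x.coeff * x.coeff) := by
      simpa [mul_def, i] using congrArg (fun y : c.Ext => (y.coeff : ℝ)) hx
    have := hpos _ h1
    nlinarith [mul_nonneg this.le (mul_self_nonneg (x.coeff : ℝ))]
  obtain ⟨χ, hχ⟩ := exists_monoidHom_intUnits_eq_neg_one hsq
  have hpos' (a : ℝˣ) (ha : 0 < (a : ℝ)) : χ (i a) = 1 := by
    have h : a = Units.mk0 (√a) (Real.sqrt_pos.2 ha).ne' * Units.mk0 (√a) (Real.sqrt_pos.2 ha).ne' :=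
      Units.ext (Real.mul_self_sqrt ha.le).symm
    rw [h, map_mul, map_mul, Int.units_mul_self]
  have hχi (a : ℝˣ) : χ (i a) = Real.unitsSign a := by
    rcases lt_or_gt_of_ne a.ne_zero with ha | ha
    · rw [← neg_neg a, ← neg_one_mul, map_mul, map_mul, hχ, hpos' _ (by simpa using ha)]
      simp [Real.unitsSign, ha.not_gt]
    · rw [hpos' a ha]
      simp [Real.unitsSign, ha]
  refine ⟨fun g => χ ⟨g, 1⟩, fun g h => ?_⟩
  simp only [← hχi, ← map_mul]
  simp [mul_def, i, c.one_left]

/-- The absolute value of a cocycle on a finite group is a coboundary. -/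
theorem exists_abs_eq [Finite G] (c : RealCocycle G) :
    ∃ f : G → ℝ, (∀ g, 0 < f g) ∧ ∀ g h, |(c.val g h : ℝ)| * f (g * h) = f g * f h := by
  have := Fintype.ofFinite G
  let F (g : G) : ℝ := ∏ u, |(c.val g u : ℝ)|
  have hF (g : G) : 0 < F g := Finset.prod_pos fun u _ => abs_pos.2 (c.val g u).ne_zero
  have hFmul (g h : G) : |(c.val g h : ℝ)| ^ Fintype.card G * F (g * h) = F g * F h := by
    calc _ = ∏ u, |(c.val g h : ℝ)| * |(c.val (g * h) u : ℝ)| := by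
          rw [Finset.prod_mul_distrib, Finset.prod_const, Finset.card_univ]
      _ = ∏ u, |(c.val h u : ℝ)| * |(c.val g (h * u) : ℝ)| := by
          refine Finset.prod_congr rfl fun u _ => ?_
          rw [← abs_mul, ← abs_mul, ← Units.val_mul, ← Units.val_mul, c.cocycle]
      _ = F g * F h := by
          rw [Finset.prod_mul_distrib, mul_comm,
            Fintype.prod_equiv (Equiv.mulLeft h) (fun u => |(c.val g (h * u) : ℝ)|)
              (fun u => |(c.val g u : ℝ)|) fun _ => rfl]
  refine ⟨fun g => F g ^ ((Fintype.card G : ℝ)⁻¹), fun g => Real.rpow_pos_of_pos (hF g) _,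
    fun g h => ?_⟩
  rw [← Real.mul_rpow (hF g).le (hF h).le, ← hFmul,
    Real.mul_rpow (by positivity) (hF _).le, Real.pow_rpow_inv_natCast (abs_nonneg _)
      Fintype.card_ne_zero]

/-- A symmetric cocycle on a finite group that is positive on `(g, g)` for all `g` with
`g ^ 2 = 1` is a coboundary. -/
theorem exists_coboundary_of_symm [Finite G] (c : RealCocycle G)
    (hc : ∀ g h, c.val g h = c.val h g) (hpos : ∀ g, g ^ 2 = 1 → 0 < (c.val g g : ℝ)) :
    ∃ f : G → ℝˣ, ∀ g h, c.val g h * f (g * h) = f g * f h := by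
  obtain ⟨s, hs⟩ := c.exists_sign_eq hc hpos
  obtain ⟨a, ha, hac⟩ := c.exists_abs_eq
  refine ⟨fun g => Units.map (Int.castRingHom ℝ).toMonoidHom (s g) * Units.mk0 (a g) (ha g).ne',
    fun g h => ?_⟩
  have key : c.val g h = Units.map (Int.castRingHom ℝ).toMonoidHom (Real.unitsSign (c.val g h)) *
      Units.mk0 |(c.val g h : ℝ)| (abs_pos.2 (c.val g h).ne_zero).ne' := by
    ext
    rcases lt_or_gt_of_ne (c.val g h).ne_zero with h | h
    · simp [Real.unitsSign, h.not_gt, abs_of_neg h]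
    · simp [Real.unitsSign, h, abs_of_pos h]
  rw [key, mul_mul_mul_comm, ← map_mul, hs, mul_mul_mul_comm (Units.map _ (s g)), ← map_mul]
  congr 1
  exact Units.ext (hac g h)

/-- The product of two cocycles. -/
instance : Mul (RealCocycle G) where
  mul c d :=
    { val g h := c.val g h * d.val g h
      one_left g := by simp [c.one_left, d.one_left]
      one_right g := by simp [c.one_right, d.one_right]
      cocycle g h k := by
        rw [mul_mul_mul_comm, c.cocycle, d.cocycle, mul_mul_mul_comm] }

/-- The inverse of a cocycle. -/
instance : Inv (RealCocycle G) where
  inv c :=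
    { val g h := (c.val g h)⁻¹
      one_left g := by simp [c.one_left]
      one_right g := by simp [c.one_right]
      cocycle g h k := by rw [← mul_inv, c.cocycle, mul_inv] }

@[simp] theorem mul_val (c d : RealCocycle G) (g h : G) :
    (c * d).val g h = c.val g h * d.val g h := rfl

@[simp] theorem inv_val (c : RealCocycle G) (g h : G) : c⁻¹.val g h = (c.val g h)⁻¹ := rfl

/-- The cocycle given by a bicharacter with values `±1`. -/
def ofBicharacter (γ : G →* G →* ℤˣ) : RealCocycle G where
  val g h := Units.map (Int.castRingHom ℝ).toMonoidHom (γ g h)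
  one_left g := by simp
  one_right g := by simp
  cocycle g h k := by
    simp only [map_mul, MonoidHom.mul_apply]
    ac_rfl

/-- Every character of the `2`-torsion subgroup is realized as the diagonal of a symmetric
cocycle. -/
theorem exists_symm_val_self_eq [Finite G] (χ : (powMonoidHom 2 : G →* G).ker →* ℝˣ) :
    ∃ c : RealCocycle G, (∀ g h, c.val g h = c.val h g) ∧
      ∀ g : (powMonoidHom 2 : G →* G).ker, c.val g g = χ g := by
  have : NeZero (Monoid.exponent G : ℂ) :=
    ⟨Nat.cast_ne_zero.2 Monoid.exponent_ne_zero_of_finite⟩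
  obtain ⟨ψ, hψ⟩ := MonoidHom.domRestrict_surjective ℂ (powMonoidHom 2 : G →* G).ker
    ((Units.map (algebraMap ℝ ℂ).toMonoidHom).comp χ)
  let z (g : G) : ℂ := (ψ g : ℂ) ^ ((2 : ℕ) : ℂ)⁻¹
  have hz (g : G) : z g ^ 2 = ψ g := Complex.cpow_nat_inv_pow _ two_ne_zero
  have hz0 (g : G) : z g ≠ 0 := fun h => (ψ g).ne_zero <| by rw [← hz, h, zero_pow two_ne_zero]
  have hz1 : z 1 = 1 := by simp [z]
  have hε (g h : G) : ∃ ε : ℝˣ, ((ε : ℝ) : ℂ) * z (g * h) = z g * z h := by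
    have h2 : (z g * z h) ^ 2 = z (g * h) ^ 2 := by
      rw [mul_pow, hz, hz, hz, map_mul, Units.val_mul]
    rcases sq_eq_sq_iff_eq_or_eq_neg.1 h2 with h | h
    · exact ⟨1, by simp [h]⟩
    · exact ⟨-1, by simp [h]⟩
  choose ε hε using hε
  have hinj {a b : ℝˣ} (h : ((a : ℝ) : ℂ) = (b : ℝ)) : a = b :=
    Units.ext (Complex.ofReal_injective h)
  have hεeq (g h : G) : ((ε g h : ℝ) : ℂ) = z g * z h / z (g * h) :=
    eq_div_of_mul_eq (hz0 _) (hε g h)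
  refine ⟨⟨ε, fun g => hinj ?_, fun g => hinj ?_, fun g h k => hinj ?_⟩, fun g h => hinj ?_,
    fun g => hinj ?_⟩
  · simp [hεeq, hz1, hz0]
  · simp [hεeq, hz1, hz0]
  · simp only [Units.val_mul, Complex.ofReal_mul, hεeq, mul_assoc g h k]
    have := hz0 (g * h)
    have := hz0 (h * k)
    have := hz0 (g * (h * k))
    field_simp
  · simp only [hεeq, mul_comm]
  · have hg : (g : G) * g = 1 := (pow_two (g : G)).symm.trans g.2
    have := congrArg Units.val (DFunLike.congr_fun hψ g)
    rw [hεeq, hg, hz1, div_one, ← pow_two, hz]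
    exact this

end RealCocycle

namespace RealCocycle

section TwistedAlgebra

variable {G : Type*} [CommGroup G]

/-- The twisted group algebra of a cocycle: the real vector space with basis `G`. -/
def TwistedAlgebra (_c : RealCocycle G) : Type _ := G →₀ ℝ

variable (c : RealCocycle G)

noncomputable instance : AddCommGroup c.TwistedAlgebra :=
  inferInstanceAs (AddCommGroup (G →₀ ℝ))

noncomputable instance : Module ℝ c.TwistedAlgebra :=
  inferInstanceAs (Module ℝ (G →₀ ℝ))

/-- The standard basis of the twisted group algebra. -/
noncomputable def stdBasis : Basis G ℝ c.TwistedAlgebra := Finsupp.basisSingleOne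

/-- The multiplication of the twisted group algebra as a bilinear map. -/
noncomputable def mulLin : c.TwistedAlgebra →ₗ[ℝ] c.TwistedAlgebra →ₗ[ℝ] c.TwistedAlgebra :=
  c.stdBasis.constr ℝ fun g => c.stdBasis.constr ℝ fun h => (c.val g h : ℝ) • c.stdBasis (g * h)

theorem mulLin_basis (g h : G) :
    c.mulLin (c.stdBasis g) (c.stdBasis h) = (c.val g h : ℝ) • c.stdBasis (g * h) := by
  simp [mulLin, Basis.constr_basis]

theorem mulLin_assoc (x y z : c.TwistedAlgebra) :
    c.mulLin (c.mulLin x y) z = c.mulLin x (c.mulLin y z) := by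
  have h : c.mulLin.compr₂ c.mulLin =
      (LinearMap.llcomp ℝ _ _ _).compl₁₂ c.mulLin c.mulLin := by
    refine c.stdBasis.ext fun g => c.stdBasis.ext fun h => c.stdBasis.ext fun k => ?_
    simp only [LinearMap.compr₂_apply, LinearMap.compl₁₂_apply, LinearMap.llcomp_apply,
      mulLin_basis, map_smul, LinearMap.smul_apply, smul_smul, mul_assoc g h k]
    rw [← Units.val_mul, ← Units.val_mul, c.cocycle]
  exact congrArg (fun f => f x y z) h

noncomputable instance : Ring c.TwistedAlgebra where
  __ := (inferInstance : AddCommGroup c.TwistedAlgebra)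
  mul x y := c.mulLin x y
  one := c.stdBasis 1
  left_distrib x y z := map_add (c.mulLin x) y z
  right_distrib x y z := c.mulLin.map_add₂ x y z
  zero_mul x := c.mulLin.map_zero₂ x
  mul_zero x := map_zero (c.mulLin x)
  mul_assoc := c.mulLin_assoc
  one_mul x := by
    have h : c.mulLin (c.stdBasis 1) = LinearMap.id :=
      c.stdBasis.ext fun g => by simp [mulLin_basis, c.one_left]
    exact congrArg (fun f => f x) h
  mul_one x := by
    have h : c.mulLin.flip (c.stdBasis 1) = LinearMap.id :=
      c.stdBasis.ext fun g => by simp [mulLin_basis, c.one_right]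
    exact congrArg (fun f => f x) h

noncomputable instance : Algebra ℝ c.TwistedAlgebra :=
  Algebra.ofModule (fun a x y => c.mulLin.map_smul₂ a x y) fun a x y => map_smul (c.mulLin x) a y

theorem stdBasis_mul (g h : G) :
    c.stdBasis g * c.stdBasis h = (c.val g h : ℝ) • c.stdBasis (g * h) :=
  c.mulLin_basis g h

theorem stdBasis_one : c.stdBasis 1 = 1 := rfl

theorem isUnit_stdBasis (g : G) : IsUnit (c.stdBasis g) := by
  refine isUnit_iff_exists_and_exists.2
    ⟨⟨(c.val g g⁻¹ : ℝ)⁻¹ • c.stdBasis g⁻¹, ?_⟩, ⟨(c.val g⁻¹ g : ℝ)⁻¹ • c.stdBasis g⁻¹, ?_⟩⟩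
  · rw [mul_smul_comm, stdBasis_mul, mul_inv_cancel, stdBasis_one, smul_smul,
      inv_mul_cancel₀ (Units.ne_zero _), one_smul]
  · rw [smul_mul_assoc, stdBasis_mul, inv_mul_cancel, stdBasis_one, smul_smul,
      inv_mul_cancel₀ (Units.ne_zero _), one_smul]

end TwistedAlgebra

section Graded

/-- The twisted group algebra of a cocycle as a graded-division algebra. -/
noncomputable def gradedDivAlg (c : RealCocycle T) : RealGradedDivAlg T where
  carrier := c.TwistedAlgebra
  comp t := ℝ ∙ c.stdBasis t
  internal := (DirectSum.isInternal_submodule_iff_iSupIndep_and_iSup_eq_top _).2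
    ⟨c.stdBasis.linearIndependent.iSupIndep_span_singleton, by
      rw [← Submodule.span_range_eq_iSup, c.stdBasis.span_eq]⟩
  one_mem := Submodule.mem_span_singleton_self _
  mul_mem hx hy := by
    obtain ⟨a, rfl⟩ := Submodule.mem_span_singleton.1 hx
    obtain ⟨b, rfl⟩ := Submodule.mem_span_singleton.1 hy
    rw [smul_mul_smul_comm, stdBasis_mul]
    exact Submodule.smul_mem _ _ (Submodule.smul_mem _ _ (Submodule.mem_span_singleton_self _))
  div g x hx hx0 := by
    obtain ⟨a, rfl⟩ := Submodule.mem_span_singleton.1 hx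
    have ha : a ≠ 0 := left_ne_zero_of_smul hx0
    exact (c.isUnit_stdBasis g).smul (Units.mk0 a ha)

/-- `b` is a homogeneous basis of `𝒟` with structure constants `c`. -/
structure IsFrame (c : RealCocycle T) (𝒟 : RealGradedDivAlg T) (b : Basis T ℝ 𝒟.carrier) :
    Prop where
  comp_eq : ∀ t, 𝒟.comp t = ℝ ∙ b t
  map_one : b 1 = 1
  map_mul : ∀ s t, b s * b t = (c.val s t : ℝ) • b (s * t)

theorem isFrame_stdBasis (c : RealCocycle T) : c.IsFrame c.gradedDivAlg c.stdBasis where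
  comp_eq _ := rfl
  map_one := rfl
  map_mul := c.stdBasis_mul

/-- A graded-division algebra with one-dimensional components has a homogeneous basis. -/
theorem exists_isFrame (𝒟 : RealGradedDivAlg T)
    (h𝒟 : ∀ t, Module.finrank ℝ (𝒟.comp t) = 1) :
    ∃ (c : RealCocycle T) (b : Basis T ℝ 𝒟.carrier), c.IsFrame 𝒟 b := by
  have hne : Nontrivial 𝒟.carrier := by
    obtain ⟨v, hv, -⟩ := finrank_eq_one_iff'.1 (h𝒟 1)
    exact ⟨v, 0, fun h => hv (Subtype.ext h)⟩
  have hspan (t : T) {v : 𝒟.carrier} (hv : v ∈ 𝒟.comp t) (hv0 : v ≠ 0) : 𝒟.comp t = ℝ ∙ v := by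
    refine le_antisymm (fun w hw => ?_) ((Submodule.span_singleton_le_iff_mem _ _).2 hv)
    obtain ⟨a, ha⟩ := (finrank_eq_one_iff_of_nonzero' (⟨v, hv⟩ : 𝒟.comp t)
      fun h => hv0 (congrArg Subtype.val h)).1 (h𝒟 t) ⟨w, hw⟩
    exact Submodule.mem_span_singleton.2 ⟨a, congrArg Subtype.val ha⟩
  have hx (t : T) : ∃ v ∈ 𝒟.comp t, v ≠ 0 ∧ (t = 1 → v = 1) := by
    by_cases ht : t = 1
    · exact ⟨1, ht ▸ 𝒟.one_mem, one_ne_zero, fun _ => rfl⟩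
    · obtain ⟨v, hv, -⟩ := finrank_eq_one_iff'.1 (h𝒟 t)
      exact ⟨v, v.2, fun h => hv (Subtype.ext h), fun h => (ht h).elim⟩
  choose x hx hx0 hx1 using hx
  have hcomp (t : T) := hspan t (hx t) (hx0 t)
  have hmul (s t : T) : ∃ a : ℝˣ, x s * x t = (a : ℝ) • x (s * t) := by
    have hmem := 𝒟.mul_mem (hx s) (hx t)
    rw [hcomp] at hmem
    obtain ⟨a, ha⟩ := Submodule.mem_span_singleton.1 hmem
    have hne : x s * x t ≠ 0 := ((𝒟.div s _ (hx s) (hx0 s)).mul (𝒟.div t _ (hx t) (hx0 t))).ne_zero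
    exact ⟨Units.mk0 a (left_ne_zero_of_smul (ha ▸ hne)), ha.symm⟩
  choose σ hσ using hmul
  have hcancel (t : T) {a b : ℝˣ} (h : (a : ℝ) • x t = (b : ℝ) • x t) : a = b :=
    Units.ext (smul_left_injective ℝ (hx0 t) h)
  refine ⟨⟨σ, fun g => hcancel g ?_, fun g => hcancel g ?_, fun g h k =>
    hcancel (g * (h * k)) ?_⟩, Basis.mk (v := x) ?_ ?_, ?_⟩
  · simpa [hx1 1 rfl] using (hσ 1 g).symm
  · simpa [hx1 1 rfl] using (hσ g 1).symm
  · have := mul_assoc (x g) (x h) (x k)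
    rw [hσ, hσ, smul_mul_assoc, mul_smul_comm, hσ, hσ, smul_smul, smul_smul, mul_assoc] at this
    exact_mod_cast this
  · exact 𝒟.internal.submodule_iSupIndep.linearIndependent _ hx hx0
  · rw [Submodule.span_range_eq_iSup, ← 𝒟.internal.submodule_iSup_eq_top]
    exact iSup_mono fun t => (hcomp t).le
  · exact ⟨by simpa using hcomp, by simpa using hx1 1 rfl, by simpa using hσ⟩

namespace IsFrame

variable {c : RealCocycle T} {𝒟 : RealGradedDivAlg T} {b : Basis T ℝ 𝒟.carrier}

theorem finrank_comp (h : c.IsFrame 𝒟 b) (t : T) : Module.finrank ℝ (𝒟.comp t) = 1 := by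
  rw [h.comp_eq]
  exact finrank_span_singleton (b.ne_zero t)

theorem exists_pow_eq (h : c.IsFrame 𝒟 b) (t : T) (n : ℕ) :
    ∃ a : ℝˣ, b t ^ n = (a : ℝ) • b (t ^ n) := by
  induction n with
  | zero => exact ⟨1, by simp [h.map_one]⟩
  | succ n ih =>
    obtain ⟨a, ha⟩ := ih
    exact ⟨a * c.val (t ^ n) t, by
      rw [pow_succ, ha, smul_mul_assoc, h.map_mul, smul_smul, pow_succ, Units.val_mul]⟩

theorem sq_eq (h : c.IsFrame 𝒟 b) {g : T} (hg : g ^ 2 = 1) :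
    b g ^ 2 = algebraMap ℝ 𝒟.carrier (c.val g g) := by
  rw [pow_two, h.map_mul, ← pow_two, hg, h.map_one, Algebra.algebraMap_eq_smul_one]

/-- The conditions defining `D(T, β, μ)` in terms of structure constants. -/
theorem rSatisfies_iff (h : c.IsFrame 𝒟 b) {β : T → T → ℝˣ} {μ : T → ℝˣ} (hμ : μ 1 = 1) :
    RSatisfies 𝒟 β μ ↔ (∀ s t, c.val s t = β s t * c.val t s) ∧
      ∀ g, g ^ 2 = 1 → 0 < (μ g * c.val g g : ℝ) := by
  have hnt : Nontrivial 𝒟.carrier := ⟨b 1, 0, b.ne_zero 1⟩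
  have hmem (t : T) : b t ∈ 𝒟.comp t := h.comp_eq t ▸ Submodule.mem_span_singleton_self _
  constructor
  · rintro ⟨-, h2, h3⟩
    refine ⟨fun s t => Units.ext (smul_left_injective ℝ (b.ne_zero (s * t)) ?_), fun g hg => ?_⟩
    · have := h2 s t _ _ (hmem s) (hmem t)
      rw [h.map_mul, h.map_mul, smul_smul, mul_comm t s] at this
      exact_mod_cast this
    · by_cases hg1 : g = 1
      · simp [hg1, hμ, c.one_left]
      · have ho : orderOf g = 2 := orderOf_eq_prime hg hg1
        obtain ⟨r, hr, hr'⟩ := h3 g (ho ▸ even_two) _ (hmem g) (b.ne_zero g)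
        rw [ho, h.sq_eq hg, Nat.div_self two_pos, pow_one] at hr'
        rw [(algebraMap ℝ 𝒟.carrier).injective hr', ← mul_assoc]
        exact mul_pos (mul_self_pos.2 (μ g).ne_zero) hr
  · rintro ⟨h1, h2⟩
    refine ⟨h.finrank_comp, fun s t x y hx hy => ?_, fun t ht x hx hx0 => ?_⟩
    · rw [h.comp_eq] at hx hy
      obtain ⟨a, rfl⟩ := Submodule.mem_span_singleton.1 hx
      obtain ⟨d, rfl⟩ := Submodule.mem_span_singleton.1 hy
      rw [smul_mul_smul_comm, smul_mul_smul_comm, h.map_mul, h.map_mul, h1, mul_comm t s,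
        smul_smul, smul_smul, smul_smul, Units.val_mul]
      congr 1
      ring
    · rw [h.comp_eq] at hx
      obtain ⟨a, rfl⟩ := Submodule.mem_span_singleton.1 hx
      have ha : a ≠ 0 := left_ne_zero_of_smul hx0
      have hdiv := Nat.div_mul_cancel ht.two_dvd
      have hg : (t ^ (orderOf t / 2)) ^ 2 = 1 := by rw [← pow_mul, hdiv, pow_orderOf_eq_one]
      obtain ⟨k, hk⟩ := h.exists_pow_eq t (orderOf t / 2)
      set g := t ^ (orderOf t / 2)
      have hpos := h2 g hg
      refine ⟨(a ^ (orderOf t / 2) * k / μ g) ^ 2 * (μ g * c.val g g), ?_, ?_⟩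
      · have := k.ne_zero
        have := (μ g).ne_zero
        positivity
      · rw [← hdiv, pow_mul, hdiv, smul_pow, hk, smul_smul, smul_pow, h.sq_eq hg,
          Algebra.smul_def, ← _root_.map_mul]
        congr 1
        have := (μ g).ne_zero
        field_simp

/-- Graded-division algebras with cohomologous structure constants are isomorphic. -/
theorem rGradedIso {c' : RealCocycle T} {𝒟' : RealGradedDivAlg T} {b' : Basis T ℝ 𝒟'.carrier}
    (h : c.IsFrame 𝒟 b) (h' : c'.IsFrame 𝒟' b') (f : T → ℝˣ)
    (hf : ∀ s t, (c * c'⁻¹).val s t * f (s * t) = f s * f t) : RGradedIso 𝒟 𝒟' := by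
  let e : 𝒟.carrier ≃ₗ[ℝ] 𝒟'.carrier := b.equiv (b'.unitsSMul f) (Equiv.refl T)
  have he (t : T) : e (b t) = (f t : ℝ) • b' t := by
    simp [e, Basis.unitsSMul_apply, Units.smul_def]
  have hf1 : f 1 = 1 := by simpa [c.one_left, c'.one_left] using hf 1 1
  have hmul : (LinearMap.mul ℝ 𝒟.carrier).compr₂ e.toLinearMap =
      (LinearMap.mul ℝ 𝒟'.carrier).compl₁₂ e.toLinearMap e.toLinearMap := by
    refine b.ext fun s => b.ext fun t => ?_
    change e (b s * b t) = e (b s) * e (b t)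
    rw [h.map_mul, map_smul, he, he, he, smul_mul_smul_comm, h'.map_mul, smul_smul, smul_smul]
    congr 1
    have := hf s t
    rw [mul_val, inv_val, mul_right_comm, mul_inv_eq_iff_eq_mul] at this
    exact_mod_cast this
  have hmul' (x y : 𝒟.carrier) : e (x * y) = e x * e y := congrArg (fun φ => φ x y) hmul
  have hone : e 1 = 1 := by
    rw [← h.map_one, he, hf1, h'.map_one, Units.val_one, one_smul]
  refine ⟨AlgEquiv.ofLinearEquiv e hone hmul', fun t x hx => ?_⟩
  rw [h.comp_eq] at hx
  obtain ⟨a, rfl⟩ := Submodule.mem_span_singleton.1 hx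
  rw [h'.comp_eq, AlgEquiv.ofLinearEquiv_apply, map_smul, he]
  exact Submodule.smul_mem _ _ (Submodule.smul_mem _ _ (Submodule.mem_span_singleton_self _))

end IsFrame

end Graded

section Commutation

variable {G : Type*} [CommGroup G] (c : RealCocycle G)

/-- The commutation factor of a cocycle. -/
def comm (g h : G) : ℝˣ := c.val g h / c.val h g

theorem comm_mul_left (g h k : G) : c.comm (g * h) k = c.comm g k * c.comm h k := by
  have h1 := c.cocycle g h k
  have h2 := c.cocycle k g h
  have h3 := c.cocycle g k h
  rw [mul_comm k g] at h2
  rw [mul_comm k h] at h3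
  rw [comm, comm, comm, div_mul_div_comm, div_eq_div_iff_mul_eq_mul]
  apply mul_left_cancel (a := c.val g h * c.val (g * k) h)
  simp only [Units.ext_iff, Units.val_mul] at *
  linear_combination (c.val (g * k) h * c.val k g * c.val k h : ℝ) * h1 +
    (c.val h k * c.val g (h * k) * c.val k h : ℝ) * h2 -
    (c.val h k * c.val k (g * h) * c.val g h : ℝ) * h3

theorem comm_swap (g h : G) : c.comm g h = (c.comm h g)⁻¹ := (inv_div _ _).symm

theorem comm_self (g : G) : c.comm g g = 1 := div_self' _

theorem comm_mul_right (g h k : G) : c.comm g (h * k) = c.comm g h * c.comm g k := by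
  rw [comm_swap, comm_mul_left, mul_inv, ← comm_swap, ← comm_swap]

theorem comm_eq_one_or [Finite G] (g h : G) : c.comm g h = 1 ∨ c.comm g h = -1 := by
  let φ : G →* ℝˣ := MonoidHom.mk' (fun g => c.comm g h) fun g g' => c.comm_mul_left g g' h
  have hpow : c.comm g h ^ Nat.card G = 1 := by
    have : φ g ^ Nat.card G = 1 := by rw [← map_pow, pow_card_eq_one', map_one]
    exact this
  have habs : |(c.comm g h : ℝ)| = 1 := by
    rw [← pow_eq_one_iff_of_nonneg (abs_nonneg _) (Nat.card_pos (α := G)).ne', ← abs_pow,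
      ← Units.val_pow_eq_pow_val, hpow, Units.val_one, abs_one]
  rcases (abs_eq zero_le_one).1 habs with h | h
  · exact Or.inl (Units.ext h)
  · exact Or.inr (Units.ext (by simpa using h))

theorem isAltBicharPM_comm [Finite T] (c : RealCocycle T) : IsAltBicharPM c.comm :=
  ⟨c.comm_mul_left, c.comm_mul_right, c.comm_self, c.comm_eq_one_or⟩

theorem val_mul_self (g : G) {h : G} (hh : h ^ 2 = 1) :
    c.val (g * h) (g * h) * (c.val g h * c.val h g) = c.val g g * c.val h h := by
  have h1 := c.cocycle g h (g * h)
  have h2 := c.cocycle h h g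
  rw [← pow_two, hh, c.one_left, mul_one, mul_comm h g] at h2
  rw [mul_left_comm h g h, ← pow_two, hh, mul_one] at h1
  rw [← mul_assoc, mul_comm (c.val (g * h) (g * h)), h1, h2]
  ac_rfl

end Commutation

/-- The signs on the diagonal of a cocycle. -/
noncomputable def diagSign {G : Type*} [CommGroup G] (c : RealCocycle G) (g : G) : ℝˣ :=
  if 0 < (c.val g g : ℝ) then 1 else -1

theorem diagSign_mul_pos {G : Type*} [CommGroup G] (c : RealCocycle G) (g : G) :
    0 < (c.diagSign g * c.val g g : ℝ) := by
  rcases lt_or_gt_of_ne (c.val g g).ne_zero with h | h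
  · simp [diagSign, h.not_gt, h]
  · simp [diagSign, h]

theorem diagSign_eq_one_or {G : Type*} [CommGroup G] (c : RealCocycle G) (g : G) :
    c.diagSign g = 1 ∨ c.diagSign g = -1 := by
  unfold diagSign; split_ifs <;> simp

end RealCocycle

/-- Two signs are equal as soon as their products with some real number are both positive. -/
theorem units_eq_of_mul_pos {a b : ℝˣ} (ha : a = 1 ∨ a = -1) (hb : b = 1 ∨ b = -1) {x : ℝ}
    (hax : 0 < (a * x : ℝ)) (hbx : 0 < (b * x : ℝ)) : a = b := by
  rcases ha with rfl | rfl <;> rcases hb with rfl | rfl <;> simp at hax hbx ⊢ <;> linarith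

namespace RealCocycle

theorem isQuadFormPM_diagSign [Finite T] (c : RealCocycle T) : IsQuadFormPM c.comm c.diagSign := by
  refine ⟨by simp [diagSign, c.one_left], fun t _ => c.diagSign_eq_one_or t, fun g h hg hh => ?_⟩
  have hgh := congrArg Units.val (c.val_mul_self g hh)
  refine units_eq_of_mul_pos (c.diagSign_eq_one_or _) ?_ (c.diagSign_mul_pos _) ?_
  · rcases c.comm_eq_one_or g h with h1 | h1 <;> rcases c.diagSign_eq_one_or g with h2 | h2 <;>
      rcases c.diagSign_eq_one_or h with h3 | h3 <;> simp [h1, h2, h3]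
  · have hpos := mul_pos (c.diagSign_mul_pos g) (c.diagSign_mul_pos h)
    simp only [Units.val_mul] at hgh ⊢
    have h1 : (c.val (g * h) (g * h) : ℝ) = c.val g g * c.val h h / (c.val g h * c.val h g) :=
      eq_div_of_mul_eq (mul_ne_zero (Units.ne_zero _) (Units.ne_zero _)) hgh
    have h2 : (c.comm g h * c.diagSign g * c.diagSign h * c.val (g * h) (g * h) : ℝ) =
        c.diagSign g * c.val g g * (c.diagSign h * c.val h h) * ((c.val h g : ℝ)⁻¹) ^ 2 := by
      have := (c.val g h).ne_zero
      have := (c.val h g).ne_zero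
      rw [h1, comm, Units.val_div_eq_div_val]
      field_simp
    rw [h2]
    have := (c.val h g).ne_zero
    positivity

/-- Every alternating bicharacter and compatible quadratic form come from a cocycle. -/
theorem exists_of_isQuadFormPM [Finite T] {β : T → T → ℝˣ} {μ : T → ℝˣ} (hβ : IsAltBicharPM β)
    (hμ : IsQuadFormPM β μ) :
    ∃ c : RealCocycle T, (∀ s t, c.val s t = β s t * c.val t s) ∧
      ∀ g, g ^ 2 = 1 → 0 < (μ g * c.val g g : ℝ) := by
  obtain ⟨hl, hr, hs, hpm⟩ := hβ
  obtain ⟨hμ1, hμpm, hμmul⟩ := hμ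
  let ι : ℤˣ →* ℝˣ := Units.map (Int.castRingHom ℝ).toMonoidHom
  have hι {a : ℝˣ} (ha : a = 1 ∨ a = -1) : ι (Real.unitsSign a) = a := by
    rcases ha with rfl | rfl <;> ext <;> norm_num [ι, Real.unitsSign]
  obtain ⟨γ, hγ⟩ := exists_bicharacter_mul_swap
    (MonoidHom.mk' (fun s => MonoidHom.mk' (fun t => Real.unitsSign (β s t))
      fun t t' => by rw [hr, map_mul]) fun s s' => by ext t; simp [hl])
    fun t => by simp [hs]
  replace hγ (s t : T) : β s t = ι (γ s t) * ι (γ t s) := by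
    rw [← map_mul, ← hγ, MonoidHom.mk'_apply, MonoidHom.mk'_apply, hι (hpm s t)]
  have hιsq (a : ℤˣ) : ι a * ι a = 1 := by rw [← map_mul, Int.units_mul_self, map_one]
  obtain ⟨d, hd, hdχ⟩ := exists_symm_val_self_eq
    (MonoidHom.mk' (fun g => μ g * ι (γ g g)) fun g h => by
      have e := hμmul g h g.2 h.2
      rw [hγ] at e
      simp only [Subgroup.coe_mul, map_mul, MonoidHom.mul_apply, e]
      calc _ = ι (γ g h) * ι (γ g h) * (ι (γ h g) * ι (γ h g)) *
            (μ g * ι (γ g g) * (μ h * ι (γ h h))) := by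
              simp only [mul_comm, mul_left_comm]
        _ = _ := by rw [hιsq, hιsq, one_mul, one_mul] : (powMonoidHom 2 : T →* T).ker →* ℝˣ)
  refine ⟨ofBicharacter γ * d, fun s t => ?_, fun g hg => ?_⟩
  · change ι (γ s t) * d.val s t = β s t * (ι (γ t s) * d.val t s)
    rw [hγ, hd t s, ← mul_assoc, mul_assoc (ι (γ s t)), hιsq, mul_one]
  · have h1 : (ofBicharacter γ * d).val g g = μ g := by
      change ι (γ g g) * d.val g g = μ g
      rw [hdχ ⟨g, hg⟩]
      change ι (γ g g) * (μ g * ι (γ g g)) = μ g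
      rw [mul_left_comm, hιsq, mul_one]
    rw [h1]
    exact mul_self_pos.2 (μ g).ne_zero

end RealCocycle

/-- Let `T` be a finite abelian group.  For every alternating
bicharacter `β : T × T → {±1}` and every quadratic form `μ : T_{[2]} → {±1}` with
polarization `β|_{T_{[2]} × T_{[2]}}` there is a graded-division algebra `D(T, β, μ)`
over `ℝ`, unique up to graded isomorphism, with `1`-dimensional components,
commutation relations governed by `β`, and `x^{o(t)} ∈ μ(t^{o(t)/2}) ℝ_{>0}` for
nonzero homogeneous `x` of even-order degree `t`.  Conversely, every graded-division
algebra over `ℝ` with support `T` and `1`-dimensional components is of this form for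
exactly one pair `(β, μ)`. -/
theorem stmt8 [Finite T] :
    (∀ (β : T → T → ℝˣ) (μ : T → ℝˣ), IsAltBicharPM β → IsQuadFormPM β μ →
      (∃ 𝒟 : RealGradedDivAlg T, RSatisfies 𝒟 β μ) ∧
      (∀ 𝒟 𝒟' : RealGradedDivAlg T, RSatisfies 𝒟 β μ → RSatisfies 𝒟' β μ →
        RGradedIso 𝒟 𝒟')) ∧
    (∀ 𝒞 : RealGradedDivAlg T, (∀ t : T, Module.finrank ℝ (𝒞.comp t) = 1) →
      ∃ (β : T → T → ℝˣ) (μ : T → ℝˣ), IsAltBicharPM β ∧ IsQuadFormPM β μ ∧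
        RSatisfies 𝒞 β μ ∧
        ∀ (β' : T → T → ℝˣ) (μ' : T → ℝˣ), IsAltBicharPM β' → IsQuadFormPM β' μ' →
          RSatisfies 𝒞 β' μ' →
          β' = β ∧ ∀ t : T, t ^ 2 = 1 → μ' t = μ t) := by
  refine ⟨fun β μ hβ hμ => ⟨?_, fun 𝒟 𝒟' h h' => ?_⟩, fun 𝒞 h𝒞 => ?_⟩
  · obtain ⟨c, hc⟩ := RealCocycle.exists_of_isQuadFormPM hβ hμ
    exact ⟨c.gradedDivAlg, (c.isFrame_stdBasis.rSatisfies_iff hμ.1).2 hc⟩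
  · obtain ⟨c, b, hb⟩ := RealCocycle.exists_isFrame 𝒟 h.1
    obtain ⟨c', b', hb'⟩ := RealCocycle.exists_isFrame 𝒟' h'.1
    obtain ⟨h1, h2⟩ := (hb.rSatisfies_iff hμ.1).1 h
    obtain ⟨h1', h2'⟩ := (hb'.rSatisfies_iff hμ.1).1 h'
    obtain ⟨f, hf⟩ := (c * c'⁻¹).exists_coboundary_of_symm
      (fun s t => by
        rw [RealCocycle.mul_val, RealCocycle.mul_val, RealCocycle.inv_val, RealCocycle.inv_val,
          h1 s t, h1' s t, mul_inv, mul_mul_mul_comm, mul_inv_cancel, one_mul])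
      fun g hg => by
        have := mul_pos (h2 g hg) (inv_pos.2 (h2' g hg))
        have hμ0 := (μ g).ne_zero
        rw [mul_inv, mul_mul_mul_comm, mul_inv_cancel₀ hμ0, one_mul] at this
        simpa using this
    exact hb.rGradedIso hb' f hf
  · obtain ⟨c, b, hb⟩ := RealCocycle.exists_isFrame 𝒞 h𝒞
    have hμ := c.isQuadFormPM_diagSign
    refine ⟨c.comm, c.diagSign, c.isAltBicharPM_comm, hμ, (hb.rSatisfies_iff hμ.1).2
      ⟨fun s t => (div_mul_cancel _ _).symm, fun g _ => c.diagSign_mul_pos g⟩,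
      fun β' μ' _ hμ' h' => ?_⟩
    obtain ⟨h1, h2⟩ := (hb.rSatisfies_iff hμ'.1).1 h'
    exact ⟨funext fun s => funext fun t => eq_div_of_mul_eq' (h1 s t).symm, fun t ht =>
      units_eq_of_mul_pos (hμ'.2.1 t ht) (c.diagSign_eq_one_or t) (h2 t ht) (c.diagSign_mul_pos t)⟩
end

section
/- Let K be a finite abelian group and let C = ⊕_{s∈K} C_s be a graded-division algebra over ℂ with 1-dimensional homogeneous components and support K, whose associated alternating bicharacter β takes values in {±1} (equivalently, C admits a real form: there exist nonzero homogeneous X_s ∈ C_s, s ∈ K, with X_s^{o(s)} = 1, spanning a real graded subalgebra C_ℝ with C = C_ℝ ⊗_ℝ ℂ). Then every ℂ-antilinear automorphism ψ of C as a graded algebra (i.e., a ring automorphism with ψ(C_s) = C_s for all s ∈ K and ψ(λx) = λ̄ ψ(x) for λ ∈ ℂ) is involutive: ψ² = id. -/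
/-- In a one-dimensional submodule, every vector is a multiple of any given nonzero one. -/
theorem Submodule.exists_smul_eq_of_finrank_eq_one {F V : Type*} [Field F] [AddCommGroup V]
    [Module F V] {W : Submodule F V} (hW : Module.finrank F W = 1) {x y : V}
    (hx : x ∈ W) (hx0 : x ≠ 0) (hy : y ∈ W) : ∃ c : F, c • x = y := by
  have hx0' : (⟨x, hx⟩ : W) ≠ 0 := fun h => hx0 (congrArg Subtype.val h)
  obtain ⟨c, hc⟩ := (finrank_eq_one_iff_of_nonzero' _ hx0').1 hW ⟨y, hy⟩
  exact ⟨c, congrArg Subtype.val hc⟩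

/-- If a conjugate-linear ring endomorphism scales `x` by `l`, and some positive power of `x` is a
nonzero scalar, then `l` has norm one. -/
theorem norm_eq_one_of_map_eq_smul {C : Type*} [Ring C] [Nontrivial C] [Algebra ℂ C]
    (ψ : C →+* C) (hψ : ∀ (l : ℂ) (x : C), ψ (l • x) = (starRingEnd ℂ l) • ψ x)
    {x : C} {l c : ℂ} {n : ℕ} (hn : n ≠ 0) (hc : c ≠ 0) (hxl : ψ x = l • x)
    (hxn : x ^ n = c • (1 : C)) : ‖l‖ = 1 := by
  have h : (starRingEnd ℂ c) • (1 : C) = (l ^ n * c) • (1 : C) := by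
    rw [← map_one ψ, ← hψ, ← hxn, map_pow, hxl, smul_pow, hxn, smul_smul, map_one]
  have h' := congrArg norm (smul_left_injective ℂ (one_ne_zero (α := C)) h)
  rw [RCLike.norm_conj, norm_mul, norm_pow] at h'
  have hc' : ‖c‖ ≠ 0 := norm_ne_zero_iff.2 hc
  exact (pow_eq_one_iff_of_nonneg (norm_nonneg l) hn).1
    (mul_right_cancel₀ hc' (by rw [one_mul, ← h']))


/-- Let `K` be a finite abelian group and `C` a graded-division algebra
over `ℂ` with `1`-dimensional homogeneous components and support `K`, whose associated
alternating bicharacter takes values in `{±1}` (i.e., homogeneous elements commute or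
anticommute). Then every `ℂ`-antilinear automorphism of `C` as a graded algebra is
involutive. -/
theorem stmt9 {K : Type*} [CommGroup K] [Finite K] [DecidableEq K]
    {C : Type*} [Ring C] [Algebra ℂ C]
    (comp : K → Submodule ℂ C)
    (hinternal : DirectSum.IsInternal comp)
    (hone : (1 : C) ∈ comp 1)
    (hmul : ∀ {g h : K} {x y : C}, x ∈ comp g → y ∈ comp h → x * y ∈ comp (g * h))
    (hdiv : ∀ (g : K), ∀ x ∈ comp g, x ≠ 0 → IsUnit x)
    (hdim : ∀ g, Module.finrank ℂ (comp g) = 1)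
    (hβ : ∀ (s t : K) (x y : C), x ∈ comp s → y ∈ comp t → x * y = y * x ∨ x * y = -(y * x))
    (ψ : C ≃+* C)
    (hψgr : ∀ (s : K) (x : C), x ∈ comp s → ψ x ∈ comp s)
    (hψanti : ∀ (l : ℂ) (x : C), ψ (l • x) = (starRingEnd ℂ l) • ψ x) :
    ∀ x : C, ψ (ψ x) = x := by
  have hpow : ∀ (s : K) (x : C), x ∈ comp s → ∀ n : ℕ, x ^ n ∈ comp (s ^ n) := by
    intro s x hx n
    induction n with
    | zero => simpa using hone
    | succ n ih => simpa only [pow_succ] using hmul ih hx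
  have hhom : ∀ (s : K) (x : C), x ∈ comp s → ψ (ψ x) = x := by
    intro s x hx
    by_cases hx0 : x = 0
    · simp [hx0]
    have : Nontrivial C := ⟨x, 0, hx0⟩
    obtain ⟨l, hl⟩ := Submodule.exists_smul_eq_of_finrank_eq_one (hdim s) hx hx0 (hψgr s x hx)
    have hxn : x ^ orderOf s ∈ comp 1 := by
      simpa only [pow_orderOf_eq_one] using hpow s x hx (orderOf s)
    obtain ⟨c, hc⟩ := Submodule.exists_smul_eq_of_finrank_eq_one (hdim 1) hone one_ne_zero hxn
    have hc0 : c ≠ 0 := by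
      rintro rfl
      exact ((hdiv s x hx hx0).pow (orderOf s)).ne_zero (by rw [← hc, zero_smul])
    have hnorm : ‖l‖ = 1 := norm_eq_one_of_map_eq_smul (ψ : C →+* C) hψanti
      (orderOf_pos s).ne' hc0 hl.symm hc.symm
    rw [← hl, hψanti, ← hl, smul_smul, RCLike.conj_mul, hnorm]
    simp
  intro x
  have hx : x ∈ ⨆ s, comp s := by simp [hinternal.submodule_iSup_eq_top]
  induction hx using Submodule.iSup_induction' with
  | mem s x hx => exact hhom s x hx
  | zero => simp
  | add x y _ _ hx hy => rw [map_add, map_add, hx, hy]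
end

section
/- Let D be a finite-dimensional graded-division algebra over ℝ with abelian support T such that the identity component D_e is isomorphic to ℂ as an ℝ-algebra and D_e is not contained in the center Z(D). Then K := Supp(Cent_D(D_e)) is a subgroup of index 2 in T, Cent_D(D_e) = D_K = ⊕_{t∈K} D_t, and for every t ∈ T∖K and every element d ∈ D_t, one has d² ∈ Z(D). -/
section GradedDivision

variable {D : Type*} [Ring D] [Algebra ℝ D]

/-- The image of a complex number under `j`, in terms of its real and imaginary parts. -/
theorem algHom_complex_apply (j : ℂ →ₐ[ℝ] D) (c : ℂ) :
    j c = algebraMap ℝ D c.re + c.im • j Complex.I := by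
  conv_lhs => rw [← Complex.re_add_im c]
  rw [map_add, map_mul, ← Complex.coe_algebraMap, AlgHom.commutes, AlgHom.commutes,
    Algebra.smul_def]

theorem algHom_complex_I_mul_I (j : ℂ →ₐ[ℝ] D) : j Complex.I * j Complex.I = -1 := by
  rw [← map_mul, Complex.I_mul_I, map_neg, map_one]

theorem mul_algHom_complex_of_commute_I (j : ℂ →ₐ[ℝ] D) {x : D}
    (hx : x * j Complex.I = j Complex.I * x) (c : ℂ) : x * j c = j c * x := by
  rw [algHom_complex_apply, mul_add, add_mul, mul_smul_comm, smul_mul_assoc, hx,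
    Algebra.commutes]

theorem mul_algHom_complex_of_anticommute_I (j : ℂ →ₐ[ℝ] D) {x : D}
    (hx : x * j Complex.I = -(j Complex.I * x)) (c : ℂ) :
    x * j c = j (starRingEnd ℂ c) * x := by
  rw [algHom_complex_apply, algHom_complex_apply j (starRingEnd ℂ c), mul_add, add_mul,
    mul_smul_comm, smul_mul_assoc, hx, Algebra.commutes, Complex.conj_re, Complex.conj_im,
    smul_neg, neg_smul]

theorem eq_zero_of_commute_of_anticommute_I (j : ℂ →ₐ[ℝ] D) {x : D}
    (h₁ : x * j Complex.I = j Complex.I * x) (h₂ : x * j Complex.I = -(j Complex.I * x)) :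
    x = 0 := by
  have h2 : (2 : ℝ) • (j Complex.I * x) = 0 := by
    rw [two_smul, ← eq_neg_iff_add_eq_zero]
    exact h₁.symm.trans h₂
  have h : j Complex.I * x = 0 := (smul_eq_zero_iff_right two_ne_zero).mp h2
  have := congrArg (j Complex.I * ·) h
  simpa [← mul_assoc, algHom_complex_I_mul_I] using this

/-- If `y * a = r • (a * y)` with `a`, `y` invertible and `r ≥ 0`, then `r = 1`. -/
theorem eq_one_of_mul_eq_smul_mul [FiniteDimensional ℝ D] [Nontrivial D] {a y : D}
    (ha : IsUnit a) (hy : IsUnit y) {r : ℝ} (hr : 0 ≤ r) (h : y * a = r • (a * y)) :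
    r = 1 := by
  have hN := congrArg (Algebra.norm ℝ) h
  rw [Algebra.smul_def, map_mul, map_mul, map_mul, Algebra.norm_algebraMap,
    mul_comm (Algebra.norm ℝ y)] at hN
  have hne : Algebra.norm ℝ a * Algebra.norm ℝ y ≠ 0 :=
    ((ha.map (Algebra.norm ℝ)).mul (hy.map (Algebra.norm ℝ))).ne_zero
  have hpow : r ^ Module.finrank ℝ D = 1 :=
    mul_right_cancel₀ hne (by rw [← hN, one_mul])
  exact (pow_eq_one_iff_of_nonneg hr Module.finrank_pos.ne').mp hpow

variable {T : Type*} [CommGroup T] {comp : T → Submodule ℝ D}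

theorem exists_homogeneous_inverse [Nontrivial D]
    (hmul : ∀ {g h : T} {x y : D}, x ∈ comp g → y ∈ comp h → x * y ∈ comp (g * h))
    (hsupp : ∀ t : T, comp t ≠ ⊥)
    (hdiv : ∀ (t : T), ∀ x ∈ comp t, x ≠ 0 → IsUnit x)
    (j : ℂ →ₐ[ℝ] D) (hj : Set.range ⇑j = (comp 1 : Set D))
    {t : T} {x : D} (hx : x ∈ comp t) (hx0 : x ≠ 0) :
    ∃ u ∈ comp t⁻¹, u * x = 1 := by
  obtain ⟨w, hw, hw0⟩ := Submodule.exists_mem_ne_zero_of_ne_bot (hsupp t⁻¹)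
  have hwx : w * x ∈ (comp 1 : Set D) := by simpa using hmul hw hx
  rw [← hj] at hwx
  obtain ⟨c, hc⟩ := hwx
  have hc0 : c ≠ 0 := by
    rintro rfl
    exact ((hdiv _ w hw hw0).mul (hdiv _ x hx hx0)).ne_zero (by rw [← hc, map_zero])
  have hinv : j c⁻¹ ∈ comp 1 := by
    rw [← SetLike.mem_coe, ← hj]; exact ⟨_, rfl⟩
  refine ⟨j c⁻¹ * w, by simpa using hmul hinv hw, ?_⟩
  rw [mul_assoc, ← hc, ← map_mul, inv_mul_cancel₀ hc0, map_one]

/-- Each homogeneous component either commutes or anticommutes with the imaginary unit of the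
identity component. -/
theorem commute_or_anticommute_I [Nontrivial D]
    (hmul : ∀ {g h : T} {x y : D}, x ∈ comp g → y ∈ comp h → x * y ∈ comp (g * h))
    (hsupp : ∀ t : T, comp t ≠ ⊥)
    (hdiv : ∀ (t : T), ∀ x ∈ comp t, x ≠ 0 → IsUnit x)
    (j : ℂ →ₐ[ℝ] D) (hj : Set.range ⇑j = (comp 1 : Set D)) (t : T) :
    (∀ x ∈ comp t, x * j Complex.I = j Complex.I * x) ∨
      (∀ x ∈ comp t, x * j Complex.I = -(j Complex.I * x)) := by
  set i := j Complex.I with hi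
  have hii : i * i = -1 := algHom_complex_I_mul_I j
  have hi1 : i ∈ comp 1 := by rw [← SetLike.mem_coe, ← hj]; exact ⟨_, rfl⟩
  by_cases h : ∀ x ∈ comp t, x * i = -(i * x)
  · exact Or.inr h
  refine Or.inl fun x hx => ?_
  push Not at h
  obtain ⟨a, ha, hne⟩ := h
  -- the part of `a` commuting with `i` is nonzero and spans the component over `comp 1`
  set b := a - i * a * i with hb
  have hiai : i * a * i ∈ comp t := by simpa using hmul (hmul hi1 ha) hi1
  have hbt : b ∈ comp t := sub_mem ha hiai
  have hbi : b * i = i * b := by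
    rw [hb, sub_mul, mul_sub, mul_assoc (i * a), hii, ← mul_assoc, ← mul_assoc i i a, hii]
    noncomm_ring
  have hb0 : b ≠ 0 := by
    intro h0
    apply hne
    have h1 := congrArg (i * ·) h0
    simp only [hb, mul_sub, ← mul_assoc, hii, mul_zero] at h1
    rw [eq_neg_iff_add_eq_zero, ← h1]
    noncomm_ring
  obtain ⟨u, hu, hub⟩ := exists_homogeneous_inverse hmul hsupp hdiv j hj hbt hb0
  have hz : x * u ∈ (comp 1 : Set D) := by simpa using hmul hx hu
  rw [← hj] at hz
  obtain ⟨c, hc⟩ := hz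
  have hxb : x = j c * b := by rw [hc, mul_assoc, hub, mul_one]
  rw [hxb, mul_assoc, hbi, ← mul_assoc, ← mul_assoc, hi, ← map_mul, ← map_mul, mul_comm c]

/-- The square of a homogeneous element anticommuting with the imaginary unit of the identity
component commutes with every homogeneous element. -/
theorem sq_mul_comm_of_anticommute_I [FiniteDimensional ℝ D] [Nontrivial D]
    (hmul : ∀ {g h : T} {x y : D}, x ∈ comp g → y ∈ comp h → x * y ∈ comp (g * h))
    (hsupp : ∀ t : T, comp t ≠ ⊥)
    (hdiv : ∀ (t : T), ∀ x ∈ comp t, x ≠ 0 → IsUnit x)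
    (j : ℂ →ₐ[ℝ] D) (hj : Set.range ⇑j = (comp 1 : Set D))
    {s t : T} {d y : D} (hd : d ∈ comp t) (hdi : d * j Complex.I = -(j Complex.I * d))
    (hy : y ∈ comp s) : d ^ 2 * y = y * d ^ 2 := by
  rcases eq_or_ne d 0 with rfl | hd0
  · simp
  rcases eq_or_ne y 0 with rfl | hy0
  · simp
  have hdu := hdiv _ d hd hd0
  have hyu := hdiv _ y hy hy0
  obtain ⟨u, hu, hudy⟩ := exists_homogeneous_inverse hmul hsupp hdiv j hj (hmul hd hy)
    (hdu.mul hyu).ne_zero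
  have hz : y * d * u ∈ (comp 1 : Set D) := by
    have := hmul (hmul hy hd) hu
    rwa [mul_comm s t, mul_inv_cancel] at this
  rw [← hj] at hz
  obtain ⟨c, hc⟩ := hz
  have hyd : y * d = j c * (d * y) := by rw [hc, mul_assoc, hudy, mul_one]
  have key : y * d ^ 2 = Complex.normSq c • (d ^ 2 * y) := by
    calc y * d ^ 2 = y * d * d := by rw [pow_two, mul_assoc]
      _ = j c * d * (y * d) := by nth_rw 1 [hyd]; simp only [mul_assoc]
      _ = j c * (d * j c) * (d * y) := by rw [hyd]; simp only [mul_assoc]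
      _ = j (c * starRingEnd ℂ c) * (d ^ 2 * y) := by
        rw [mul_algHom_complex_of_anticommute_I j hdi, map_mul, pow_two]; simp only [mul_assoc]
      _ = _ := by
        rw [Complex.mul_conj, ← Complex.coe_algebraMap, AlgHom.commutes, ← Algebra.smul_def]
  have hr := eq_one_of_mul_eq_smul_mul (hdu.pow 2) hyu (Complex.normSq_nonneg c) key
  rw [key, hr, one_smul]

end GradedDivision


/-- Let `D` be a finite-dimensional graded-division algebra over `ℝ`
with abelian support `T`, such that `D_e ≅ ℂ` as an `ℝ`-algebra and `D_e ⊄ Z(D)`.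
Then `K := Supp(Cent_D(D_e))` is a subgroup of index `2` in `T`,
`Cent_D(D_e) = D_K = ⨁_{t ∈ K} D_t`, and `d² ∈ Z(D)` for every `d ∈ D_t` with
`t ∈ T ∖ K`. -/
theorem stmt10 {T : Type*} [CommGroup T] [DecidableEq T]
    {D : Type*} [Ring D] [Algebra ℝ D] [FiniteDimensional ℝ D]
    (comp : T → Submodule ℝ D)
    (hinternal : DirectSum.IsInternal comp)
    (hone : (1 : D) ∈ comp 1)
    (hmul : ∀ {g h : T} {x y : D}, x ∈ comp g → y ∈ comp h → x * y ∈ comp (g * h))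
    (hsupp : ∀ t : T, comp t ≠ ⊥)
    (hdiv : ∀ (t : T), ∀ x ∈ comp t, x ≠ 0 → IsUnit x)
    (j : ℂ →ₐ[ℝ] D) (hj : Set.range ⇑j = (comp 1 : Set D))
    (hnc : ∃ x ∈ comp 1, ∃ y : D, x * y ≠ y * x) :
    ∃ K : Subgroup T,
      ((K : Set T) = {t : T | ∃ x ∈ comp t, x ≠ 0 ∧ ∀ z ∈ comp 1, x * z = z * x}) ∧
      K.index = 2 ∧
      (∀ t ∈ K, ∀ x ∈ comp t, ∀ z ∈ comp 1, x * z = z * x) ∧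
      ((Subalgebra.centralizer ℝ ((comp 1 : Submodule ℝ D) : Set D) : Set D) =
        ↑(⨆ t ∈ K, comp t)) ∧
      (∀ t : T, t ∉ K → ∀ d ∈ comp t, ∀ y : D, d ^ 2 * y = y * d ^ 2) := by
  have : Nontrivial D := by
    obtain ⟨x, -, y, hxy⟩ := hnc
    exact nontrivial_of_ne _ _ hxy
  have hdich := commute_or_anticommute_I hmul hsupp hdiv j hj
  have hi1 : j Complex.I ∈ comp 1 := by rw [← SetLike.mem_coe, ← hj]; exact ⟨_, rfl⟩
  have hcomm : ∀ x : D, x * j Complex.I = j Complex.I * x → ∀ z ∈ comp 1, x * z = z * x := by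
    intro x hx z hz
    rw [← SetLike.mem_coe, ← hj] at hz
    obtain ⟨c, rfl⟩ := hz
    exact mul_algHom_complex_of_commute_I j hx c
  have htop : ∀ y : D, y ∈ ⨆ t, comp t := fun y => by
    rw [hinternal.submodule_iSup_eq_top]; trivial
  have hex : ∀ t, ∃ x ∈ comp t, IsUnit x := fun t => by
    obtain ⟨x, hx, hx0⟩ := Submodule.exists_mem_ne_zero_of_ne_bot (hsupp t)
    exact ⟨x, hx, hdiv t x hx hx0⟩
  -- the sign character recording whether a component commutes or anticommutes with `j I`
  have hsgn : ∀ t, ∃ e : ℤˣ, ∀ x ∈ comp t, x * j Complex.I = (e : ℤ) • (j Complex.I * x) :=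
    fun t => (hdich t).elim (fun h => ⟨1, by simpa using h⟩) (fun h => ⟨-1, by simpa using h⟩)
  choose e he using hsgn
  have huniq : ∀ t, ∀ f : ℤˣ, ∀ x ∈ comp t, IsUnit x →
      x * j Complex.I = (f : ℤ) • (j Complex.I * x) → e t = f := by
    intro t f x hx hxu hf
    have h := he t x hx
    rcases Int.units_eq_one_or (e t) with h1 | h1 <;>
      rcases Int.units_eq_one_or f with h2 | h2 <;> rw [h1] at h <;> rw [h2] at hf
    · rw [h1, h2]
    · exact absurd (eq_zero_of_commute_of_anticommute_I j (by simpa using h) (by simpa using hf))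
        hxu.ne_zero
    · exact absurd (eq_zero_of_commute_of_anticommute_I j (by simpa using hf) (by simpa using h))
        hxu.ne_zero
    · rw [h1, h2]
  let χ : T →* ℤˣ := MonoidHom.mk' e fun s t => by
    obtain ⟨x, hx, hxu⟩ := hex s
    obtain ⟨y, hy, hyu⟩ := hex t
    refine huniq _ _ (x * y) (hmul hx hy) (hxu.mul hyu) ?_
    rw [mul_assoc, he t y hy, mul_smul_comm, ← mul_assoc, he s x hx, smul_mul_assoc, smul_smul,
      Units.val_mul, mul_comm (e t : ℤ), mul_assoc]
  have hK : ∀ t, t ∈ χ.ker ↔ e t = 1 := fun t => MonoidHom.mem_ker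
  have hKcomm : ∀ t ∈ χ.ker, ∀ x ∈ comp t, x * j Complex.I = j Complex.I * x := by
    intro t ht x hx
    simpa [(hK t).mp ht] using he t x hx
  have hKanti : ∀ t, t ∉ χ.ker → ∀ x ∈ comp t, x * j Complex.I = -(j Complex.I * x) := by
    intro t ht x hx
    have h1 := (Int.units_eq_one_or (e t)).resolve_left fun h => ht ((hK t).mpr h)
    simpa [h1] using he t x hx
  refine ⟨χ.ker, ?_, ?_, fun t ht x hx => hcomm x (hKcomm t ht x hx), ?_, ?_⟩
  · ext t
    rw [SetLike.mem_coe]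
    constructor
    · intro ht
      obtain ⟨x, hx, hxu⟩ := hex t
      exact ⟨x, hx, hxu.ne_zero, hcomm x (hKcomm t ht x hx)⟩
    · rintro ⟨x, hx, hx0, hxc⟩
      exact (hK t).mpr (huniq t 1 x hx (hdiv t x hx hx0) (by simpa using hxc _ hi1))
  · have ha : ∃ a, a ∉ χ.ker := by
      by_contra! hall
      obtain ⟨x, hx, y, hxy⟩ := hnc
      refine hxy (hcomm y ?_ x hx).symm
      clear hxy
      induction htop y using Submodule.iSup_induction' with
      | mem t y hy => exact hKcomm t (hall t) y hy
      | zero => simp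
      | add y z _ _ hy hz => rw [add_mul, mul_add, hy, hz]
    obtain ⟨a, ha⟩ := ha
    refine Subgroup.index_eq_two_iff.mpr ⟨a, fun b => ?_⟩
    have ha' : χ a = -1 := (Int.units_eq_one_or _).resolve_left ha
    rw [MonoidHom.mem_ker, MonoidHom.mem_ker, map_mul, ha']
    rcases Int.units_eq_one_or (χ b) with h | h <;> rw [h] <;> decide
  · ext y
    rw [SetLike.mem_coe, SetLike.mem_coe, Subalgebra.mem_centralizer_iff]
    constructor
    · intro hy
      have hproj : ∀ z : D, z - j Complex.I * z * j Complex.I ∈ ⨆ t ∈ χ.ker, comp t := by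
        intro z
        induction htop z using Submodule.iSup_induction' with
        | mem t z hz =>
          by_cases ht : t ∈ χ.ker
          · have hle : comp t ≤ ⨆ t ∈ χ.ker, comp t := le_iSup₂_of_le t ht le_rfl
            refine sub_mem (hle hz) (hle ?_)
            simpa using hmul (hmul hi1 hz) hi1
          · rw [mul_assoc, hKanti t ht z hz, mul_neg, ← mul_assoc, algHom_complex_I_mul_I]
            simp
        | zero => simp
        | add z w _ _ hz hw =>
          convert add_mem hz hw using 1
          noncomm_ring
      have h2 : (2 : ℝ)⁻¹ • (y - j Complex.I * y * j Complex.I) = y := by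
        rw [mul_assoc, ← hy _ hi1, ← mul_assoc, algHom_complex_I_mul_I, neg_one_mul,
          sub_neg_eq_add, ← two_smul ℝ y, smul_smul]
        norm_num
      rw [← h2]
      exact Submodule.smul_mem _ _ (hproj y)
    · intro hy z hz
      refine (hcomm y ?_ z hz).symm
      have hle : ⨆ t ∈ χ.ker, comp t ≤
          (Subalgebra.centralizer ℝ {j Complex.I}).toSubmodule :=
        iSup₂_le fun t ht x hx => Subalgebra.mem_centralizer_iff ℝ |>.mpr fun g hg => by
          rw [Set.mem_singleton_iff.mp hg, hKcomm t ht x hx]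
      exact (Subalgebra.mem_centralizer_iff ℝ |>.mp (hle hy) _ rfl).symm
  · intro t ht d hd y
    induction htop y using Submodule.iSup_induction' with
    | mem s y hy =>
      exact sq_mul_comm_of_anticommute_I hmul hsupp hdiv j hj hd (hKanti t ht d hd) hy
    | zero => simp
    | add y z _ _ hy hz => rw [add_mul, mul_add, hy, hz]
end

section
/- Let K/F be a G-graded field extension: K is a field with an additive decomposition K = ⊕_{g∈G} K_g indexed by a group G such that K_g ≠ 0 for all g ∈ G, K_g K_h ⊆ K_{gh} for all g,h ∈ G, and K_e = F. Then: G is a torsion abelian group; there is a subgroup M of the multiplicative group K^× containing F^× (namely the group of nonzero homogeneous elements) with G ≅ M/F^×; if K is a finite field, then G is cyclic; and K/F is an algebraic field extension. -/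
namespace GradedField

variable {ι : Type*} [AddGroup ι] [DecidableEq ι] {K : Type*} [Field K]
  (𝒜 : ι → AddSubgroup K) [GradedRing 𝒜]

theorem inv_mem {i : ι} {x : K} (hx : x ∈ 𝒜 i) : x⁻¹ ∈ 𝒜 (-i) := by
  by_cases h0 : x = 0
  · simp [h0]
  have h := DirectSum.coe_decompose_mul_add_of_left_mem (b := x⁻¹) (j := -i) 𝒜 hx
  rw [mul_inv_cancel₀ h0, add_neg_cancel,
    DirectSum.decompose_of_mem_same 𝒜 SetLike.GradedOne.one_mem] at h
  rw [← eq_inv_of_mul_eq_one_right h.symm]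
  exact SetLike.coe_mem _

/-- The degree of a nonzero homogeneous element is torsion: otherwise the components of
`(1 + x)⁻¹` in degrees `n • i` would be nonzero for infinitely many `n`. -/
theorem isOfFinAddOrder_of_mem {i : ι} {x : K} (hx : x ∈ 𝒜 i) (h0 : x ≠ 0) :
    IsOfFinAddOrder i := by
  classical
  by_contra hi
  have hinj : Function.Injective fun n : ℤ ↦ n • i :=
    injective_zsmul_iff_not_isOfFinAddOrder.2 hi
  have h1x : 1 + x ≠ 0 := fun h ↦ by
    have h1 : x ∈ 𝒜 0 := by
      rw [← neg_eq_of_add_eq_zero_right h]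
      exact neg_mem SetLike.GradedOne.one_mem
    have := DirectSum.degree_eq_of_mem_mem 𝒜 hx h1 h0
    exact hi (this ▸ IsOfFinAddOrder.zero)
  set y := (1 + x)⁻¹ with hy
  set a : ℤ → K := fun n ↦ DirectSum.decompose 𝒜 y (n • i) with ha
  have hfin : {n | a n ≠ 0}.Finite := by
    refine ((DirectSum.decompose 𝒜 y).support.finite_toSet.preimage hinj.injOn).subset ?_
    intro n hn
    simpa [ha] using hn
  have hsum : y + x * y = 1 := by
    rw [hy, ← one_add_mul, mul_inv_cancel₀ h1x]
  have hrec (n : ℤ) :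
      a (n + 1) + x * a n = DirectSum.decompose 𝒜 (1 : K) ((n + 1) • i) := by
    rw [← hsum, DirectSum.decompose_add, DirectSum.add_apply, AddSubgroup.coe_add, ha]
    dsimp only
    rw [add_comm n 1, one_add_zsmul, DirectSum.coe_decompose_mul_add_of_left_mem 𝒜 hx]
  have hzero (n : ℤ) (hn : n + 1 ≠ 0) : a (n + 1) + x * a n = 0 := by
    rw [hrec, DirectSum.decompose_of_mem_ne 𝒜 SetLike.GradedOne.one_mem]
    intro h
    exact hn (hinj (by simpa using h.symm))
  have hone : a 0 + x * a (-1) = 1 := by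
    have := hrec (-1)
    rwa [neg_add_cancel, zero_zsmul,
      DirectSum.decompose_of_mem_same 𝒜 SetLike.GradedOne.one_mem] at this
  by_cases h : a 0 = 0
  · have hne (n : ℕ) : a (-1 - n) ≠ 0 := by
      induction n with
      | zero =>
        intro h'
        simp_all
      | succ n ih =>
        intro h'
        have := hzero (-1 - (n + 1 : ℕ)) (by lia)
        rw [h', mul_zero, add_zero] at this
        refine ih ?_
        convert this using 2
        push_cast
        ring
    exact Set.infinite_of_injective_forall_mem (f := fun n : ℕ ↦ -1 - (n : ℤ))
      (fun m n h ↦ by simpa using h) hne hfin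
  · have hne (n : ℕ) : a n ≠ 0 := by
      induction n with
      | zero => exact h
      | succ n ih =>
        intro h'
        have := hzero n (by lia)
        rw [Nat.cast_succ] at h'
        simp_all
    exact Set.infinite_of_injective_forall_mem Nat.cast_injective hne hfin

/-- The degree-zero component of a graded field, as a subfield. -/
def zeroSubfield : Subfield K where
  carrier := 𝒜 0
  mul_mem' {x y} hx hy := by simpa using SetLike.GradedMul.mul_mem hx hy
  one_mem' := SetLike.GradedOne.one_mem
  add_mem' := add_mem
  zero_mem' := zero_mem _
  neg_mem' := neg_mem
  inv_mem' x hx := by simpa using inv_mem 𝒜 hx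

theorem isAlgebraic_zeroSubfield (x : K) : IsAlgebraic (zeroSubfield 𝒜) x := by
  classical
  rw [← DirectSum.sum_support_decompose 𝒜 x]
  refine (IsIntegral.sum _ fun i hi ↦ ?_).isAlgebraic
  let y : K := DirectSum.decompose 𝒜 x i
  change IsIntegral _ y
  have hy : y ∈ 𝒜 i := SetLike.coe_mem _
  have hy0 : y ≠ 0 := by simpa [y] using hi
  obtain ⟨n, hn, hni⟩ := isOfFinAddOrder_iff_nsmul_eq_zero.1 (isOfFinAddOrder_of_mem 𝒜 hy hy0)
  have hyn : y ^ n ∈ 𝒜 0 := hni ▸ SetLike.pow_mem_graded n hy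
  exact IsIntegral.of_pow hn (isIntegral_algebraMap (R := zeroSubfield 𝒜) (x := ⟨y ^ n, hyn⟩))

/-- The group of nonzero homogeneous elements of a graded field. -/
def homogeneousUnits : Subgroup Kˣ where
  carrier := {u | ∃ i, (u : K) ∈ 𝒜 i}
  mul_mem' := fun ⟨i, hi⟩ ⟨j, hj⟩ ↦ ⟨i + j, by simpa using SetLike.GradedMul.mul_mem hi hj⟩
  one_mem' := ⟨0, SetLike.GradedOne.one_mem⟩
  inv_mem' := fun ⟨i, hi⟩ ↦ ⟨-i, by simpa using inv_mem 𝒜 hi⟩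

/-- The degree of a nonzero homogeneous element. -/
noncomputable def degree : homogeneousUnits 𝒜 →* Multiplicative ι :=
  MonoidHom.mk' (fun u ↦ .ofAdd u.2.choose) fun u v ↦
    DirectSum.degree_eq_of_mem_mem 𝒜 (u * v).2.choose_spec
      (SetLike.GradedMul.mul_mem u.2.choose_spec v.2.choose_spec) (Units.ne_zero _)

theorem degree_eq_iff {u : homogeneousUnits 𝒜} {i : ι} :
    degree 𝒜 u = .ofAdd i ↔ ((u : Kˣ) : K) ∈ 𝒜 i := by
  refine ⟨fun h ↦ ?_, fun h ↦ ?_⟩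
  · have : u.2.choose = i := h
    exact this ▸ u.2.choose_spec
  · exact DirectSum.degree_eq_of_mem_mem 𝒜 u.2.choose_spec h (Units.ne_zero _)

theorem degree_surjective (h : ∀ i, 𝒜 i ≠ ⊥) : Function.Surjective (degree 𝒜) := by
  intro i
  obtain ⟨x, hx, hx0⟩ := (𝒜 i.toAdd).bot_or_exists_ne_zero.resolve_left (h _)
  exact ⟨⟨Units.mk0 x hx0, i.toAdd, hx⟩, (degree_eq_iff 𝒜).2 hx⟩

end GradedField


/-- Let `K` be a field with a `G`-graded field extension structure over
`F = K_e`: an additive decomposition `K = ⨁_{g ∈ G} K_g` with all `K_g ≠ 0` and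
`K_g K_h ⊆ K_{gh}`.  Then `G` is a torsion abelian group; the nonzero homogeneous
elements form a subgroup `M` of `K^×` containing `F^× = (K_e)^×` with `G ≅ M/F^×`;
if `K` is a finite field then `G` is cyclic; and `K/F` is an algebraic extension
(every element of `K` is a root of a nonzero polynomial with coefficients in `K_e`). -/
theorem stmt11 {G : Type*} [Group G] [DecidableEq G]
    {K : Type*} [Field K]
    (comp : G → AddSubgroup K)
    (hinternal : DirectSum.IsInternal comp)
    (hone : (1 : K) ∈ comp 1)
    (hmul : ∀ {g h : G} {x y : K}, x ∈ comp g → y ∈ comp h → x * y ∈ comp (g * h))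
    (hsupp : ∀ g : G, comp g ≠ ⊥) :
    (∀ g h : G, g * h = h * g) ∧
    (∀ g : G, IsOfFinOrder g) ∧
    (∃ M N : Subgroup Kˣ, N ≤ M ∧
      ((N : Set Kˣ) = {u : Kˣ | (u : K) ∈ comp 1}) ∧
      ((M : Set Kˣ) = {u : Kˣ | ∃ g : G, (u : K) ∈ comp g}) ∧
      Nonempty (G ≃* ↥M ⧸ N.subgroupOf M)) ∧
    (Finite K → IsCyclic G) ∧
    (∀ x : K, ∃ p : Polynomial K, p ≠ 0 ∧ (∀ i, p.coeff i ∈ comp 1) ∧ Polynomial.eval x p = 0) := by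
  let 𝒜 : Additive G → AddSubgroup K := fun i ↦ comp i.toMul
  let : DecidableEq (Additive G) := ‹DecidableEq G›
  let : DirectSum.Decomposition 𝒜 :=
    DirectSum.IsInternal.chooseDecomposition (ι := Additive G) 𝒜 hinternal
  let : GradedRing 𝒜 :=
    { one_mem := hone
      mul_mem := fun _ _ _ _ hx hy ↦ hmul hx hy }
  let φ : GradedField.homogeneousUnits 𝒜 →* G := GradedField.degree 𝒜
  have hφ : Function.Surjective φ := GradedField.degree_surjective 𝒜 fun i ↦ hsupp i.toMul
  have hφ_iff {u} {g : G} : φ u = g ↔ ((u : Kˣ) : K) ∈ comp g := GradedField.degree_eq_iff 𝒜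
  have hunits : ((φ.ker.map (Subgroup.subtype _) : Subgroup Kˣ) : Set Kˣ) =
      {u : Kˣ | (u : K) ∈ comp 1} := by
    ext u
    constructor
    · rintro ⟨v, hv, rfl⟩
      exact hφ_iff.1 hv
    · exact fun hu ↦ ⟨⟨u, .ofMul 1, hu⟩, hφ_iff.2 hu, rfl⟩
  refine ⟨fun g h ↦ ?_, fun g ↦ ?_, ⟨GradedField.homogeneousUnits 𝒜,
    φ.ker.map (Subgroup.subtype _), Subgroup.map_subtype_le _, hunits, rfl, ?_⟩, fun _ ↦ ?_,
    fun x ↦ ?_⟩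
  · obtain ⟨u, rfl⟩ := hφ g
    obtain ⟨v, rfl⟩ := hφ h
    rw [← map_mul, mul_comm, map_mul]
  · obtain ⟨u, rfl⟩ := hφ g
    exact isOfFinAddOrder_ofMul_iff.1
      (GradedField.isOfFinAddOrder_of_mem 𝒜 (hφ_iff.1 (rfl : φ u = φ u)) (Units.ne_zero _))
  · have hker : (φ.ker.map (Subgroup.subtype _)).subgroupOf _ = φ.ker :=
      Subgroup.comap_map_eq_self_of_injective (Subgroup.subtype_injective _) _
    exact ⟨((QuotientGroup.quotientMulEquivOfEq hker).trans
      (QuotientGroup.quotientKerEquivOfSurjective φ hφ)).symm⟩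
  · exact isCyclic_of_surjective φ hφ
  · obtain ⟨p, hp, hpx⟩ := GradedField.isAlgebraic_zeroSubfield 𝒜 x
    refine ⟨p.map (algebraMap _ K), (Polynomial.map_ne_zero_iff Subtype.val_injective).2 hp,
      fun i ↦ ?_, by rwa [Polynomial.eval_map_algebraMap]⟩
    rw [Polynomial.coeff_map]
    exact (p.coeff i).2
end

section
/- Let K = ⊕_{g∈G} K_g be a graded-field (a commutative graded-division algebra) with support the abelian group G, and let L = K_e be its identity component (a field). For each prime p, let K(p) := ⊕_{t ∈ Tor_p(G)} K_t, where Tor_p(G) is the p-primary component of G. Then K is a field if and only if G is a torsion group and, for every prime p, the subalgebra K(p) is a field. -/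
/-- If `v g * v h` is always a multiple of `v (g * h)`, then the spans in `F` of the images of
finite subgroups are subfields, so their degrees divide one another. -/
theorem finrank_span_image_subgroup_dvd {L F G : Type*} [CommGroup G] [Field L] [Field F]
    [Algebra L F]
    (v : G → F) (hmul : ∀ g h, v g * v h ∈ Submodule.span L {v (g * h)})
    (hone : (1 : F) ∈ Submodule.span L {v 1}) {P H : Subgroup G} (hPH : P ≤ H) [Finite H] :
    Module.finrank L (Submodule.span L (v '' P)) ∣
      Module.finrank L (Submodule.span L (v '' H)) := by
  have key : ∀ Q : Subgroup G, Q ≤ H → ∃ E : IntermediateField L F,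
      Subalgebra.toSubmodule E.toSubalgebra = Submodule.span L (v '' Q) := by
    intro Q hQ
    have hfin : (v '' (Q : Set G)).Finite :=
      ((Set.toFinite (H : Set G)).subset hQ).image v
    have := FiniteDimensional.span_of_finite L hfin
    let S : Subalgebra L F := (Submodule.span L (v '' Q)).toSubalgebra
      (Submodule.span_mono (by simpa using ⟨1, Q.one_mem, rfl⟩) hone)
      (fun x y hx hy => by
        have h := Submodule.mul_mem_mul hx hy
        rw [Submodule.span_mul_span] at h
        refine Submodule.span_le.2 ?_ h
        rintro _ ⟨_, ⟨g, hg, rfl⟩, _, ⟨k, hk, rfl⟩, rfl⟩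
        refine Submodule.span_mono ?_ (hmul g k)
        simpa using ⟨g * k, Q.mul_mem hg hk, rfl⟩)
    have hS : Subalgebra.toSubmodule S = Submodule.span L (v '' Q) :=
      Submodule.toSubalgebra_toSubmodule _ _ _
    have : FiniteDimensional L S := by
      change FiniteDimensional L (Subalgebra.toSubmodule S)
      rwa [hS]
    exact ⟨S.toIntermediateField' (Algebra.IsIntegral.isField_iff_isField
      (algebraMap L S).injective |>.1 (Field.toIsField L)), hS⟩
  obtain ⟨E, hE⟩ := key P hPH
  obtain ⟨E', hE'⟩ := key H le_rfl
  have hle : E ≤ E' := by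
    have : Subalgebra.toSubmodule E.toSubalgebra ≤ Subalgebra.toSubmodule E'.toSubalgebra := by
      rw [hE, hE']
      exact Submodule.span_mono (Set.image_mono hPH)
    exact this
  rw [← hE, ← hE']
  exact IntermediateField.finrank_dvd_of_le_right hle

theorem linearIndependent_of_forall_isPGroup {L F G : Type*} [CommGroup G] [Field L] [Field F]
    [Algebra L F]
    (v : G → F) (hmul : ∀ g h, v g * v h ∈ Submodule.span L {v (g * h)})
    (hone : (1 : F) ∈ Submodule.span L {v 1}) (htors : ∀ g : G, IsOfFinOrder g)
    (hprim : ∀ p : ℕ, p.Prime → ∀ P : Subgroup G, IsPGroup p P →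
      LinearIndependent L (fun h : P => v h)) : LinearIndependent L v := by
  have key : ∀ H : Subgroup G, Finite H → LinearIndependent L (fun h : H => v h) := by
    intro H _
    have := Fintype.ofFinite H
    rw [linearIndependent_iff_card_le_finrank_span]
    have hr : ∀ Q : Subgroup G, Set.range (fun h : Q => v h) = v '' Q := fun Q => by
      ext; simp
    rw [Set.finrank, hr, ← Nat.card_eq_fintype_card]
    have : Nontrivial (Submodule.span L (v '' H)) := by
      refine ⟨⟨1, Submodule.span_mono (by simpa using ⟨1, H.one_mem, rfl⟩) hone⟩, 0, ?_⟩
      simp [Subtype.ext_iff]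
    have := FiniteDimensional.span_of_finite L ((Set.toFinite (H : Set G)).image v)
    have hpos : 0 < Module.finrank L (Submodule.span L (v '' H)) :=
      Module.finrank_pos
    refine Nat.le_of_dvd hpos ?_
    rw [← Nat.factorization_prime_le_iff_dvd Nat.card_pos.ne' hpos.ne']
    intro p hp
    have := Fact.mk hp
    obtain ⟨P⟩ : Nonempty (Sylow p H) := inferInstance
    set Q := (P : Subgroup H).map H.subtype
    have hQH : Q ≤ H := Subgroup.map_subtype_le _
    have hQ := finrank_span_image_subgroup_dvd v hmul hone hQH
    have : Finite Q := Finite.of_injective _ (Subgroup.inclusion_injective hQH)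
    have := Fintype.ofFinite Q
    have hli := finrank_span_eq_card (hprim p hp Q (P.2.map _))
    rw [hr, ← Nat.card_eq_fintype_card, Subgroup.card_map_of_injective H.subtype_injective,
      P.card_eq_multiplicity] at hli
    rw [hli] at hQ
    exact (hp.pow_dvd_iff_le_factorization hpos.ne').1 hQ
  rw [linearIndependent_iff_finset_linearIndependent]
  intro s
  have hfg : Group.FG (Subgroup.closure (s : Set G)) := inferInstance
  have : Finite (Subgroup.closure (s : Set G)) :=
    CommGroup.finite_of_fg_isMulTorsion _ (fun g => Submonoid.isOfFinOrder_coe.1 (htors g))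
  exact (key _ this).comp (fun x : s => ⟨x, Subgroup.subset_closure x.2⟩)
    (fun x y h => Subtype.ext (Subtype.mk.inj h))

section GradedField

variable {G A : Type*} [CommGroup G] [DecidableEq G] [CommRing A]
  {comp : G → AddSubgroup A} [DirectSum.Decomposition comp]

open DirectSum

theorem coe_decompose_mul_left
    (hmul : ∀ {g h : G} {x y : A}, x ∈ comp g → y ∈ comp h → x * y ∈ comp (g * h))
    {g : G} {a : A} (ha : a ∈ comp g) (x : A) (h : G) :
    (decompose comp (a * x) (g * h) : A) = a * decompose comp x h := by
  induction x using Decomposition.inductionOn comp with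
  | zero => simp
  | @homogeneous i m =>
    by_cases hi : i = h
    · subst hi
      rw [decompose_of_mem_same _ (hmul ha m.2), decompose_of_mem_same _ m.2]
    · rw [decompose_of_mem_ne _ (hmul ha m.2) (by simpa using hi),
        decompose_of_mem_ne _ m.2 hi, mul_zero]
  | add x y hx hy => simp [mul_add, decompose_add, hx, hy]

theorem mem_inv_of_mul_eq_one (hone : (1 : A) ∈ comp 1)
    (hmul : ∀ {g h : G} {x y : A}, x ∈ comp g → y ∈ comp h → x * y ∈ comp (g * h))
    {g : G} {a b : A} (ha : a ∈ comp g) (hab : a * b = 1) : b ∈ comp g⁻¹ := by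
  have h := coe_decompose_mul_left hmul ha b g⁻¹
  rw [hab, mul_inv_cancel, decompose_of_mem_same _ hone] at h
  have hb : b = decompose comp b g⁻¹ :=
    calc b = b * (a * decompose comp b g⁻¹) := by rw [← h, mul_one]
      _ = a * b * decompose comp b g⁻¹ := by ring
      _ = _ := by rw [hab, one_mul]
  rw [hb]
  exact (decompose comp b g⁻¹).2

theorem isOfFinOrder_of_isField (hA : IsField A) (hone : (1 : A) ∈ comp 1)
    (hmul : ∀ {g h : G} {x y : A}, x ∈ comp g → y ∈ comp h → x * y ∈ comp (g * h))
    (hsupp : ∀ g : G, comp g ≠ ⊥) (g : G) : IsOfFinOrder g := by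
  have := hA.isDomain
  by_contra hg
  have hinj : Function.Injective (fun n : ℤ => g ^ n) := injective_zpow_iff_not_isOfFinOrder.2 hg
  obtain ⟨x, hx, hx0⟩ : ∃ x ∈ comp g, x ≠ 0 := by
    by_contra! h
    exact hsupp g ((AddSubgroup.eq_bot_iff_forall _).2 h)
  have hg1 : g ≠ 1 := fun h => hg (h ▸ IsOfFinOrder.one)
  have hx1 : 1 - x ≠ 0 := by
    intro h
    rw [sub_eq_zero] at h
    have := decompose_of_mem_ne comp hx hg1
    rw [← h, decompose_of_mem_same _ hone] at this
    exact one_ne_zero this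
  obtain ⟨y, hy⟩ := hA.mul_inv_cancel hx1
  let c : ℤ → A := fun n => decompose comp y (g ^ n)
  have hrec : ∀ n : ℤ, c (n + 1) = x * c n + decompose comp (1 : A) (g ^ (n + 1)) := by
    intro n
    have h := coe_decompose_mul_left hmul hx y (g ^ n)
    rw [← zpow_one_add, add_comm 1 n] at h
    rw [← h, ← hy, ← AddSubgroup.coe_add, ← DirectSum.add_apply, ← decompose_add]
    rw [show x * y + (1 - x) * y = y by ring]
  have hrec' : ∀ n : ℤ, n + 1 ≠ 0 → c (n + 1) = x * c n := by
    intro n hn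
    rw [hrec, decompose_of_mem_ne comp hone, add_zero]
    intro h
    exact hn (hinj (by simpa using h.symm))
  have hfin : {n : ℤ | c n ≠ 0}.Finite := by
    classical
    refine ((decompose comp y).support.finite_toSet.preimage hinj.injOn).subset ?_
    intro n hn
    simpa [c] using hn
  have hpos : c 0 = 0 := by
    by_contra h0
    have h : ∀ n : ℕ, c n ≠ 0 := by
      intro n
      induction n with
      | zero => exact h0
      | succ n ih =>
        push_cast
        rw [hrec' n (by omega)]
        exact mul_ne_zero hx0 ih
    exact Set.infinite_of_injective_forall_mem Nat.cast_injective h hfin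
  have hneg : c (-1) = 0 := by
    by_contra h0
    have h : ∀ n : ℕ, c (-1 - n) ≠ 0 := by
      intro n
      induction n with
      | zero => simpa using h0
      | succ n ih =>
        intro h
        apply ih
        have := hrec' (-1 - (n + 1 : ℕ)) (by omega)
        rw [h, mul_zero] at this
        rw [← this]
        congr 1
        push_cast
        ring
    exact Set.infinite_of_injective_forall_mem (f := fun n : ℕ => (-1 - n : ℤ))
      (fun a b h => by simpa using h) h hfin
  have h := hrec (-1)
  rw [hneg, neg_add_cancel, hpos, mul_zero, zero_add, zpow_zero,
    decompose_of_mem_same _ hone] at h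
  exact zero_ne_one h

/-- The sum of the components indexed by a subgroup of degrees contains the inverses of its units:
the projection onto that sum is linear over it. -/
theorem exists_mem_iSup_mul_eq_one
    (hone : (1 : A) ∈ comp 1)
    (hmul : ∀ {g h : G} {x y : A}, x ∈ comp g → y ∈ comp h → x * y ∈ comp (g * h))
    (H : Subgroup G) {x y : A} (hx : x ∈ ⨆ g ∈ H, comp g) (hxy : x * y = 1) :
    ∃ z ∈ ⨆ g ∈ H, comp g, x * z = 1 := by
  classical
  let π : A →+ A := (DirectSum.toAddMonoid
    (fun g => if g ∈ H then (comp g).subtype else 0)).comp (decomposeAddEquiv comp).toAddMonoidHom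
  have hπ : ∀ {g a}, a ∈ comp g → π a = if g ∈ H then a else 0 := by
    intro g a ha
    simp only [π, AddMonoidHom.comp_apply, AddEquiv.coe_toAddMonoidHom, decomposeAddEquiv_apply,
      decompose_of_mem _ ha, DirectSum.toAddMonoid_of]
    split_ifs <;> rfl
  have hmem : ∀ a, π a ∈ ⨆ g ∈ H, comp g := by
    intro a
    induction a using Decomposition.inductionOn comp with
    | zero => simp
    | @homogeneous i m =>
      rw [hπ m.2]
      split_ifs with h
      · exact (le_iSup₂_of_le (f := fun g (_ : g ∈ H) => comp g) i h le_rfl) m.2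
      · exact zero_mem _
    | add a b ha hb => rw [map_add]; exact add_mem ha hb
  have hlin : ∀ g ∈ H, ∀ a ∈ comp g, ∀ b, π (a * b) = a * π b := by
    intro g hg a ha b
    induction b using Decomposition.inductionOn comp with
    | zero => simp
    | @homogeneous i m =>
      rw [hπ m.2, hπ (hmul ha m.2), H.mul_mem_cancel_left hg]
      split_ifs <;> simp
    | add b c hb hc => simp [mul_add, hb, hc]
  have hle : (⨆ g ∈ H, comp g) ≤
      (π.comp (AddMonoidHom.mulRight y)).eqLocus (AddMonoidHom.mulRight (π y)) :=
    iSup₂_le fun g hg a ha => hlin g hg a ha y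
  refine ⟨π y, hmem y, ?_⟩
  have h : π (x * y) = x * π y := hle hx
  rw [← h, hxy, hπ hone, if_pos H.one_mem]

theorem isField_of_forall_isPGroup (hone : (1 : A) ∈ comp 1)
    (hmul : ∀ {g h : G} {x y : A}, x ∈ comp g → y ∈ comp h → x * y ∈ comp (g * h))
    (hsupp : ∀ g : G, comp g ≠ ⊥)
    (hdiv : ∀ (g : G), ∀ x ∈ comp g, x ≠ 0 → IsUnit x)
    (htors : ∀ g : G, IsOfFinOrder g)
    (hprim : ∀ p : ℕ, p.Prime → ∀ P : Subgroup G, IsPGroup p P →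
      ∀ x ∈ ⨆ g ∈ P, comp g, x ≠ 0 → IsUnit x) : IsField A := by
  have hex : ∀ g, ∃ x ∈ comp g, x ≠ 0 := fun g => by
    by_contra! h
    exact hsupp g ((AddSubgroup.eq_bot_iff_forall _).2 h)
  choose u hu hu0 using hex
  have : Nontrivial A := ⟨u 1, 0, hu0 1⟩
  let L : Subring A :=
    { comp 1 with
      one_mem' := hone
      mul_mem' := fun hx hy => by simpa using hmul hx hy }
  have hL : IsField L :=
    { exists_pair_ne := ⟨0, 1, zero_ne_one⟩
      mul_comm := mul_comm
      mul_inv_cancel := by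
        intro a ha
        obtain ⟨b, hb⟩ := (hdiv 1 a a.2 (by simpa using ha)).exists_right_inv
        exact ⟨⟨b, show b ∈ comp 1 by
          simpa using mem_inv_of_mul_eq_one hone hmul a.2 hb⟩, Subtype.ext hb⟩ }
  let _ : Field L := hL.toField
  have hspan : ∀ {g x}, x ∈ comp g → x ∈ Submodule.span L {u g} := by
    intro g x hx
    obtain ⟨b, hb⟩ := (hdiv g _ (hu g) (hu0 g)).exists_right_inv
    refine Submodule.mem_span_singleton.2
      ⟨⟨x * b, show x * b ∈ comp 1 by
        simpa using hmul hx (mem_inv_of_mul_eq_one hone hmul (hu g) hb)⟩, ?_⟩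
    change x * b * u g = x
    rw [mul_assoc, mul_comm b, hb, mul_one]
  have hsmul : ∀ (c : L) (g : G), c • u g ∈ comp g := fun c g => by
    have h := hmul c.2 (hu g)
    rwa [one_mul] at h
  have hli : LinearIndependent L u := by
    rw [linearIndependent_iff']
    intro s c hc i hi
    have h : (decompose comp (∑ j ∈ s, c j • u j) i : A) = c i • u i := by
      rw [decompose_sum, DFinsupp.finsetSum_apply, AddSubgroup.val_finsetSum,
        Finset.sum_eq_single_of_mem i hi
          (fun j _ hj => decompose_of_mem_ne comp (hsmul _ _) hj),
        decompose_of_mem_same comp (hsmul _ _)]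
    rw [hc, decompose_zero] at h
    have h' : (c i : A) * u i = 0 := h.symm
    exact Subtype.ext (((hdiv i _ (hu i) (hu0 i)).mul_left_eq_zero).1 h')
  obtain ⟨M, hM⟩ := Ideal.exists_maximal A
  let _ : Field (A ⧸ M) := Ideal.Quotient.field M
  let φ : A →ₐ[L] A ⧸ M := Ideal.Quotient.mkₐ L M
  have hφspan : ∀ {g x}, x ∈ comp g → φ x ∈ Submodule.span L {φ (u g)} := by
    intro g x hx
    have := Submodule.mem_map_of_mem (f := φ.toLinearMap) (hspan hx)
    rwa [Submodule.map_span, Set.image_singleton] at this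
  have hφ : LinearIndependent L (fun g => φ (u g)) := by
    refine linearIndependent_of_forall_isPGroup _
      (fun g h => by rw [← map_mul]; exact hφspan (hmul (hu g) (hu h)))
      (by rw [← map_one φ]; exact hφspan hone) htors ?_
    intro p hp P hP
    rw [linearIndependent_iff']
    intro s c hc
    have hsum : φ (∑ i ∈ s, c i • u i) = 0 := by simpa using hc
    refine linearIndependent_iff'.1 (hli.comp _ Subtype.val_injective) s c ?_
    by_contra h0
    refine ((hprim p hp P hP _ ?_ h0).map φ).ne_zero hsum
    exact sum_mem fun i _ =>
      (le_iSup₂_of_le (f := fun g (_ : g ∈ P) => comp g) i.1 i.2 le_rfl) (hsmul _ _)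
  have htop : ∀ x, x ∈ Submodule.span L (Set.range u) := by
    intro x
    induction x using Decomposition.inductionOn comp with
    | zero => exact zero_mem _
    | homogeneous m => exact Submodule.span_mono (by simp) (hspan m.2)
    | add x y hx hy => exact add_mem hx hy
  have hbot : M = ⊥ := by
    rw [eq_bot_iff]
    intro x hx
    obtain ⟨c, rfl⟩ := (Finsupp.mem_span_range_iff_exists_finsupp).1 (htop x)
    have h : φ (c.sum fun i a => a • u i) = 0 := Ideal.Quotient.eq_zero_iff_mem.2 hx
    have hc : c = 0 := linearIndependent_iff.1 hφ c (by
      rw [← h, map_finsuppSum]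
      simp [Finsupp.linearCombination_apply])
    simp [hc]
  exact Ring.isField_iff_maximal_bot.2 (hbot ▸ hM)

end GradedField

/-- Let `K = ⨁_{g ∈ G} K_g` be a graded-field (a commutative
graded-division algebra) with support the abelian group `G`.  For each prime `p` let
`K(p) = ⨁_{t ∈ Tor_p(G)} K_t` (realized as the additive subgroup
`⨆ g ∈ {g | ∃ k, g ^ p ^ k = 1}, K_g`, which is a graded subalgebra).  Then `K` is a
field if and only if `G` is a torsion group and, for every prime `p`, the subalgebra
`K(p)` is a field (i.e., every nonzero element of it has an inverse inside it). -/
theorem stmt12 {G : Type*} [CommGroup G] [DecidableEq G]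
    {A : Type*} [CommRing A]
    (comp : G → AddSubgroup A)
    (hinternal : DirectSum.IsInternal comp)
    (hone : (1 : A) ∈ comp 1)
    (hmul : ∀ {g h : G} {x y : A}, x ∈ comp g → y ∈ comp h → x * y ∈ comp (g * h))
    (hsupp : ∀ g : G, comp g ≠ ⊥)
    (hdiv : ∀ (g : G), ∀ x ∈ comp g, x ≠ 0 → IsUnit x) :
    IsField A ↔
      ((∀ g : G, IsOfFinOrder g) ∧
        ∀ p : ℕ, p.Prime →
          ∀ x ∈ (⨆ g ∈ {g : G | ∃ k : ℕ, g ^ p ^ k = 1}, comp g), x ≠ 0 →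
            ∃ y ∈ (⨆ g ∈ {g : G | ∃ k : ℕ, g ^ p ^ k = 1}, comp g), x * y = 1) := by
  let _ := hinternal.chooseDecomposition
  constructor
  · intro hA
    refine ⟨isOfFinOrder_of_isField hA hone hmul hsupp, fun p _ x hx hx0 => ?_⟩
    obtain ⟨y, hy⟩ := hA.mul_inv_cancel hx0
    let H : Subgroup G :=
      { carrier := {g : G | ∃ k : ℕ, g ^ p ^ k = 1}
        one_mem' := ⟨0, one_pow _⟩
        mul_mem' := by
          rintro a b ⟨k, hk⟩ ⟨m, hm⟩
          refine ⟨k + m, ?_⟩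
          rw [mul_pow, pow_add, pow_mul, hk, one_pow, mul_comm (p ^ k), pow_mul, hm, one_pow,
            mul_one]
        inv_mem' := by
          rintro a ⟨k, hk⟩
          exact ⟨k, by rw [inv_pow, hk, inv_one]⟩ }
    exact exists_mem_iSup_mul_eq_one hone hmul H hx hy
  · rintro ⟨htors, hprim⟩
    refine isField_of_forall_isPGroup hone hmul hsupp hdiv htors fun p hp P hP x hx hx0 => ?_
    have hle : (⨆ g ∈ P, comp g) ≤ ⨆ g ∈ {g : G | ∃ k : ℕ, g ^ p ^ k = 1}, comp g :=
      biSup_mono fun g hg => (hP ⟨g, hg⟩).imp fun k hk => congrArg Subtype.val hk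
    obtain ⟨y, -, hy⟩ := hprim p hp x (hle hx) hx0
    exact IsUnit.of_mul_eq_one y hy
end

section
/- Let F be a field, p a prime number, m ≥ 1, k_1,…,k_m ≥ 1 integers, and μ_1,…,μ_m ∈ F^×. Consider the commutative F-algebra A = F[X_1,…,X_m]/(X_1^{p^{k_1}} − μ_1, …, X_m^{p^{k_m}} − μ_m). If A is a field, then the subgroup of F^×/(F^×)^p generated by the images of μ_1,…,μ_m has order p^m (where (F^×)^p denotes the subgroup of p-th powers); equivalently, if U ≤ F^× is the subgroup generated by μ_1,…,μ_m, then |U(F^×)^p/(F^×)^p| = p^m. -/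
/-- If a coaction of `M` makes `y` homogeneous of a degree whose multiples by `0 < n < p` are nonzero,
then `y ^ p` is not the `p`-th power of a nonzero scalar. -/
theorem pow_ne_pow_of_coaction {F A M : Type*} [Field F] [CommRing A] [IsDomain A] [Algebra F A]
    [AddCommMonoid M] (Φ : A →ₐ[F] AddMonoidAlgebra A M) {p : ℕ} (hp : p.Prime) {d : M} {y : A}
    (hy : Φ y = AddMonoidAlgebra.single d y) (hd : ∀ n, 0 < n → n < p → n • d ≠ 0)
    {a : F} (ha : a ≠ 0) : y ^ p ≠ algebraMap F A a ^ p := by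
  intro h
  have hc : ∀ c : F, Φ (algebraMap F A c) = AddMonoidAlgebra.single 0 (algebraMap F A c) := by
    intro c
    rw [AlgHom.commutes]
    rfl
  have h0 : (∑ n ∈ Finset.range p, y ^ n * algebraMap F A a ^ (p - 1 - n)) *
      (y - algebraMap F A a) = 0 := by
    rw [geom_sum₂_mul, h, sub_self]
  rcases mul_eq_zero.mp h0 with h1 | h1
  · have h2 := congrArg (fun z => (Φ z).coeff 0) h1
    simp only [map_sum, map_mul, map_pow, hy, hc, AddMonoidAlgebra.single_pow,
      AddMonoidAlgebra.single_mul_single, map_zero, smul_zero, add_zero,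
      AddMonoidAlgebra.coeff_sum, Finsupp.finsetSum_apply] at h2
    rw [Finset.sum_eq_single 0] at h2
    · simp [ha] at h2
    · intro n hn hn0
      have := hd n (Nat.pos_of_ne_zero hn0) (Finset.mem_range.mp hn)
      simp [this]
    · simp [hp.pos]
  · have h2 := congrArg (fun z => (Φ z).coeff 0) h1
    have hd1 : d ≠ 0 := by simpa using hd 1 one_pos hp.one_lt
    simp [hy, hc, hd1, ha] at h2

/-- The grading of `F[X_i]/(X_i^{n_i} - μ_i)` by the `j`-th exponent modulo `n_j`. -/
theorem exists_coaction {F ι : Type*} [Field F] [DecidableEq ι] (n : ι → ℕ) (μ : ι → F) (j : ι)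
    {I : Ideal (MvPolynomial ι F)}
    (hI : I = Ideal.span (Set.range fun i => MvPolynomial.X i ^ n i - MvPolynomial.C (μ i))) :
    ∃ Φ : (MvPolynomial ι F ⧸ I) →ₐ[F]
        AddMonoidAlgebra (MvPolynomial ι F ⧸ I) (ZMod (n j)),
      ∀ i, Φ (Ideal.Quotient.mk I (MvPolynomial.X i)) =
        AddMonoidAlgebra.single (if i = j then 1 else 0)
          (Ideal.Quotient.mk I (MvPolynomial.X i)) := by
  let ψ : MvPolynomial ι F →ₐ[F] AddMonoidAlgebra (MvPolynomial ι F ⧸ I) (ZMod (n j)) :=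
    MvPolynomial.aeval fun i => AddMonoidAlgebra.single (if i = j then (1 : ZMod (n j)) else 0)
      (Ideal.Quotient.mk I (MvPolynomial.X i))
  have hψ : ∀ f ∈ I, ψ f = 0 := by
    suffices I ≤ RingHom.ker ψ from fun f hf => this hf
    refine hI.le.trans (Ideal.span_le.mpr ?_)
    rintro _ ⟨i, rfl⟩
    have hd : n i • (if i = j then (1 : ZMod (n j)) else 0) = 0 := by
      split_ifs with h
      · subst h; simp
      · simp
    have hx : (Ideal.Quotient.mk I (MvPolynomial.X i)) ^ n i =
        Ideal.Quotient.mk I (MvPolynomial.C (μ i)) := by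
      rw [← map_pow, Ideal.Quotient.eq]
      exact hI ▸ Ideal.subset_span ⟨i, rfl⟩
    have hC : ψ (MvPolynomial.C (μ i)) =
        AddMonoidAlgebra.single 0 (Ideal.Quotient.mk I (MvPolynomial.C (μ i))) :=
      ψ.commutes (μ i)
    simp only [SetLike.mem_coe, RingHom.mem_ker, map_sub, map_pow, hC, sub_eq_zero]
    simp only [ψ, MvPolynomial.aeval_X, AddMonoidAlgebra.single_pow, hd, hx]
  exact ⟨Ideal.Quotient.liftₐ I ψ hψ, fun i =>
    (Ideal.Quotient.lift_mk _ _ _).trans (MvPolynomial.aeval_X _ _)⟩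

/-- If `F[X_i]/(X_i^{p^{k_i}} - μ_i)` is a field, then a product of powers of the `μ_i` is a `p`-th power
only if all exponents are divisible by `p`. -/
theorem dvd_of_isField_of_pow_eq_prod {F ι : Type*} [Field F] [Fintype ι] {p : ℕ} (hp : p.Prime)
    (k : ι → ℕ) (hk : ∀ i, 1 ≤ k i) (μ : ι → Fˣ)
    (hA : IsField (MvPolynomial ι F ⧸ Ideal.span (Set.range fun i : ι =>
      MvPolynomial.X i ^ (p ^ k i) - MvPolynomial.C ((μ i : F)))))
    (e : ι → ℕ) (a : Fˣ) (h : a ^ p = ∏ i, μ i ^ e i) (j : ι) : p ∣ e j := by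
  classical
  by_contra hj
  set I := Ideal.span (Set.range fun i : ι =>
      MvPolynomial.X i ^ (p ^ k i) - MvPolynomial.C ((μ i : F))) with hI
  obtain ⟨Φ, hΦ⟩ := exists_coaction (fun i => p ^ k i) (fun i => (μ i : F)) j hI
  have : IsDomain (MvPolynomial ι F ⧸ I) := hA.isDomain
  let x : ι → MvPolynomial ι F ⧸ I := fun i => Ideal.Quotient.mk I (MvPolynomial.X i)
  have hx : ∀ i, x i ^ p ^ k i = algebraMap F _ (μ i : F) := by
    intro i
    change _ = Ideal.Quotient.mk I (MvPolynomial.C (μ i : F))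
    rw [← map_pow, Ideal.Quotient.eq]
    exact Ideal.subset_span ⟨i, rfl⟩
  have hpk : ∀ i, p ^ k i = p ^ (k i - 1) * p := fun i => by
    rw [← pow_succ, Nat.sub_add_cancel (hk i)]
  have hy : Φ (∏ i, x i ^ (p ^ (k i - 1) * e i)) =
      AddMonoidAlgebra.single ((p ^ (k j - 1) * e j : ℕ) : ZMod (p ^ k j))
        (∏ i, x i ^ (p ^ (k i - 1) * e i)) := by
    simp only [map_prod, map_pow, x, hΦ, AddMonoidAlgebra.single_pow,
      AddMonoidAlgebra.prod_single]
    congr 1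
    simp
  refine pow_ne_pow_of_coaction Φ hp hy ?_ a.ne_zero ?_
  · intro n hn hnp h0
    rw [nsmul_eq_mul, ← Nat.cast_mul, ZMod.natCast_eq_zero_iff, hpk, mul_left_comm] at h0
    rcases hp.dvd_mul.mp (Nat.dvd_of_mul_dvd_mul_left (pow_pos hp.pos _) h0) with h1 | h1
    · exact absurd (Nat.le_of_dvd hn h1) hnp.not_ge
    · exact hj h1
  · have h' := congrArg (fun u : Fˣ => algebraMap F (MvPolynomial ι F ⧸ I) (u : F)) h
    simp only [Units.val_pow_eq_pow_val, Units.coe_prod, map_pow, map_prod] at h'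
    rw [h', ← Finset.prod_pow]
    refine Finset.prod_congr rfl fun i _ => ?_
    rw [← hx, ← pow_mul, ← pow_mul, hpk, mul_right_comm]

theorem LinearIndependent.natCard_closure_range_zmod {G ι : Type*} [AddCommGroup G] [Fintype ι]
    {p : ℕ} [Fact p.Prime] [Module (ZMod p) G] {v : ι → G} (hv : LinearIndependent (ZMod p) v) :
    Nat.card (AddSubgroup.closure (Set.range v)) = p ^ Fintype.card ι := by
  have hspan : (Submodule.span (ZMod p) (Set.range v)).toAddSubgroup =
      AddSubgroup.closure (Set.range v) := by
    refine le_antisymm ?_ ((AddSubgroup.closure_le _).mpr Submodule.subset_span)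
    have h : Submodule.span (ZMod p) (Set.range v) ≤
        AddSubgroup.toZModSubmodule p (AddSubgroup.closure (Set.range v)) :=
      Submodule.span_le.mpr AddSubgroup.subset_closure
    exact fun _ hx => h hx
  have := FiniteDimensional.span_of_finite (ZMod p) (Set.finite_range v)
  rw [← hspan]
  change Nat.card (Submodule.span (ZMod p) (Set.range v)) = _
  rw [Module.natCard_eq_pow_finrank (K := ZMod p), finrank_span_eq_card hv, Nat.card_zmod]

theorem AddSubgroup.card_closure_range_of_nsmul_eq_zero {G : Type*} [AddCommGroup G] {p m : ℕ}
    (hp : p.Prime) (hG : ∀ g : G, p • g = 0) (v : Fin m → G)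
    (hv : ∀ e : Fin m → ℕ, ∑ i, e i • v i = 0 → ∀ i, p ∣ e i) :
    Nat.card (AddSubgroup.closure (Set.range v)) = p ^ m := by
  have : Fact p.Prime := ⟨hp⟩
  let _ : Module (ZMod p) G := AddCommGroup.zmodModule hG
  have hli : LinearIndependent (ZMod p) v := by
    rw [Fintype.linearIndependent_iff]
    intro g hg i
    have h := hv (fun i => (g i).val) ?_ i
    · rwa [← ZMod.natCast_eq_zero_iff, ZMod.natCast_zmod_val] at h
    · rw [← hg]
      refine Finset.sum_congr rfl fun i _ => ?_
      rw [← Nat.cast_smul_eq_nsmul (ZMod p), ZMod.natCast_zmod_val]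
  rw [hli.natCard_closure_range_zmod, Fintype.card_fin]

theorem Subgroup.card_closure_range_of_pow_eq_one {G : Type*} [CommGroup G] {p m : ℕ}
    (hp : p.Prime) (hG : ∀ g : G, g ^ p = 1) (v : Fin m → G)
    (hv : ∀ e : Fin m → ℕ, ∏ i, v i ^ e i = 1 → ∀ i, p ∣ e i) :
    Nat.card (Subgroup.closure (Set.range v)) = p ^ m := by
  have h := AddSubgroup.card_closure_range_of_nsmul_eq_zero (G := Additive G) hp hG
    (fun i => Additive.ofMul (v i)) hv
  rw [← h]
  change Nat.card (Subgroup.closure (Set.range v)).toAddSubgroup = _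
  rw [Subgroup.toAddSubgroup_closure]
  rfl

/-- Let `F` be a field, `p` a prime, `m ≥ 1`, `k_1, …, k_m ≥ 1` and
`μ_1, …, μ_m ∈ F^×`.  If the commutative algebra
`A = F[X_1,…,X_m]/(X_1^{p^{k_1}} − μ_1, …, X_m^{p^{k_m}} − μ_m)` is a field, then the
subgroup of `F^×/(F^×)^p` generated by the images of `μ_1, …, μ_m` has order `p^m`. -/
theorem stmt13 {F : Type*} [Field F] (p : ℕ) (hp : p.Prime) (m : ℕ) (hm : 1 ≤ m)
    (k : Fin m → ℕ) (hk : ∀ i, 1 ≤ k i) (μ : Fin m → Fˣ)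
    (hA : IsField (MvPolynomial (Fin m) F ⧸
      Ideal.span (Set.range fun i : Fin m =>
        MvPolynomial.X i ^ (p ^ k i) - MvPolynomial.C ((μ i : F))))) :
    Nat.card (Subgroup.closure (Set.range fun i : Fin m =>
      (QuotientGroup.mk (μ i) : Fˣ ⧸ (powMonoidHom p : Fˣ →* Fˣ).range))) = p ^ m := by
  refine Subgroup.card_closure_range_of_pow_eq_one hp ?_ (fun i : Fin m =>
    (QuotientGroup.mk (μ i) : Fˣ ⧸ (powMonoidHom p : Fˣ →* Fˣ).range)) ?_
  · intro g
    induction g using QuotientGroup.induction_on with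
    | H z =>
      rw [← QuotientGroup.mk_pow]
      exact (QuotientGroup.eq_one_iff _).mpr ⟨z, rfl⟩
  · intro e he j
    have he' : QuotientGroup.mk' (powMonoidHom p : Fˣ →* Fˣ).range (∏ i, μ i ^ e i) = 1 := by
      rw [map_prod, ← he]
      rfl
    obtain ⟨a, ha⟩ := (QuotientGroup.eq_one_iff _).mp he'
    exact dvd_of_isField_of_pow_eq_prod hp k hk μ hA e a ha j
end

section
/- Let F be a field with char F ≠ 2, m ≥ 1, and μ_1,…,μ_m ∈ F^×. Consider the commutative F-algebra A = F[X_1,…,X_m]/(X_1² − μ_1, …, X_m² − μ_m). Then A is a field if and only if the subgroup of F^×/(F^×)² generated by the images of μ_1,…,μ_m has order 2^m; equivalently, if U ≤ F^× is the subgroup generated by μ_1,…,μ_m, then A is a field if and only if |U(F^×)²/(F^×)²| = 2^m. -/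
section MultiquadraticAlgebra

variable {ι F A : Type*} [Field F] [CommRing A] [Algebra F A]

theorem exists_eq_add_mul_of_mem_adjoin_insert {x : A} {s : Set A} {r : F}
    (hx : x ^ 2 = algebraMap F A r) {z : A} (hz : z ∈ Algebra.adjoin F (insert x s)) :
    ∃ b ∈ Algebra.adjoin F s, ∃ c ∈ Algebra.adjoin F s, z = b + c * x := by
  induction hz using Algebra.adjoin_induction with
  | mem y hy =>
    rcases hy with rfl | hy
    · exact ⟨0, zero_mem _, 1, one_mem _, by ring⟩
    · exact ⟨y, Algebra.subset_adjoin hy, 0, zero_mem _, by ring⟩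
  | algebraMap a => exact ⟨_, Subalgebra.algebraMap_mem _ a, 0, zero_mem _, by ring⟩
  | add y z _ _ hy hz =>
    obtain ⟨b, hb, c, hc, rfl⟩ := hy
    obtain ⟨b', hb', c', hc', rfl⟩ := hz
    exact ⟨b + b', add_mem hb hb', c + c', add_mem hc hc', by ring⟩
  | mul y z _ _ hy hz =>
    obtain ⟨b, hb, c, hc, rfl⟩ := hy
    obtain ⟨b', hb', c', hc', rfl⟩ := hz
    refine ⟨b * b' + c * c' * algebraMap F A r,
      add_mem (mul_mem hb hb') (mul_mem (mul_mem hc hc') (Subalgebra.algebraMap_mem _ r)),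
      b * c' + c * b', add_mem (mul_mem hb hc') (mul_mem hc hb'), ?_⟩
    linear_combination c * c' * hx

variable {x : ι → A} {μ : ι → F}

theorem prod_sq_eq_algebraMap_prod (hx : ∀ i, x i ^ 2 = algebraMap F A (μ i)) (S : Finset ι) :
    (∏ i ∈ S, x i) ^ 2 = algebraMap F A (∏ i ∈ S, μ i) := by
  rw [← Finset.prod_pow, map_prod]
  exact Finset.prod_congr rfl fun i _ => hx i

/-- In an algebra generated by square roots of scalars that are independent modulo squares,
nonzero elements are invertible and the only square roots of scalars are scalar multiples of
products of generators. -/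
theorem adjoin_sqrt_inverse_and_sqrt [Nontrivial A] (h2 : (2 : F) ≠ 0)
    (hx : ∀ i, x i ^ 2 = algebraMap F A (μ i))
    (hμ : ∀ S : Finset ι, S.Nonempty → ¬ IsSquare (∏ i ∈ S, μ i)) (T : Finset ι) :
    (∀ z ∈ Algebra.adjoin F (x '' T), z ≠ 0 → ∃ w ∈ Algebra.adjoin F (x '' T), z * w = 1) ∧
    (∀ z ∈ Algebra.adjoin F (x '' T), ∀ r : F, z ^ 2 = algebraMap F A r →
      ∃ d : F, ∃ S ⊆ T, z = algebraMap F A d * ∏ i ∈ S, x i) := by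
  classical
  have hinj : Function.Injective (algebraMap F A) := (algebraMap F A).injective
  induction T using Finset.induction_on with
  | empty =>
    simp only [Finset.coe_empty, Set.image_empty, Algebra.adjoin_empty, Algebra.mem_bot,
      Set.forall_mem_range]
    refine ⟨fun a ha => ?_, fun a r _ => ⟨a, ∅, subset_rfl, by simp⟩⟩
    have ha : a ≠ 0 := by rintro rfl; simp at ha
    exact ⟨_, ⟨a⁻¹, rfl⟩, by rw [← map_mul, mul_inv_cancel₀ ha, map_one]⟩
  | insert i T hi ih =>
    obtain ⟨ihinv, ihsq⟩ := ih
    rw [Finset.coe_insert, Set.image_insert_eq]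
    have hle : Algebra.adjoin F (x '' T) ≤ Algebra.adjoin F (insert (x i) (x '' T)) :=
      Algebra.adjoin_mono (Set.subset_insert _ _)
    have hxi : x i ∈ Algebra.adjoin F (insert (x i) (x '' T)) :=
      Algebra.subset_adjoin (Set.mem_insert _ _)
    have hroot : ∀ z ∈ Algebra.adjoin F (x '' T), z ^ 2 ≠ algebraMap F A (μ i) := by
      intro z hz h
      obtain ⟨d, S, hS, rfl⟩ := ihsq z hz _ h
      rw [mul_pow, prod_sq_eq_algebraMap_prod hx, ← map_pow, ← map_mul] at h
      refine hμ (insert i S) (Finset.insert_nonempty _ _) ⟨d * ∏ j ∈ S, μ j, ?_⟩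
      rw [Finset.prod_insert fun h => hi (hS h), ← hinj h]
      ring
    have hdom : ∀ b ∈ Algebra.adjoin F (x '' T), ∀ c, b * c = 0 → b = 0 ∨ c = 0 := by
      intro b hb c hbc
      by_contra! h
      obtain ⟨w, -, hw⟩ := ihinv b hb h.1
      exact h.2 (by linear_combination w * hbc - c * hw)
    constructor
    · intro z hz hz0
      obtain ⟨b, hb, c, hc, rfl⟩ := exists_eq_add_mul_of_mem_adjoin_insert (hx i) hz
      have hN : b ^ 2 - c ^ 2 * algebraMap F A (μ i) ≠ 0 := by
        intro h
        by_cases hc0 : c = 0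
        · subst hc0
          have hb0 : b = 0 := (hdom b hb b (by linear_combination h)).elim id id
          exact hz0 (by simp [hb0])
        · obtain ⟨w, hw, hcw⟩ := ihinv c hc hc0
          refine hroot (b * w) (mul_mem hb hw) ?_
          linear_combination w ^ 2 * h + algebraMap F A (μ i) * (c * w + 1) * hcw
      obtain ⟨w, hw, hNw⟩ := ihinv _ (sub_mem (pow_mem hb 2)
        (mul_mem (pow_mem hc 2) (Subalgebra.algebraMap_mem _ _))) hN
      refine ⟨(b - c * x i) * w, mul_mem (sub_mem (hle hb) (mul_mem (hle hc) hxi)) (hle hw), ?_⟩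
      linear_combination hNw - c ^ 2 * w * hx i
    · intro z hz r hr
      obtain ⟨b, hb, c, hc, rfl⟩ := exists_eq_add_mul_of_mem_adjoin_insert (hx i) hz
      have h2A : (algebraMap F A 2⁻¹) * 2 = 1 := by
        rw [← map_ofNat (algebraMap F A) 2, ← map_mul, inv_mul_cancel₀ h2, map_one]
      have hbc : b * c = 0 := by
        by_contra hbc
        obtain ⟨w, hw, hbcw⟩ := ihinv _ (mul_mem hb hc) hbc
        refine hroot (algebraMap F A 2⁻¹ * w *
          (algebraMap F A r - b ^ 2 - c ^ 2 * algebraMap F A (μ i))) ?_ ?_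
        · exact mul_mem (mul_mem (Subalgebra.algebraMap_mem _ _) hw)
            (sub_mem (sub_mem (Subalgebra.algebraMap_mem _ _) (pow_mem hb 2))
              (mul_mem (pow_mem hc 2) (Subalgebra.algebraMap_mem _ _)))
        · rw [← hx i]
          congr 1
          linear_combination -(algebraMap F A 2⁻¹ * w) * hr + algebraMap F A 2⁻¹ * 2 * x i * hbcw
            + x i * h2A
      rcases hdom b hb c hbc with rfl | rfl
      · by_cases hμi : μ i = 0
        · exact absurd (by simp [hμi]) (hμ {i} (Finset.singleton_nonempty i))
        obtain ⟨d, S, hS, rfl⟩ := ihsq c hc (r * (μ i)⁻¹) (by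
          rw [map_mul, ← hr]
          have : algebraMap F A (μ i) * algebraMap F A (μ i)⁻¹ = 1 := by
            rw [← map_mul, mul_inv_cancel₀ hμi, map_one]
          linear_combination -c ^ 2 * this - c ^ 2 * algebraMap F A (μ i)⁻¹ * hx i)
        refine ⟨d, insert i S, Finset.insert_subset_insert _ hS, ?_⟩
        rw [Finset.prod_insert fun h => hi (hS h)]
        ring
      · obtain ⟨d, S, hS, rfl⟩ := ihsq b hb r (by simpa using hr)
        exact ⟨d, S, hS.trans (Finset.subset_insert _ _), by ring⟩

theorem isField_of_adjoin_sqrt_eq_top [Finite ι] [Nontrivial A] (h2 : (2 : F) ≠ 0)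
    (hx : ∀ i, x i ^ 2 = algebraMap F A (μ i)) (htop : Algebra.adjoin F (Set.range x) = ⊤)
    (hμ : ∀ S : Finset ι, S.Nonempty → ¬ IsSquare (∏ i ∈ S, μ i)) : IsField A := by
  have := Fintype.ofFinite ι
  refine ⟨exists_pair_ne A, mul_comm, fun {z} hz => ?_⟩
  obtain ⟨w, -, hw⟩ := (adjoin_sqrt_inverse_and_sqrt h2 hx hμ Finset.univ).1 z
    (by rw [Finset.coe_univ, Set.image_univ, htop]; trivial) hz
  exact ⟨w, hw⟩

/-- In a field with square roots `x i` of the `μ i`, each of whose signs can be changed alone by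
an endomorphism, no nonempty product of the `μ i` is a square in the base field. -/
theorem not_isSquare_prod_of_isField (h2 : (2 : F) ≠ 0) (hA : IsField A)
    (hx : ∀ i, x i ^ 2 = algebraMap F A (μ i)) (hμ : ∀ i, μ i ≠ 0)
    (hσ : ∀ i, ∃ σ : A →ₐ[F] A, σ (x i) = -x i ∧ ∀ j ≠ i, σ (x j) = x j)
    {S : Finset ι} (hS : S.Nonempty) : ¬ IsSquare (∏ i ∈ S, μ i) := by
  classical
  rintro ⟨a, ha⟩
  let := hA.toField
  obtain ⟨i, hi⟩ := hS
  obtain ⟨σ, hσi, hσj⟩ := hσ i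
  have ha0 : a ≠ 0 := by
    rintro rfl
    exact Finset.prod_ne_zero_iff.2 (fun i _ => hμ i) (ha.trans (mul_zero 0))
  have hneg : σ (∏ j ∈ S, x j) = -∏ j ∈ S, x j := by
    rw [map_prod, ← Finset.mul_prod_erase S _ hi, ← Finset.mul_prod_erase S x hi, hσi,
      Finset.prod_congr rfl fun j hj => hσj j (Finset.ne_of_mem_erase hj), neg_mul]
  have key : ∀ b : F, b ≠ 0 → ∏ j ∈ S, x j ≠ algebraMap F A b := by
    intro b hb h
    rw [h, AlgHom.commutes, ← map_neg] at hneg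
    have := (algebraMap F A).injective hneg
    exact mul_ne_zero h2 hb (by linear_combination this)
  have hsq := prod_sq_eq_algebraMap_prod hx S
  rw [ha, ← sq, map_pow] at hsq
  rcases sq_eq_sq_iff_eq_or_eq_neg.1 hsq with h | h
  · exact key a ha0 h
  · exact key (-a) (neg_ne_zero.2 ha0) (by rw [h, map_neg])

end MultiquadraticAlgebra

section ElementaryTwoGroup

variable {ι G : Type*} [CommGroup G]

theorem prod_symmDiff_of_sq_eq_one [DecidableEq ι] {g : ι → G} (hg : ∀ i, g i ^ 2 = 1)
    (S T : Finset ι) : ∏ i ∈ symmDiff S T, g i = (∏ i ∈ S, g i) * ∏ i ∈ T, g i := by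
  have h1 : (∏ i ∈ S ∩ T, g i) ^ 2 = 1 := by
    rw [← Finset.prod_pow]
    exact Finset.prod_eq_one fun i _ => hg i
  rw [← Finset.prod_sdiff (Finset.inter_subset_left : S ∩ T ⊆ S),
    ← Finset.prod_sdiff (Finset.inter_subset_right : S ∩ T ⊆ T), Finset.sdiff_inter_self_left,
    Finset.sdiff_inter_self_right, mul_mul_mul_comm, ← sq, h1, mul_one, symmDiff_def,
    Finset.sup_eq_union, Finset.prod_union disjoint_sdiff_sdiff]

theorem coe_closure_range_eq_range_prod {g : ι → G} (hg : ∀ i, g i ^ 2 = 1) :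
    (Subgroup.closure (Set.range g) : Set G) = Set.range fun S : Finset ι => ∏ i ∈ S, g i := by
  classical
  apply Set.Subset.antisymm
  · intro y hy
    induction hy using Subgroup.closure_induction with
    | mem y hy =>
      obtain ⟨i, rfl⟩ := hy
      exact ⟨{i}, by simp⟩
    | one => exact ⟨∅, by simp⟩
    | mul y z _ _ hy hz =>
      obtain ⟨S, rfl⟩ := hy
      obtain ⟨T, rfl⟩ := hz
      exact ⟨symmDiff S T, prod_symmDiff_of_sq_eq_one hg S T⟩
    | inv y _ hy =>
      obtain ⟨S, rfl⟩ := hy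
      refine ⟨S, ?_⟩
      dsimp only
      rw [← Finset.prod_inv_distrib]
      exact Finset.prod_congr rfl fun i _ => eq_inv_of_mul_eq_one_left (by rw [← sq, hg])
  · rintro _ ⟨S, rfl⟩
    exact Subgroup.prod_mem _ fun i _ => Subgroup.subset_closure ⟨i, rfl⟩

theorem card_closure_range_eq_two_pow_iff [Fintype ι] {g : ι → G} (hg : ∀ i, g i ^ 2 = 1) :
    Nat.card (Subgroup.closure (Set.range g)) = 2 ^ Fintype.card ι ↔
      ∀ S : Finset ι, S.Nonempty → ∏ i ∈ S, g i ≠ 1 := by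
  classical
  have hcard : Nat.card (Subgroup.closure (Set.range g)) =
      (Finset.univ.image fun S : Finset ι => ∏ i ∈ S, g i).card := by
    rw [← SetLike.coe_sort_coe, coe_closure_range_eq_range_prod hg, Nat.card_coe_set_eq,
      ← Set.ncard_coe_finset, Finset.coe_image, Finset.coe_univ, Set.image_univ]
  rw [hcard, ← Fintype.card_finset, ← Finset.card_univ, Finset.card_image_iff, Finset.coe_univ,
    Set.injOn_univ]
  constructor
  · intro h S hS h1
    exact hS.ne_empty (h (by simpa using h1))
  · intro h S T hST
    by_contra hne
    refine h (symmDiff S T) (Finset.nonempty_iff_ne_empty.2 fun h => hne (symmDiff_eq_bot.1 h)) ?_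
    dsimp only at hST
    rw [prod_symmDiff_of_sq_eq_one hg, hST, ← sq, ← Finset.prod_pow]
    exact Finset.prod_eq_one fun i _ => hg i

end ElementaryTwoGroup

theorem Units.isSquare_val_iff {F : Type*} [Field F] {u : Fˣ} :
    IsSquare (u : F) ↔ IsSquare u := by
  refine ⟨fun ⟨a, ha⟩ => ?_, fun h => h.map (Units.coeHom F)⟩
  have ha0 : a ≠ 0 := by
    rintro rfl
    exact u.ne_zero (ha.trans (mul_zero 0))
  exact ⟨Units.mk0 a ha0, Units.ext ha⟩

namespace MvPolynomial

variable {σ F : Type*} [Field F] (μ : σ → F)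

theorem nontrivial_quotient_span_X_sq_sub_C :
    Nontrivial (MvPolynomial σ F ⧸ Ideal.span (Set.range fun i => X i ^ 2 - C (μ i))) := by
  rw [Ideal.Quotient.nontrivial_iff]
  choose r hr using fun i => IsAlgClosed.exists_pow_nat_eq
    (algebraMap F (AlgebraicClosure F) (μ i)) two_pos
  intro h
  have hle : Ideal.span (Set.range fun i => X i ^ 2 - C (μ i)) ≤
      RingHom.ker (aeval r : MvPolynomial σ F →ₐ[F] AlgebraicClosure F) := by
    rw [Ideal.span_le]
    rintro _ ⟨i, rfl⟩
    simp [hr]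
  rw [h, top_le_iff] at hle
  exact RingHom.ker_ne_top _ hle

theorem mk_X_sq (i : σ) :
    (Ideal.Quotient.mk (Ideal.span (Set.range fun i => X i ^ 2 - C (μ i))) (X i)) ^ 2 =
      algebraMap F _ (μ i) := by
  rw [← map_pow]
  exact Ideal.Quotient.eq.2 (Ideal.subset_span ⟨i, rfl⟩)

theorem adjoin_range_mk_X (I : Ideal (MvPolynomial σ F)) :
    Algebra.adjoin F (Set.range fun i => Ideal.Quotient.mk I (X i)) = ⊤ := by
  have h := congrArg (Subalgebra.map (Ideal.Quotient.mkₐ F I)) (adjoin_range_X (R := F) (σ := σ))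
  rw [AlgHom.map_adjoin, ← Set.range_comp, Algebra.map_top,
    (AlgHom.range_eq_top _).2 (Ideal.Quotient.mkₐ_surjective F I)] at h
  exact h

theorem exists_algHom_neg_mk_X (i : σ) :
    let mk := Ideal.Quotient.mk (Ideal.span (Set.range fun i => X i ^ 2 - C (μ i)))
    ∃ f : (MvPolynomial σ F ⧸ Ideal.span (Set.range fun i => X i ^ 2 - C (μ i))) →ₐ[F]
        (MvPolynomial σ F ⧸ Ideal.span (Set.range fun i => X i ^ 2 - C (μ i))),
      f (mk (X i)) = -mk (X i) ∧ ∀ j ≠ i, f (mk (X j)) = mk (X j) := by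
  classical
  intro mk
  let φ := aeval (R := F) fun j => if j = i then -mk (X j) else mk (X j)
  have hφ : ∀ p ∈ Ideal.span (Set.range fun i => X i ^ 2 - C (μ i)), φ p = 0 := by
    intro p hp
    refine (Ideal.span_le (I := RingHom.ker φ)).2 ?_ hp
    rintro _ ⟨j, rfl⟩
    have h := mk_X_sq μ j
    simp only [SetLike.mem_coe, RingHom.mem_ker, map_sub, map_pow, φ, aeval_X, aeval_C]
    rw [sub_eq_zero, ← h]
    split_ifs
    · exact neg_sq (mk (X j))
    · rfl
  refine ⟨Ideal.Quotient.liftₐ _ φ hφ, ?_, fun j hj => ?_⟩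
  · exact (aeval_X _ i).trans (if_pos rfl)
  · exact (aeval_X _ j).trans (if_neg hj)

end MvPolynomial

/-- Let `F` be a field of characteristic `≠ 2`, `m ≥ 1`, and
`μ_1, …, μ_m ∈ F^×`.  The commutative algebra
`A = F[X_1,…,X_m]/(X_1² − μ_1, …, X_m² − μ_m)` is a field if and only if the subgroup
of `F^×/(F^×)²` generated by the images of `μ_1, …, μ_m` has order `2^m`. -/
theorem stmt14 {F : Type*} [Field F] (hchar : (2 : F) ≠ 0) (m : ℕ) (hm : 1 ≤ m)
    (μ : Fin m → Fˣ) :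
    IsField (MvPolynomial (Fin m) F ⧸
      Ideal.span (Set.range fun i : Fin m =>
        MvPolynomial.X i ^ 2 - MvPolynomial.C ((μ i : F)))) ↔
    Nat.card (Subgroup.closure (Set.range fun i : Fin m =>
      (QuotientGroup.mk (μ i) : Fˣ ⧸ (powMonoidHom 2 : Fˣ →* Fˣ).range))) = 2 ^ m := by
  have hsq : ∀ i, (QuotientGroup.mk (μ i) : Fˣ ⧸ (powMonoidHom 2 : Fˣ →* Fˣ).range) ^ 2 = 1 :=
    fun i => (QuotientGroup.eq_one_iff (μ i ^ 2)).2 ⟨μ i, rfl⟩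
  have hprod : ∀ S : Finset (Fin m),
      ∏ i ∈ S, (QuotientGroup.mk (μ i) : Fˣ ⧸ (powMonoidHom 2 : Fˣ →* Fˣ).range) = 1 ↔
        IsSquare (∏ i ∈ S, (μ i : F)) := by
    intro S
    rw [← Units.coe_prod, Units.isSquare_val_iff, isSquare_iff_exists_sq,
      ← QuotientGroup.mk_prod]
    refine (QuotientGroup.eq_one_iff _).trans ?_
    simp only [MonoidHom.mem_range, powMonoidHom_apply, eq_comm]
  have hcard := card_closure_range_eq_two_pow_iff
    (G := Fˣ ⧸ (powMonoidHom 2 : Fˣ →* Fˣ).range) hsq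
  rw [Fintype.card_fin] at hcard
  rw [hcard]
  simp only [ne_eq, hprod]
  constructor
  · intro hA S hS
    exact not_isSquare_prod_of_isField hchar hA
      (MvPolynomial.mk_X_sq fun i => (μ i : F)) (fun i => (μ i).ne_zero)
      (MvPolynomial.exists_algHom_neg_mk_X fun i => (μ i : F)) hS
  · intro h
    have := MvPolynomial.nontrivial_quotient_span_X_sq_sub_C fun i => (μ i : F)
    exact isField_of_adjoin_sqrt_eq_top hchar (MvPolynomial.mk_X_sq fun i => (μ i : F))
      (MvPolynomial.adjoin_range_mk_X _) h
end

section
/- Let K = GF(p^n) and F = GF(p^ℓ) be finite fields with ℓ dividing n, and set k = n/ℓ. Then there exists a group G and a G-grading on K with support G and identity component F (i.e., K = ⊕_{g∈G} K_g with K_g K_h ⊆ K_{gh}, K_g ≠ 0 for all g ∈ G, and K_e = F) if and only if the following two conditions hold: (i) every prime divisor q of k divides p^ℓ − 1; and (ii) if 4 divides k then 4 divides p^ℓ − 1. Moreover, if such a grading exists, the group G must be cyclic of order k, and such a grading exists if and only if there is μ ∈ F^× for which the polynomial X^k − μ is irreducible over F. -/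
/-- A grading of a field `K` by some group `G`, with support all of `G` and identity
component the subfield `F`. -/
structure FieldGrading (K : Type*) [Field K] (F : Subfield K) where
  G : Type
  [grp : Group G]
  [decG : DecidableEq G]
  comp : G → AddSubgroup K
  internal : DirectSum.IsInternal comp
  one_mem : (1 : K) ∈ comp 1
  mul_mem : ∀ {g h : G} {x y : K}, x ∈ comp g → y ∈ comp h → x * y ∈ comp (g * h)
  support : ∀ g : G, comp g ≠ ⊥
  identity : (comp 1 : Set K) = (F : Set K)

attribute [instance] FieldGrading.grp FieldGrading.decG

namespace Polynomial

open IntermediateField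

universe u

theorem X_pow_sub_C_irreducible_of_four_dvd_imp_isSquare_neg_one {K : Type u} [Field K]
    {n : ℕ} (hn : n ≠ 0) (h4 : 4 ∣ n → IsSquare (-1 : K)) {a : K}
    (ha : ∀ p : ℕ, p.Prime → p ∣ n → ∀ b : K, b ^ p ≠ a) :
    Irreducible (X ^ n - C a) := by
  induction n using induction_on_primes generalizing K a with
  | zero => exact absurd rfl hn
  | one => simpa using irreducible_X_sub_C a
  | prime_mul p n hp IH =>
    rw [mul_comm]
    apply X_pow_mul_sub_C_irreducible
      (X_pow_sub_C_irreducible_of_prime hp (ha p hp (dvd_mul_right _ _)))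
    intro E _ _ x hx
    have hint : IsIntegral K x := not_not.mp fun h ↦ by
      simpa only [degree_zero, degree_X_pow_sub_C hp.pos,
        WithBot.natCast_ne_bot] using congr_arg degree (hx.symm.trans (dif_neg h))
    apply IH (right_ne_zero_of_mul hn)
    · intro h
      simpa using (h4 (dvd_mul_of_dvd_right h p)).map (algebraMap K K⟮x⟯)
    intro q hq hqn b hb
    have hnorm : Algebra.norm K b ^ q = (-1) ^ p * -a := by
      rw [← map_pow, hb, ← adjoin.powerBasis_gen hint,
        Algebra.PowerBasis.norm_gen_eq_coeff_zero_minpoly]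
      simp [minpoly_gen, hx, hp.ne_zero.symm]
    have hqpn : q ∣ p * n := dvd_mul_of_dvd_right hqn p
    rcases hp.eq_two_or_odd' with rfl | hodd
    · rcases hq.eq_two_or_odd' with rfl | hq_odd
      · obtain ⟨i, hi⟩ := h4 (by obtain ⟨m, rfl⟩ := hqn; exact ⟨m, by ring⟩)
        refine ha 2 hq hqpn (i * Algebra.norm K b) ?_
        rw [mul_pow, hnorm, sq, ← hi]
        ring
      · refine ha q hq hqpn (-Algebra.norm K b) ?_
        rw [hq_odd.neg_pow, hnorm]
        ring
    · refine ha q hq hqpn (Algebra.norm K b) ?_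
      rw [hnorm, hodd.neg_one_pow]
      ring

theorem not_irreducible_X_pow_add_C {K : Type*} [Field K] {n : ℕ} (h4 : 4 ∣ n) {a c : K}
    (hc : c ^ 2 = 2 * a) : ¬ Irreducible (X ^ n + C (a ^ 2)) := by
  obtain ⟨m, rfl⟩ := h4
  rcases eq_or_ne m 0 with rfl | hm
  · intro h
    exact not_irreducible_C (1 + a ^ 2) (by simpa using h)
  have hfac : (X ^ (4 * m) + C (a ^ 2) : K[X]) =
      (X ^ (2 * m) + (C c * X ^ m + C a)) * (X ^ (2 * m) + (C (-c) * X ^ m + C a)) := by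
    have hc' : C c * C c = 2 * C a := by
      rw [← C_mul, ← sq, hc, C_mul]; rfl
    simp only [C_pow, C_neg]
    linear_combination X ^ (2 * m) * hc'
  have hdeg (d : K) : ¬ IsUnit (X ^ (2 * m) + (C d * X ^ m + C a)) := by
    intro h
    have hlt : (C d * X ^ m + C a).degree < ((2 * m : ℕ) : WithBot ℕ) := by
      refine (degree_add_le _ _).trans_lt (max_lt ?_ ?_)
      · exact (degree_C_mul_X_pow_le _ _).trans_lt (by exact_mod_cast (by omega))
      · exact degree_C_le.trans_lt (by exact_mod_cast (by omega))
    have := degree_eq_zero_of_isUnit h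
    rw [degree_add_eq_left_of_degree_lt (by rwa [degree_X_pow]), degree_X_pow] at this
    have : 2 * m = 0 := by exact_mod_cast this
    omega
  intro h
  rcases h.isUnit_or_isUnit hfac with h | h
  exacts [hdeg _ h, hdeg _ h]

end Polynomial

namespace FiniteField

open Polynomial

variable {F : Type*} [Field F]

theorem isSquare_mul_of_not_isSquare [Finite F] {a b : F} (ha : ¬ IsSquare a) (hb : ¬ IsSquare b) :
    IsSquare (a * b) := by
  classical
  have := Fintype.ofFinite F
  have hF : ringChar F ≠ 2 := fun h ↦ ha (FiniteField.isSquare_of_char_two h a)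
  by_contra h
  rw [← quadraticChar_neg_one_iff_not_isSquare] at ha hb h
  rw [map_mul, ha, hb] at h
  norm_num at h

theorem dvd_card_sub_one_of_irreducible_X_pow_sub_C {k : ℕ} {μ : F}
    (hirr : Irreducible (X ^ k - C μ)) (hμ : μ ≠ 0) {q : ℕ} (hq : q.Prime) (hqk : q ∣ k) :
    q ∣ Nat.card F - 1 := by
  by_contra h
  rw [← hq.coprime_iff_not_dvd, ← Nat.card_units] at h
  obtain ⟨b, hb⟩ := (powCoprime h.symm).surjective (Units.mk0 μ hμ)
  refine pow_ne_of_irreducible_X_pow_sub_C hirr hqk hq.ne_one (b : F) ?_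
  simpa using congr_arg Units.val hb

theorem four_dvd_card_sub_one_of_irreducible_X_pow_sub_C [Finite F] {k : ℕ} {μ : F}
    (hirr : Irreducible (X ^ k - C μ)) (hμ : μ ≠ 0) (hk : 4 ∣ k) : 4 ∣ Nat.card F - 1 := by
  have := Fintype.ofFinite F
  have h2k : 2 ∣ k := dvd_trans (by norm_num) hk
  have h2 := dvd_card_sub_one_of_irreducible_X_pow_sub_C hirr hμ Nat.prime_two h2k
  by_contra h
  have hneg : ¬ IsSquare (-1 : F) := by
    rw [FiniteField.isSquare_neg_one_iff, ← Nat.card_eq_fintype_card]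
    have := Nat.card_pos (α := F)
    omega
  have hμsq : ¬ IsSquare μ := by
    rintro ⟨b, hb⟩
    exact pow_ne_of_irreducible_X_pow_sub_C hirr h2k (by norm_num) b (by rw [sq, hb])
  obtain ⟨a, ha⟩ := isSquare_mul_of_not_isSquare hneg hμsq
  have key : ∃ a c : F, a ^ 2 = -μ ∧ c ^ 2 = 2 * a := by
    by_cases hsq : IsSquare (2 * a)
    · obtain ⟨c, hc⟩ := hsq
      exact ⟨a, c, by rw [sq, ← ha]; ring, by rw [sq, hc]⟩
    · obtain ⟨c, hc⟩ := isSquare_mul_of_not_isSquare hneg hsq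
      exact ⟨-a, c, by rw [neg_sq, sq, ← ha]; ring, by rw [sq, ← hc]; ring⟩
  obtain ⟨a, c, ha, hc⟩ := key
  apply not_irreducible_X_pow_add_C hk hc
  rwa [ha, C_neg, ← sub_eq_add_neg]

theorem exists_irreducible_X_pow_sub_C [Finite F] {k : ℕ} (hk : k ≠ 0)
    (hprime : ∀ q : ℕ, q.Prime → q ∣ k → q ∣ Nat.card F - 1)
    (hfour : 4 ∣ k → 4 ∣ Nat.card F - 1) :
    ∃ μ : F, μ ≠ 0 ∧ Irreducible (X ^ k - C μ) := by
  have := Fintype.ofFinite F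
  have hcard : 1 < Nat.card F := Finite.one_lt_card
  obtain ⟨μ, hμ⟩ := IsCyclic.exists_generator (α := Fˣ)
  refine ⟨μ, μ.ne_zero, X_pow_sub_C_irreducible_of_four_dvd_imp_isSquare_neg_one hk ?_ ?_⟩
  · intro h
    rw [FiniteField.isSquare_neg_one_iff, ← Nat.card_eq_fintype_card]
    have := hfour h
    omega
  · intro q hq hqk b hb
    have hb0 : b ≠ 0 := by
      rintro rfl
      exact μ.ne_zero (by rw [← hb, zero_pow hq.ne_zero])
    have hbμ : Units.mk0 b hb0 ^ q = μ := Units.ext (by simpa using hb)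
    obtain ⟨m, hm⟩ := hprime q hq hqk
    have hord : orderOf μ = q * m := by
      rw [orderOf_eq_card_of_forall_mem_zpowers hμ, Nat.card_units, hm]
    have hm0 : 0 < m := by
      rcases Nat.eq_zero_or_pos m with rfl | h
      · omega
      · exact h
    have : q * m ∣ m := by
      rw [← hord]
      apply orderOf_dvd_of_pow_eq_one
      rw [← hbμ, ← pow_mul, ← hm, ← Nat.card_units, pow_card_eq_one']
    have := Nat.le_of_dvd hm0 this
    have := hq.two_le
    nlinarith

theorem exists_pow_eq_of_irreducible_X_pow_sub_C {K : Type*} [Field K] [Finite K] [Algebra F K]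
    {k : ℕ} {μ : F} (hirr : Irreducible (X ^ k - C μ)) (hk : Module.finrank F K = k) :
    ∃ u : K, u ^ k = algebraMap F K μ := by
  have := Fact.mk hirr
  have hne := hirr.ne_zero
  have hdim : Module.finrank F (AdjoinRoot (X ^ k - C μ)) = k := by
    rw [(AdjoinRoot.powerBasis hne).finrank, AdjoinRoot.powerBasis_dim hne,
      natDegree_X_pow_sub_C]
  obtain ⟨φ⟩ := nonempty_algHom_of_finrank_dvd (F := F) (K := AdjoinRoot (X ^ k - C μ)) (L := K)
    (by rw [hdim, hk])
  refine ⟨φ (AdjoinRoot.root _), ?_⟩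
  have h := AdjoinRoot.eval₂_root (X ^ k - C μ)
  rw [eval₂_sub, eval₂_pow, eval₂_C, eval₂_X, sub_eq_zero] at h
  rw [← map_pow, h]
  exact φ.commutes μ

end FiniteField

namespace FieldGrading

open Polynomial

variable {K : Type*} [Field K] {F : Subfield K} (gr : FieldGrading K F)

theorem mem_comp_one {x : K} : x ∈ gr.comp 1 ↔ x ∈ F := by
  rw [← SetLike.mem_coe, gr.identity, SetLike.mem_coe]

theorem pow_mem_comp {g : gr.G} {x : K} (hx : x ∈ gr.comp g) (m : ℕ) :
    x ^ m ∈ gr.comp (g ^ m) := by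
  induction m with
  | zero => simpa using gr.one_mem
  | succ m ih => simpa only [pow_succ] using gr.mul_mem ih hx

/-- A homogeneous component as a vector space over the identity component. -/
def submodule (g : gr.G) : Submodule F K where
  __ := gr.comp g
  smul_mem' c x hx := by
    simpa [Subfield.smul_def] using gr.mul_mem (gr.mem_comp_one.2 c.2) hx

theorem mem_submodule {g : gr.G} {x : K} : x ∈ gr.submodule g ↔ x ∈ gr.comp g := Iff.rfl

theorem isInternal_submodule : DirectSum.IsInternal gr.submodule := gr.internal

theorem eq_of_mem_comp {g h : gr.G} {x : K} (hg : x ∈ gr.comp g) (hh : x ∈ gr.comp h)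
    (hx : x ≠ 0) : g = h := by
  by_contra hne
  exact hx (AddSubgroup.disjoint_def.1
    (gr.internal.addSubgroup_iSupIndep.pairwiseDisjoint hne) hg hh)

theorem exists_mem_comp_ne_zero (g : gr.G) : ∃ x ∈ gr.comp g, x ≠ 0 :=
  ((gr.comp g).ne_bot_iff_exists_ne_zero.1 (gr.support g)).elim
    fun x hx ↦ ⟨x, x.2, by simpa using hx⟩

theorem submodule_eq_span_singleton {g : gr.G} {x : K} (hx : x ∈ gr.comp g) (hx0 : x ≠ 0) :
    gr.submodule g = Submodule.span F {x} := by
  refine le_antisymm (fun y hy ↦ ?_)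
    ((Submodule.span_singleton_le_iff_mem _ _).2 (gr.mem_submodule.2 hx))
  obtain ⟨z, hz, hz0⟩ := gr.exists_mem_comp_ne_zero g⁻¹
  have hxz : x * z ∈ F := gr.mem_comp_one.1 (by simpa using gr.mul_mem hx hz)
  have hyz : y * z ∈ F := gr.mem_comp_one.1 (by simpa using gr.mul_mem hy hz)
  refine Submodule.mem_span_singleton.2 ⟨⟨y * z / (x * z), F.div_mem hyz hxz⟩, ?_⟩
  rw [Subfield.smul_def, smul_eq_mul]
  field_simp

theorem natCard_eq_finrank : Nat.card gr.G = Module.finrank F K := by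
  choose x hx hx0 using gr.exists_mem_comp_ne_zero
  have hli : LinearIndependent F x :=
    gr.isInternal_submodule.submodule_iSupIndep.linearIndependent _ hx hx0
  have hspan : ⊤ ≤ Submodule.span F (Set.range x) := by
    rw [← gr.isInternal_submodule.submodule_iSup_eq_top, Submodule.span_range_eq_iSup]
    exact iSup_mono fun g ↦ (gr.submodule_eq_span_singleton (hx g) (hx0 g)).le
  exact (Module.finrank_eq_nat_card_basis (Module.Basis.mk hli hspan)).symm

section Finite

variable [Finite K]

/-- The group of nonzero homogeneous elements. -/
def homogeneousUnits : Subgroup Kˣ where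
  carrier := {u | ∃ g, (u : K) ∈ gr.comp g}
  one_mem' := ⟨1, by simpa using gr.one_mem⟩
  mul_mem' := by
    rintro u v ⟨g, hg⟩ ⟨h, hh⟩
    exact ⟨g * h, by simpa using gr.mul_mem hg hh⟩
  inv_mem' := by
    rintro u ⟨g, hg⟩
    rw [Set.mem_ofPred_eq, inv_eq_of_mul_eq_one_right
      (show u * u ^ (orderOf u - 1) = 1 by
        rw [mul_pow_sub_one (orderOf_pos u).ne', pow_orderOf_eq_one])]
    exact ⟨_, by simpa using gr.pow_mem_comp hg _⟩

theorem exists_homogeneous_generator :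
    ∃ (u : K) (g : gr.G), u ∈ gr.comp g ∧ u ≠ 0 ∧ ∀ h : gr.G, ∃ m : ℕ, h = g ^ m := by
  obtain ⟨⟨u, g, hu⟩, hgen⟩ := IsCyclic.exists_generator (α := gr.homogeneousUnits)
  refine ⟨u, g, hu, u.ne_zero, fun h ↦ ?_⟩
  obtain ⟨y, hy, hy0⟩ := gr.exists_mem_comp_ne_zero h
  obtain ⟨m, hm⟩ := mem_powers_iff_mem_zpowers.2 (hgen ⟨Units.mk0 y hy0, h, hy⟩)
  have hm' : (u : K) ^ m = y := by
    simpa using congr_arg (fun v : gr.homogeneousUnits ↦ ((v : Kˣ) : K)) hm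
  exact ⟨m, gr.eq_of_mem_comp hy (hm' ▸ gr.pow_mem_comp hu m) hy0⟩

theorem isCyclic : IsCyclic gr.G := by
  obtain ⟨-, g, -, -, hg⟩ := gr.exists_homogeneous_generator
  refine ⟨g, fun h ↦ ?_⟩
  obtain ⟨m, rfl⟩ := hg h
  exact Subgroup.npow_mem_zpowers g m

theorem exists_irreducible_X_pow_sub_C (gr : FieldGrading K F) :
    ∃ μ : F, μ ≠ 0 ∧ Irreducible (X ^ Module.finrank F K - C μ) := by
  obtain ⟨u, g, hu, hu0, hg⟩ := gr.exists_homogeneous_generator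
  have huk : u ^ Module.finrank F K ∈ F := by
    rw [← gr.mem_comp_one, ← pow_card_eq_one' (x := g), gr.natCard_eq_finrank]
    exact gr.pow_mem_comp hu _
  have hk : Module.finrank F K ≠ 0 := Module.finrank_pos.ne'
  refine ⟨⟨_, huk⟩, fun h ↦ pow_ne_zero _ hu0 (congr_arg Subtype.val h), ?_⟩
  have hint : IsIntegral F u := .of_finite F u
  have htop : IntermediateField.adjoin F {u} = ⊤ := by
    rw [← IntermediateField.toSubalgebra_inj, IntermediateField.top_toSubalgebra,
      ← Subalgebra.toSubmodule.injective.eq_iff, Algebra.top_toSubmodule, eq_top_iff,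
      ← gr.isInternal_submodule.submodule_iSup_eq_top]
    refine iSup_le fun h ↦ ?_
    obtain ⟨m, rfl⟩ := hg h
    rw [gr.submodule_eq_span_singleton (gr.pow_mem_comp hu m) (pow_ne_zero m hu0),
      Submodule.span_singleton_le_iff_mem]
    exact pow_mem (IntermediateField.mem_adjoin_simple_self F u) m
  have hdeg : (minpoly F u).natDegree = Module.finrank F K := by
    rw [← IntermediateField.adjoin.finrank hint, htop, IntermediateField.finrank_top']
  have hmin : minpoly F u = X ^ Module.finrank F K - C ⟨_, huk⟩ := by
    refine (eq_of_monic_of_dvd_of_natDegree_le (minpoly.monic hint)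
      (monic_X_pow_sub_C _ hk) (minpoly.dvd F u ?_) ?_).symm
    · rw [map_sub, map_pow, aeval_X, aeval_C]
      exact sub_self _
    · rw [natDegree_X_pow_sub_C, hdeg]
  exact hmin ▸ minpoly.irreducible hint

end Finite

/-- The grading by `ℤ/k` in which a `k`-th root of `μ` is homogeneous of degree `1`. -/
noncomputable def ofPowEq {k : ℕ} [NeZero k] {μ : F} (hirr : Irreducible (X ^ k - C μ))
    (hμ : μ ≠ 0) (hk : Module.finrank F K = k) {u : K} (hu : u ^ k = μ) :
    FieldGrading K F where
  G := Multiplicative (ZMod k)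
  comp g := (Submodule.span F {u ^ (Multiplicative.toAdd g).val}).toAddSubgroup
  internal := by
    have hk0 : k ≠ 0 := NeZero.ne k
    have hroot : aeval u (X ^ k - C μ) = 0 := by
      rw [map_sub, map_pow, aeval_X, aeval_C, hu]
      exact sub_self _
    have hmin : minpoly F u = X ^ k - C μ :=
      (minpoly.eq_of_irreducible_of_monic hirr hroot (monic_X_pow_sub_C _ hk0)).symm
    have hdeg : (minpoly F u).natDegree = k := by rw [hmin, natDegree_X_pow_sub_C]
    have hli : LinearIndependent F (fun g : Multiplicative (ZMod k) ↦
        u ^ (Multiplicative.toAdd g).val) := by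
      refine (linearIndependent_pow (K := F) u).comp
        (fun g : Multiplicative (ZMod k) ↦
          (⟨(Multiplicative.toAdd g).val, hdeg.symm ▸ ZMod.val_lt _⟩ :
            Fin (minpoly F u).natDegree)) fun g h hgh ↦ ?_
      exact ZMod.val_injective k (Fin.mk.inj_iff.1 hgh)
    have := FiniteDimensional.of_finrank_pos (hk ▸ NeZero.pos k)
    have hcard : Fintype.card (Multiplicative (ZMod k)) = Module.finrank F K := by
      rw [Fintype.card_multiplicative, ZMod.card, hk]
    refine (DirectSum.isInternal_submodule_of_iSupIndep_of_iSup_eq_top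
      hli.iSupIndep_span_singleton ?_ :)
    rw [← Submodule.span_range_eq_iSup]
    exact hli.span_eq_top_of_card_eq_finrank' hcard
  one_mem := Submodule.mem_span_singleton.2 ⟨1, by simp⟩
  mul_mem {g h x y} hx hy := by
    obtain ⟨a, rfl⟩ := Submodule.mem_span_singleton.1 hx
    obtain ⟨b, rfl⟩ := Submodule.mem_span_singleton.1 hy
    set i := (Multiplicative.toAdd g).val
    set j := (Multiplicative.toAdd h).val
    refine Submodule.mem_span_singleton.2 ⟨a * b * μ ^ ((i + j) / k), ?_⟩
    have hij : u ^ i * u ^ j = (μ : K) ^ ((i + j) / k) * u ^ ((i + j) % k) := by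
      rw [← hu, ← pow_mul, ← pow_add, ← pow_add, Nat.div_add_mod]
    rw [toAdd_mul, ZMod.val_add]
    simp only [Subfield.smul_def, smul_eq_mul]
    push_cast
    linear_combination (-(a : K) * b) * hij
  support g h := by
    have hu0 : u ≠ 0 := by
      rintro rfl
      rw [zero_pow (NeZero.ne k)] at hu
      exact hμ (Subtype.ext hu.symm)
    have hmem : u ^ (Multiplicative.toAdd g).val ∈
        (Submodule.span F {u ^ (Multiplicative.toAdd g).val}).toAddSubgroup :=
      Submodule.mem_span_singleton_self _
    rw [h] at hmem
    exact pow_ne_zero _ hu0 hmem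
  identity := by
    ext x
    simp only [Submodule.coe_toAddSubgroup, SetLike.mem_coe, Submodule.mem_span_singleton,
      toAdd_one, ZMod.val_zero, pow_zero, Subfield.smul_def, smul_eq_mul, mul_one]
    exact ⟨fun ⟨a, ha⟩ ↦ ha ▸ a.2, fun hx ↦ ⟨⟨x, hx⟩, rfl⟩⟩

end FieldGrading

/-- Let `K = GF(p^n)` and `F = GF(p^ℓ)` with `ℓ ∣ n`, `k = n/ℓ`.
There is a grading of `K` by some group `G` with support `G` and identity component `F`
iff (i) every prime divisor `q` of `k` divides `p^ℓ − 1`, and (ii) if `4 ∣ k` then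
`4 ∣ p^ℓ − 1`.  Moreover any such grading group is cyclic of order `k`, and such a
grading exists iff `X^k − μ` is irreducible over `F` for some `μ ∈ F^×`. -/
theorem stmt15 {p n ℓ k : ℕ} (hp : p.Prime) (hℓ : 0 < ℓ) (hk : 0 < k) (hn : n = k * ℓ)
    {K : Type*} [Field K] (F : Subfield K)
    (hcardK : Nat.card K = p ^ n) (hcardF : Nat.card F = p ^ ℓ) :
    (Nonempty (FieldGrading K F) ↔
      ((∀ q : ℕ, q.Prime → q ∣ k → q ∣ p ^ ℓ - 1) ∧ (4 ∣ k → 4 ∣ p ^ ℓ - 1))) ∧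
    (∀ gr : FieldGrading K F, IsCyclic gr.G ∧ Nat.card gr.G = k) ∧
    (Nonempty (FieldGrading K F) ↔
      ∃ μ : F, μ ≠ 0 ∧ Irreducible (Polynomial.X ^ k - Polynomial.C μ)) := by
  have : Finite K := Nat.finite_of_card_ne_zero (hcardK ▸ pow_ne_zero n hp.ne_zero)
  have hfin : Module.finrank F K = k := by
    have h := Module.natCard_eq_pow_finrank (K := F) (V := K)
    rw [hcardK, hcardF, ← pow_mul, hn, mul_comm] at h
    exact (Nat.eq_of_mul_eq_mul_left hℓ (Nat.pow_right_injective hp.two_le h)).symm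
  have hirr : Nonempty (FieldGrading K F) ↔
      ∃ μ : F, μ ≠ 0 ∧ Irreducible (Polynomial.X ^ k - Polynomial.C μ) := by
    constructor
    · rintro ⟨gr⟩
      exact hfin ▸ gr.exists_irreducible_X_pow_sub_C
    · rintro ⟨μ, hμ, hirr⟩
      have : NeZero k := ⟨hk.ne'⟩
      obtain ⟨u, hu⟩ := FiniteField.exists_pow_eq_of_irreducible_X_pow_sub_C (K := K) hirr hfin
      exact ⟨.ofPowEq hirr hμ hfin hu⟩
  refine ⟨hirr.trans ⟨?_, fun ⟨hprime, hfour⟩ ↦ ?_⟩,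
    fun gr ↦ ⟨gr.isCyclic, gr.natCard_eq_finrank.trans hfin⟩, hirr⟩
  · rintro ⟨μ, hμ, h⟩
    rw [← hcardF]
    exact ⟨fun q hq ↦ FiniteField.dvd_card_sub_one_of_irreducible_X_pow_sub_C h hμ hq,
      FiniteField.four_dvd_card_sub_one_of_irreducible_X_pow_sub_C h hμ⟩
  · rw [← hcardF] at hprime hfour
    exact FiniteField.exists_irreducible_X_pow_sub_C hk.ne' hprime hfour
end

section
/- Let q be a prime number and α ≥ 1, and let K = GF(2^{q^α}) be the finite field with 2^{q^α} elements. Then every grading of K is trivial: for any group G and any decomposition K = ⊕_{g∈G} K_g of the additive group of K with K_g K_h ⊆ K_{gh} for all g,h ∈ G and 1 ∈ K_e, the support {g ∈ G : K_g ≠ 0} equals {e}, i.e., K = K_e. -/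
/-- A nonzero element lies in at most one component of an independent family. -/
lemma iSupIndep.eq_of_mem_of_mem {ι A : Type*} [AddGroup A] {comp : ι → AddSubgroup A}
    (hindep : iSupIndep comp) {i j : ι} {x : A} (hx : x ≠ 0) (hi : x ∈ comp i)
    (hj : x ∈ comp j) : i = j := by
  by_contra hij
  have h : x ∈ comp i ⊓ comp j := ⟨hi, hj⟩
  rw [(hindep.pairwiseDisjoint hij).eq_bot] at h
  exact hx (AddSubgroup.mem_bot.mp h)

section Grading

variable {K G : Type*} [Field K] [Group G] {comp : G → AddSubgroup K}

lemma pow_mem_of_grading (hone : (1 : K) ∈ comp 1)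
    (hmul : ∀ {g h : G} {x y : K}, x ∈ comp g → y ∈ comp h → x * y ∈ comp (g * h))
    {g : G} {x : K} (hx : x ∈ comp g) (n : ℕ) : x ^ n ∈ comp (g ^ n) := by
  induction n with
  | zero => simpa using hone
  | succ n ih => simpa only [pow_succ] using hmul ih hx

variable [Finite K]

lemma pow_natCard_sub_one_of_ne_zero {x : K} (hx : x ≠ 0) : x ^ (Nat.card K - 1) = 1 := by
  have := Fintype.ofFinite K
  simpa [Nat.card_eq_fintype_card] using FiniteField.pow_card_sub_one_eq_one x hx

/-- The degree of a nonzero homogeneous element has order dividing `|K| - 1`. -/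
lemma degree_pow_natCard_sub_one (hindep : iSupIndep comp) (hone : (1 : K) ∈ comp 1)
    (hmul : ∀ {g h : G} {x y : K}, x ∈ comp g → y ∈ comp h → x * y ∈ comp (g * h))
    {g : G} {x : K} (hx : x ∈ comp g) (hx0 : x ≠ 0) : g ^ (Nat.card K - 1) = 1 := by
  have h := pow_mem_of_grading hone hmul hx (Nat.card K - 1)
  rw [pow_natCard_sub_one_of_ne_zero hx0] at h
  exact hindep.eq_of_mem_of_mem one_ne_zero h hone

/-- The inverse of a nonzero homogeneous element is homogeneous of inverse degree. -/
lemma inv_mem_of_grading (hindep : iSupIndep comp) (hone : (1 : K) ∈ comp 1)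
    (hmul : ∀ {g h : G} {x y : K}, x ∈ comp g → y ∈ comp h → x * y ∈ comp (g * h))
    {g : G} {x : K} (hx : x ∈ comp g) (hx0 : x ≠ 0) : x⁻¹ ∈ comp g⁻¹ := by
  have hK : Nat.card K - 1 = (Nat.card K - 2) + 1 := by
    have := Finite.one_lt_card (α := K)
    omega
  have hg := degree_pow_natCard_sub_one hindep hone hmul hx hx0
  have hx1 := pow_natCard_sub_one_of_ne_zero hx0
  rw [hK, pow_succ] at hg hx1
  rw [← eq_inv_of_mul_eq_one_left hg, ← eq_inv_of_mul_eq_one_left hx1]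
  exact pow_mem_of_grading hone hmul hx _

/-- The support of a grading of a finite field is a subgroup. -/
def gradingSupport (hindep : iSupIndep comp) (hone : (1 : K) ∈ comp 1)
    (hmul : ∀ {g h : G} {x y : K}, x ∈ comp g → y ∈ comp h → x * y ∈ comp (g * h)) :
    Subgroup G where
  carrier := {g | comp g ≠ ⊥}
  one_mem' := by
    intro e
    rw [e] at hone
    exact one_ne_zero (AddSubgroup.mem_bot.mp hone)
  mul_mem' := by
    intro g h hg hh
    obtain ⟨x, hx, hx0⟩ := (comp g).bot_or_exists_ne_zero.resolve_left hg
    obtain ⟨y, hy, hy0⟩ := (comp h).bot_or_exists_ne_zero.resolve_left hh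
    intro e
    have h := hmul hx hy
    rw [e] at h
    exact mul_ne_zero hx0 hy0 (AddSubgroup.mem_bot.mp h)
  inv_mem' := by
    intro g hg
    obtain ⟨x, hx, hx0⟩ := (comp g).bot_or_exists_ne_zero.resolve_left hg
    intro e
    have h := inv_mem_of_grading hindep hone hmul hx hx0
    rw [e] at h
    exact inv_ne_zero hx0 (AddSubgroup.mem_bot.mp h)

/-- Every nonzero component has as many elements as the identity component. -/
lemma natCard_component (hindep : iSupIndep comp) (hone : (1 : K) ∈ comp 1)
    (hmul : ∀ {g h : G} {x y : K}, x ∈ comp g → y ∈ comp h → x * y ∈ comp (g * h))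
    {g : G} (hg : comp g ≠ ⊥) : Nat.card (comp g) = Nat.card (comp 1) := by
  obtain ⟨x, hx, hx0⟩ := (comp g).bot_or_exists_ne_zero.resolve_left hg
  have hinv := inv_mem_of_grading hindep hone hmul hx hx0
  apply le_antisymm
  · refine Nat.card_le_card_of_injective
      (fun y : comp g => (⟨x⁻¹ * y, by simpa using hmul hinv y.2⟩ : comp 1)) fun y z h => ?_
    exact Subtype.ext (mul_left_cancel₀ (inv_ne_zero hx0) (congrArg Subtype.val h))
  · refine Nat.card_le_card_of_injective
      (fun y : comp 1 => (⟨x * y, by simpa using hmul hx y.2⟩ : comp g)) fun y z h => ?_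
    exact Subtype.ext (mul_left_cancel₀ hx0 (congrArg Subtype.val h))

/-- The cardinality of a graded finite field is `|K_e|` to the size of the support. -/
lemma natCard_eq_pow_natCard_support [DecidableEq G] (hinternal : DirectSum.IsInternal comp)
    (hone : (1 : K) ∈ comp 1)
    (hmul : ∀ {g h : G} {x y : K}, x ∈ comp g → y ∈ comp h → x * y ∈ comp (g * h)) :
    Nat.card K = Nat.card (comp 1) ^ Nat.card {g // comp g ≠ ⊥} := by
  have hfin : Finite {g // comp g ≠ ⊥} :=
    WellFoundedGT.finite_ne_bot_of_iSupIndep hinternal.addSubgroup_iSupIndep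
  have := Fintype.ofFinite {g // comp g ≠ ⊥}
  have hsupp : DirectSum.IsInternal fun g : {g // comp g ≠ ⊥} => comp g := by
    have hsub : DirectSum.IsInternal fun g => AddSubgroup.toIntSubmodule (comp g) := hinternal
    have hbot : ∀ g, AddSubgroup.toIntSubmodule (comp g) ≠ ⊥ ↔ comp g ≠ ⊥ := fun g =>
      (map_eq_bot_iff (AddSubgroup.toIntSubmodule (M := K))).not
    have hpred := funext fun g => propext (hbot g)
    have hres : ∀ P : G → Prop, (fun g => AddSubgroup.toIntSubmodule (comp g) ≠ ⊥) = P →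
        DirectSum.IsInternal fun g : {g // P g} => AddSubgroup.toIntSubmodule (comp g) := by
      rintro _ rfl
      exact DirectSum.isInternal_ne_bot_iff.mpr hsub
    exact hres _ hpred
  rw [← Nat.card_congr (Equiv.ofBijective _ hsupp),
    Nat.card_congr (DirectSum.addEquivProd fun g : {g // comp g ≠ ⊥} => comp g).toEquiv,
    Nat.card_pi, Finset.prod_congr rfl fun g _ =>
      natCard_component hinternal.addSubgroup_iSupIndep hone hmul g.2]
  simp [Nat.card_eq_fintype_card]

end Grading

/-- If a power of `n` is a power `p ^ m` of a prime, then the exponent divides `m`. -/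
lemma Nat.Prime.dvd_of_pow_eq_pow {p m n k : ℕ} (hp : p.Prime) (h : p ^ m = n ^ k) : k ∣ m := by
  have h' := congrArg (fun a => a.factorization p) h
  simp only [Nat.factorization_pow, Finsupp.smul_apply, hp.factorization_self, smul_eq_mul,
    mul_one] at h'
  exact ⟨_, h'⟩

lemma Nat.Prime.not_dvd_two_pow_pow_sub_one {q : ℕ} (hq : q.Prime) (a : ℕ) :
    ¬ q ∣ 2 ^ q ^ a - 1 := by
  have := Fact.mk hq
  intro h
  rw [← ZMod.natCast_eq_zero_iff, Nat.cast_sub Nat.one_le_two_pow] at h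
  push_cast at h
  rw [ZMod.pow_card_pow] at h
  exact one_ne_zero (α := ZMod q) (by linear_combination h)


/-- Let `q` be prime, `α ≥ 1`, and let `K = GF(2^{q^α})` be the finite
field with `2^{q^α}` elements.  Then every grading of `K` is trivial: for any group `G`
and any decomposition `K = ⨁_{g ∈ G} K_g` of the additive group of `K` with
`K_g K_h ⊆ K_{gh}` and `1 ∈ K_e`, the support equals `{e}`. -/
theorem stmt16 {q α : ℕ} (hq : q.Prime) (hα : 1 ≤ α)
    {K : Type*} [Field K] (hcard : Nat.card K = 2 ^ q ^ α)
    {G : Type*} [Group G] [DecidableEq G]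
    (comp : G → AddSubgroup K)
    (hinternal : DirectSum.IsInternal comp)
    (hone : (1 : K) ∈ comp 1)
    (hmul : ∀ {g h : G} {x y : K}, x ∈ comp g → y ∈ comp h → x * y ∈ comp (g * h)) :
    {g : G | comp g ≠ ⊥} = {1} := by
  have : Finite K := Nat.finite_of_card_ne_zero (by rw [hcard]; positivity)
  have hindep := hinternal.addSubgroup_iSupIndep
  let S := gradingSupport hindep hone hmul
  have hS : Nat.card S ∣ q ^ α := Nat.prime_two.dvd_of_pow_eq_pow
    (hcard.symm.trans (natCard_eq_pow_natCard_support hinternal hone hmul))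
  refine Set.eq_singleton_iff_unique_mem.mpr ⟨S.one_mem, fun g hg => ?_⟩
  obtain ⟨x, hx, hx0⟩ := (comp g).bot_or_exists_ne_zero.resolve_left hg
  have hord : orderOf g ∣ 2 ^ q ^ α - 1 := by
    rw [← hcard]
    exact orderOf_dvd_of_pow_eq_one (degree_pow_natCard_sub_one hindep hone hmul hx hx0)
  have hordq : orderOf g ∣ q ^ α := (S.orderOf_dvd_natCard hg).trans hS
  have hcop : Nat.Coprime (q ^ α) (2 ^ q ^ α - 1) :=
    ((hq.coprime_iff_not_dvd).mpr (hq.not_dvd_two_pow_pow_sub_one α)).pow_left α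
  exact orderOf_eq_one_iff.mp (Nat.eq_one_of_dvd_coprimes hcop hordq hord)
end

section
/- Let p and q be prime numbers, ℓ ≥ 1, and suppose q divides p^ℓ − 1. Then the finite field K = GF(p^{qℓ}) admits a Z_q-grading with identity component GF(p^ℓ): there is a decomposition K = ⊕_{i∈Z_q} K_i of the additive group of K with K_i K_j ⊆ K_{i+j}, K_i ≠ 0 for all i ∈ Z_q, and K_0 = GF(p^ℓ). Explicitly, fixing a primitive q-th root of unity ζ in GF(p^ℓ), the components are the eigenspaces K_i = {x ∈ K : x^{p^ℓ} = ζ^i x} of the automorphism x ↦ x^{p^ℓ}. -/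
/-- The eigenspace `{x | σ x = a x}` of a ring endomorphism, as an additive subgroup. -/
def RingHom.eigenAddSubgroup {K : Type*} [Ring K] (σ : K →+* K) (a : K) : AddSubgroup K where
  carrier := {x | σ x = a * x}
  zero_mem' := by simp
  add_mem' {x y} hx hy := by
    simp only [Set.mem_ofPred_eq] at *
    rw [map_add, hx, hy, mul_add]
  neg_mem' {x} hx := by
    simp only [Set.mem_ofPred_eq] at *
    rw [map_neg, hx, mul_neg]

theorem RingHom.mem_eigenAddSubgroup {K : Type*} [Ring K] {σ : K →+* K} {a x : K} :
    x ∈ σ.eigenAddSubgroup a ↔ σ x = a * x :=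
  Iff.rfl

theorem geom_sum_eq_zero_of_pow_eq_one {K : Type*} [Field K] {w : K} {n : ℕ} (hw : w ^ n = 1)
    (h1 : w ≠ 1) : ∑ j ∈ Finset.range n, w ^ j = 0 := by
  have h := mul_geom_sum w n
  rw [hw, sub_self] at h
  exact (mul_eq_zero.mp h).resolve_left (sub_ne_zero.mpr h1)

theorem ZMod.sum_val {M : Type*} [AddCommMonoid M] (n : ℕ) [NeZero n] (f : ℕ → M) :
    ∑ i : ZMod n, f i.val = ∑ k ∈ Finset.range n, f k := by
  refine Finset.sum_bij (fun i _ => i.val) (fun i _ => Finset.mem_range.mpr i.val_lt)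
    (fun i _ j _ h => ZMod.val_injective n h) (fun k hk => ⟨k, Finset.mem_univ _, ?_⟩)
    (fun _ _ => rfl)
  exact ZMod.val_cast_of_lt (Finset.mem_range.mp hk)

/-- A ring endomorphism of a field whose `n`-th iterate is the identity is diagonalizable as soon
as its fixed field contains a primitive `n`-th root of unity. -/
theorem RingHom.isInternal_eigenAddSubgroup {K : Type*} [Field K] {n : ℕ} [NeZero n]
    (hn : (n : K) ≠ 0) (σ : K →+* K) (hσ : ∀ x, σ^[n] x = x) {ζ : K} (hζ : IsPrimitiveRoot ζ n)
    (hσζ : σ ζ = ζ) :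
    DirectSum.IsInternal fun i : ZMod n => σ.eigenAddSubgroup (ζ ^ i.val) := by
  have hζ0 : ζ ≠ 0 := hζ.ne_zero (NeZero.ne n)
  let e : ZMod n → K →+ K := fun k =>
    ∑ j ∈ Finset.range n, (AddMonoidHom.mulLeft ((ζ ^ k.val)⁻¹ ^ j)).comp (σ ^ j : K →+* K)
  have he : ∀ k x, e k x = ∑ j ∈ Finset.range n, (ζ ^ k.val)⁻¹ ^ j * σ^[j] x := by
    intro k x
    simp [e, AddMonoidHom.finsetSum_apply, RingHom.coe_pow]
  have he_mem : ∀ k x, e k x ∈ σ.eigenAddSubgroup (ζ ^ k.val) := by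
    intro k x
    rw [RingHom.mem_eigenAddSubgroup, he, map_sum, Finset.mul_sum]
    have key : ∀ j, σ ((ζ ^ k.val)⁻¹ ^ j * σ^[j] x) =
        ζ ^ k.val * ((ζ ^ k.val)⁻¹ ^ (j + 1) * σ^[j + 1] x) := by
      intro j
      have : ζ ^ k.val ≠ 0 := pow_ne_zero _ hζ0
      rw [map_mul, map_pow, map_inv₀, map_pow, hσζ, Function.iterate_succ_apply', pow_succ',
        ← mul_assoc, mul_inv_cancel_left₀ this]
    simp_rw [key, ← Finset.mul_sum]
    congr 1
    have h1 := Finset.sum_range_succ (fun j => (ζ ^ k.val)⁻¹ ^ j * σ^[j] x) n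
    rw [Finset.sum_range_succ'] at h1
    have h2 : (ζ ^ k.val)⁻¹ ^ n = 1 := by
      rw [inv_pow, ← pow_mul, mul_comm, pow_mul, hζ.pow_eq_one, one_pow, inv_one]
    simpa [h2, hσ] using h1
  have he_apply : ∀ i k x, x ∈ σ.eigenAddSubgroup (ζ ^ i.val) →
      e k x = if i = k then n * x else 0 := by
    intro i k x hx
    have hit : ∀ j, σ^[j] x = (ζ ^ i.val) ^ j * x := by
      intro j
      induction j with
      | zero => simp
      | succ j ih =>
        rw [Function.iterate_succ_apply', ih, map_mul, map_pow, map_pow, hσζ,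
          RingHom.mem_eigenAddSubgroup.mp hx]
        ring
    rw [he]
    simp_rw [hit, ← mul_assoc, ← mul_pow, ← Finset.sum_mul]
    split_ifs with h
    · subst h
      rw [inv_mul_cancel₀ (pow_ne_zero _ hζ0)]
      simp
    · rw [geom_sum_eq_zero_of_pow_eq_one, zero_mul]
      · rw [mul_pow, inv_pow, ← pow_mul, ← pow_mul, mul_comm _ n, mul_comm _ n, pow_mul, pow_mul,
          hζ.pow_eq_one]
        simp
      · intro h1
        rw [inv_mul_eq_one₀ (pow_ne_zero _ hζ0)] at h1
        exact h (ZMod.val_injective n (hζ.pow_inj i.val_lt k.val_lt h1.symm))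
  have he_sum : ∀ x, ∑ k, e k x = n * x := by
    intro x
    simp_rw [he]
    rw [Finset.sum_comm, Finset.sum_eq_single 0]
    · simp
    · intro j hj hj0
      have hjn := Finset.mem_range.mp hj
      rw [← Finset.sum_mul]
      have h1 : ∀ k : ℕ, (ζ ^ k)⁻¹ ^ j = (ζ ^ j)⁻¹ ^ k := by
        intro k
        rw [inv_pow, inv_pow, ← pow_mul, ← pow_mul, mul_comm]
      rw [ZMod.sum_val n fun k => (ζ ^ k)⁻¹ ^ j]
      simp_rw [h1]
      rw [geom_sum_eq_zero_of_pow_eq_one, zero_mul]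
      · rw [inv_pow, ← pow_mul, mul_comm, pow_mul, hζ.pow_eq_one, one_pow, inv_one]
      · rw [Ne, inv_eq_one]
        exact hζ.pow_ne_one_of_pos_of_lt hj0 hjn
    · intro h
      exact absurd (Finset.mem_range.mpr (NeZero.pos n)) h
  classical
  have hcoe : ∀ f : DirectSum (ZMod n) fun i => σ.eigenAddSubgroup (ζ ^ i.val),
      DirectSum.coeAddMonoidHom (fun i : ZMod n => σ.eigenAddSubgroup (ζ ^ i.val)) f =
        ∑ i, (f i : K) := by
    intro f
    rw [DirectSum.coeAddMonoidHom_eq_dfinsuppSum]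
    exact DFinsupp.sum_eq_sum_fintype f fun _ => rfl
  constructor
  · rw [injective_iff_map_eq_zero]
    intro f hf
    rw [hcoe] at hf
    ext k
    have h := congrArg (e k) hf
    rw [map_sum, map_zero, Finset.sum_congr rfl fun i _ => he_apply i k _ (f i).2] at h
    simpa [hn] using h
  · intro x
    refine ⟨∑ k, DirectSum.of (fun i : ZMod n => σ.eigenAddSubgroup (ζ ^ i.val)) k
      ⟨e k ((n : K)⁻¹ * x), he_mem k _⟩, ?_⟩
    simp only [map_sum, DirectSum.coeAddMonoidHom_of]
    rw [he_sum, mul_inv_cancel_left₀ hn]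

theorem DirectSum.IsInternal.natCard_eq_prod {ι M : Type*} [Fintype ι] [DecidableEq ι]
    [AddCommGroup M] {A : ι → AddSubgroup M} (h : DirectSum.IsInternal A) :
    Nat.card M = ∏ i, Nat.card (A i) := by
  rw [← Nat.card_congr (Equiv.ofBijective _ h), ← Nat.card_pi]
  exact Nat.card_congr DFinsupp.equivFunOnFintype

theorem Nat.card_pow_eq_mul_le {K : Type*} [Field K] {m : ℕ} (hm : 1 < m) (a : K) :
    Nat.card {x : K // x ^ m = a * x} ≤ m := by
  classical
  open Polynomial in
  have hdeg : (X ^ m - C a * X : K[X]).natDegree = m := by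
    rw [natDegree_sub_eq_left_of_natDegree_lt] <;> rw [natDegree_X_pow]
    exact (natDegree_C_mul_le _ _).trans_lt (by rwa [natDegree_X])
  have h0 : (Polynomial.X ^ m - Polynomial.C a * Polynomial.X : Polynomial K) ≠ 0 := by
    intro h
    rw [h, Polynomial.natDegree_zero] at hdeg
    omega
  have hset : {x : K | x ^ m = a * x} =
      (Polynomial.X ^ m - Polynomial.C a * Polynomial.X : Polynomial K).roots.toFinset := by
    ext x
    simp [h0, sub_eq_zero]
  change Nat.card {x : K | x ^ m = a * x} ≤ m
  rw [hset, Nat.card_coe_set_eq, Set.ncard_coe_finset]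
  exact (Multiset.toFinset_card_le _).trans ((Polynomial.card_roots' _).trans hdeg.le)


/-- Let `p, q` be primes, `ℓ ≥ 1`, and suppose `q ∣ p^ℓ − 1`.  Then the
finite field `K = GF(p^{qℓ})` admits a `ℤ_q`-grading with identity component `GF(p^ℓ)`:
the components are the eigenspaces `K_i = {x ∈ K : x^{p^ℓ} = ζ^i x}` of the automorphism
`x ↦ x^{p^ℓ}`, where `ζ` is a fixed primitive `q`-th root of unity lying in the subfield
`GF(p^ℓ)` (the fixed field of `x ↦ x^{p^ℓ}`). -/
theorem stmt17 {p q ℓ : ℕ} (hp : p.Prime) (hq : q.Prime) (hℓ : 0 < ℓ)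
    (hdvd : q ∣ p ^ ℓ - 1)
    {K : Type*} [Field K] (hcard : Nat.card K = p ^ (q * ℓ))
    (ζ : K) (hζ : IsPrimitiveRoot ζ q) (hζmem : ζ ^ p ^ ℓ = ζ) :
    ∃ comp : ZMod q → AddSubgroup K,
      (∀ i : ZMod q, (comp i : Set K) = {x : K | x ^ p ^ ℓ = ζ ^ i.val * x}) ∧
      DirectSum.IsInternal comp ∧
      (∀ i j : ZMod q, ∀ x ∈ comp i, ∀ y ∈ comp j, x * y ∈ comp (i + j)) ∧
      (∀ i : ZMod q, comp i ≠ ⊥) ∧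
      ((comp 0 : Set K) = {x : K | x ^ p ^ ℓ = x}) ∧
      Nat.card {x : K // x ^ p ^ ℓ = x} = p ^ ℓ := by
  have : Fact p.Prime := ⟨hp⟩
  have : Fact q.Prime := ⟨hq⟩
  have hQ : 1 < p ^ ℓ := Nat.one_lt_pow hℓ.ne' hp.one_lt
  have : Finite K := Nat.finite_of_card_ne_zero (hcard ▸ pow_ne_zero _ hp.ne_zero)
  have : Fintype K := Fintype.ofFinite K
  have hcard' : Fintype.card K = p ^ (q * ℓ) := by rw [← Nat.card_eq_fintype_card, hcard]
  have : CharP K p := charP_of_card_eq_prime_pow hcard'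
  have hq0 : (q : K) ≠ 0 := by
    rw [Ne, CharP.cast_eq_zero_iff K p, Nat.prime_dvd_prime_iff_eq hp hq]
    rintro rfl
    have h := (Nat.dvd_sub_iff_right hQ.le (dvd_pow_self p hℓ.ne')).mp hdvd
    exact hp.one_lt.ne' (Nat.dvd_one.mp h)
  let σ : K →+* K := iterateFrobenius K p ℓ
  have hσ : ∀ x, σ x = x ^ p ^ ℓ := fun x => iterateFrobenius_def p ℓ x
  have hσq : ∀ x, σ^[q] x = x := by
    have h : ∀ (k : ℕ) (x : K), σ^[k] x = x ^ (p ^ ℓ) ^ k := by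
      intro k x
      induction k with
      | zero => simp
      | succ k ih => rw [Function.iterate_succ_apply', ih, hσ, ← pow_mul, ← pow_succ]
    intro x
    rw [h, ← pow_mul, mul_comm, ← hcard', FiniteField.pow_card]
  have hint := σ.isInternal_eigenAddSubgroup hq0 hσq hζ ((hσ ζ).trans hζmem)
  have hset : ∀ i : ZMod q, (σ.eigenAddSubgroup (ζ ^ i.val) : Set K) =
      {x : K | x ^ p ^ ℓ = ζ ^ i.val * x} := by
    intro i
    ext x
    simp [RingHom.mem_eigenAddSubgroup, hσ]
  have hle : ∀ i : ZMod q, Nat.card (σ.eigenAddSubgroup (ζ ^ i.val)) ≤ p ^ ℓ := by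
    intro i
    refine le_of_eq_of_le ?_ (Nat.card_pow_eq_mul_le hQ (ζ ^ i.val))
    exact congrArg (fun s : Set K => Nat.card s) (hset i)
  have heq : ∀ i : ZMod q, Nat.card (σ.eigenAddSubgroup (ζ ^ i.val)) = p ^ ℓ := by
    by_contra! h
    obtain ⟨i, hi⟩ := h
    have hlt := Finset.prod_lt_prod (s := Finset.univ)
      (fun i : ZMod q => fun _ => Nat.card_pos (α := σ.eigenAddSubgroup (ζ ^ i.val)))
      (fun i _ => hle i) ⟨i, Finset.mem_univ _, lt_of_le_of_ne (hle i) hi⟩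
    rw [← hint.natCard_eq_prod, hcard, Finset.prod_const, Finset.card_univ, ZMod.card, ← pow_mul,
      mul_comm] at hlt
    exact lt_irrefl _ hlt
  have hzero : (σ.eigenAddSubgroup (ζ ^ (0 : ZMod q).val) : Set K) = {x : K | x ^ p ^ ℓ = x} := by
    rw [hset]
    simp
  refine ⟨fun i => σ.eigenAddSubgroup (ζ ^ i.val), hset, hint, ?_, ?_, hzero, ?_⟩
  · intro i j x hx y hy
    rw [RingHom.mem_eigenAddSubgroup] at *
    have hpow : ζ ^ (i + j).val = ζ ^ i.val * ζ ^ j.val := by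
      rw [ZMod.val_add, ← pow_add, ← pow_eq_pow_mod _ hζ.pow_eq_one]
    rw [map_mul, hx, hy, hpow]
    ring
  · intro i h
    have hcard_bot := heq i
    dsimp only at h
    rw [h, AddSubgroup.card_bot] at hcard_bot
    omega
  · exact (congrArg (fun s : Set K => Nat.card s) hzero).symm.trans (heq 0)
end

section
/- Let K/F be a G-graded finite field extension, where G is a finite abelian group equal to the support: K = ⊕_{g∈G} K_g with K_g ≠ 0 for all g ∈ G, K_g K_h ⊆ K_{gh}, and K_e = F. Assume F contains a primitive n-th root of unity, where n = exp(G) is the exponent of G. Then K/F is a Galois extension and Gal(K/F) is isomorphic to the character group Ĝ = Hom(G, F^×) (hence to G), via the action in which χ ∈ Ĝ acts on K by χ·x = χ(g)x for x ∈ K_g. -/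
theorem DirectSum.IsInternal.exists_basis_of_finrank_eq_one {F K G : Type*} [Field F]
    [AddCommGroup K] [Module F K] [DecidableEq G] {comp : G → Submodule F K}
    (hinternal : DirectSum.IsInternal comp) (hdim : ∀ g : G, Module.finrank F (comp g) = 1) :
    ∃ b : Module.Basis G F K, ∀ g, b g ∈ comp g ∧ ∀ x ∈ comp g, ∃ c : F, x = c • b g := by
  let v : ∀ g, Module.Basis Unit F (comp g) := fun g => Module.basisUnique Unit (hdim g)
  refine ⟨(hinternal.collectedBasis v).reindex (Equiv.sigmaUnique G fun _ => Unit),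
    fun g => ?_⟩
  have hb : (hinternal.collectedBasis v).reindex (Equiv.sigmaUnique G fun _ => Unit) g
      = v g () := by
    simp [Module.Basis.reindex_apply, DirectSum.IsInternal.collectedBasis_coe]
  rw [hb]
  refine ⟨(v g ()).2, fun x hx => ⟨(v g).repr ⟨x, hx⟩ (), ?_⟩⟩
  have h := congrArg Subtype.val ((v g).sum_repr ⟨x, hx⟩)
  simpa using h.symm

/-- Characters of the grading group act on a commutative algebra graded by one-dimensional
components, multiplying each component by the value of the character. -/
theorem exists_monoidHom_algEquiv_of_graded {F K G : Type*} [Field F] [Field K] [Algebra F K]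
    [CommGroup G] (comp : G → Submodule F K)
    (hmul : ∀ {g h : G} {x y : K}, x ∈ comp g → y ∈ comp h → x * y ∈ comp (g * h))
    (hone : (1 : K) ∈ comp 1) (b : Module.Basis G F K)
    (hb : ∀ g, b g ∈ comp g ∧ ∀ x ∈ comp g, ∃ c : F, x = c • b g) :
    ∃ f : (G →* Fˣ) →* (K ≃ₐ[F] K),
      ∀ (χ : G →* Fˣ) (g : G) (x : K), x ∈ comp g → f χ x = ((χ g : Fˣ) : F) • x := by
  let L : (G →* Fˣ) → K →ₗ[F] K := fun χ => b.constr F fun g => ((χ g : Fˣ) : F) • b g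
  have hL : ∀ (χ : G →* Fˣ) (g : G) (x : K), x ∈ comp g → L χ x = ((χ g : Fˣ) : F) • x := by
    intro χ g x hx
    obtain ⟨c, rfl⟩ := (hb g).2 x hx
    simp [L, smul_comm c]
  have hLmul : ∀ χ x y, L χ (x * y) = L χ x * L χ y := by
    intro χ x y
    have h : (LinearMap.mul F K).compr₂ (L χ) = (LinearMap.mul F K).compl₁₂ (L χ) (L χ) := by
      refine b.ext fun g => b.ext fun h => ?_
      simp [hL χ _ _ (hmul (hb g).1 (hb h).1), hL χ _ _ (hb g).1, hL χ _ _ (hb h).1, smul_smul,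
        mul_comm]
    exact LinearMap.congr_fun₂ h x y
  let A : (G →* Fˣ) →* (K →ₐ[F] K) :=
    { toFun := fun χ => AlgHom.ofLinearMap (L χ) (by simp [hL χ 1 1 hone]) (hLmul χ)
      map_one' := by
        refine AlgHom.toLinearMap_injective (b.ext fun g => ?_)
        simp [hL 1 g _ (hb g).1]
      map_mul' := fun χ ψ => by
        refine AlgHom.toLinearMap_injective (b.ext fun g => ?_)
        simp [hL _ g _ (hb g).1, smul_smul, mul_comm] }
  exact ⟨(AlgEquiv.algHomUnitsEquiv F K).toMonoidHom.comp A.toHomUnits,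
    fun χ g x hx => hL χ g x hx⟩


/-- Let `K/F` be a `G`-graded finite field extension with `G` a finite
abelian group equal to the support (all components nonzero, in fact `1`-dimensional,
`K_g K_h ⊆ K_{gh}` and `K_e = F`).  If `F` contains a primitive `exp(G)`-th root of
unity, then `K/F` is Galois and `Gal(K/F)` is isomorphic to the character group
`Ĝ = Hom(G, F^×)` (hence to `G`), via the action `χ · x = χ(g) x` for `x ∈ K_g`. -/
theorem stmt19 {F K : Type*} [Field F] [Field K] [Algebra F K]
    {G : Type*} [CommGroup G] [Fintype G] [DecidableEq G]
    (comp : G → Submodule F K)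
    (hinternal : DirectSum.IsInternal comp)
    (hmul : ∀ {g h : G} {x y : K}, x ∈ comp g → y ∈ comp h → x * y ∈ comp (g * h))
    (hdim : ∀ g : G, Module.finrank F (comp g) = 1)
    (hidentity : (comp 1 : Set K) = Set.range (algebraMap F K))
    (ζ : F) (hζ : IsPrimitiveRoot ζ (Monoid.exponent G)) :
    IsGalois F K ∧
    (∃ e : (G →* Fˣ) ≃* (K ≃ₐ[F] K),
      ∀ (χ : G →* Fˣ) (g : G) (x : K), x ∈ comp g → e χ x = ((χ g : Fˣ) : F) • x) ∧
    Nonempty ((K ≃ₐ[F] K) ≃* G) := by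
  obtain ⟨b, hb⟩ := hinternal.exists_basis_of_finrank_eq_one hdim
  have hone : (1 : K) ∈ comp 1 := by
    rw [← SetLike.mem_coe, hidentity]
    exact ⟨1, map_one _⟩
  obtain ⟨f, hf⟩ := exists_monoidHom_algEquiv_of_graded comp hmul hone b hb
  have : FiniteDimensional F K := b.finiteDimensional_of_finite
  have : NeZero (Monoid.exponent G) := ⟨Monoid.exponent_ne_zero_of_finite⟩
  have : HasEnoughRootsOfUnity F (Monoid.exponent G) := ⟨⟨ζ, hζ⟩, inferInstance⟩
  obtain ⟨d⟩ := CommGroup.monoidHom_mulEquiv_of_hasEnoughRootsOfUnity G F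
  have hinj : Function.Injective f := by
    intro χ ψ h
    ext g
    refine smul_left_injective F (b.ne_zero g) ?_
    simp only [← hf _ g _ (hb g).1, h]
  have hcard : Nat.card (G →* Fˣ) = Module.finrank F K := by
    rw [Nat.card_congr d.toEquiv, Module.finrank_eq_nat_card_basis b]
  have hle : Nat.card (K ≃ₐ[F] K) ≤ Nat.card (G →* Fˣ) := by
    rw [hcard, Nat.card_eq_fintype_card]
    exact AlgEquiv.card_le
  have hbij : Function.Bijective f :=
    hinj.bijective_of_nat_card_le hle
  let e := MulEquiv.ofBijective f hbij
  exact ⟨IsGalois.of_card_aut_eq_finrank F K ((Nat.card_congr e.toEquiv).symm.trans hcard),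
    ⟨e, hf⟩, ⟨e.symm.trans d⟩⟩
end
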